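/- arXiv:1306.1278 — 2 statements merged into one kernel-verified Lean document; each statement's English description precedes it below -/
import Mathlib

section
/- Let α : ℝ → ℝ be continuous and positive, L > 0, and define B(ξ) = ∫₀^ξ s α(s) ds. The following are equivalent: (i) for every M > 0 and every t > 0 there exists a constant C = C(t, M) (depending also on α and L) such that every L-periodic regular solution u of ∂_t u = α(∂_x u) ∂²_x u on ℝ × [0,t] with sup|u| ≤ M satisfies |∂_x u(z,t)| ≤ C for all z ∈ ℝ; (ii) B(ξ) → ∞ as ξ → +∞ and as ξ → −∞. -/
open Set Real Filter

/-- Partial derivative in the spatial variable. -/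
noncomputable def pderivX (u : ℝ → ℝ → ℝ) (x t : ℝ) : ℝ := deriv (fun y => u y t) x

/-- Second partial derivative in the spatial variable. -/
noncomputable def pderivXX (u : ℝ → ℝ → ℝ) (x t : ℝ) : ℝ := deriv (fun y => pderivX u y t) x

/-- Partial derivative in the time variable. -/
noncomputable def pderivT (u : ℝ → ℝ → ℝ) (x t : ℝ) : ℝ := deriv (fun s => u x s) t

/-- `u` is regular on `S`: it is continuous, has spatial derivatives up to second order and a
first time derivative on `S`, and these are continuous on `S`. -/
def RegularOn (u : ℝ → ℝ → ℝ) (S : Set (ℝ × ℝ)) : Prop :=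
  ContinuousOn (fun p : ℝ × ℝ => u p.1 p.2) S ∧
  (∀ p ∈ S, DifferentiableAt ℝ (fun y => u y p.2) p.1) ∧
  (∀ p ∈ S, DifferentiableAt ℝ (fun y => pderivX u y p.2) p.1) ∧
  (∀ p ∈ S, DifferentiableAt ℝ (fun s => u p.1 s) p.2) ∧
  ContinuousOn (fun p : ℝ × ℝ => pderivX u p.1 p.2) S ∧
  ContinuousOn (fun p : ℝ × ℝ => pderivXX u p.1 p.2) S ∧
  ContinuousOn (fun p : ℝ × ℝ => pderivT u p.1 p.2) S

open MeasureTheory Topology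

section Grid

variable {N : ℕ} [NeZero N]

/-- Forward difference quotient on the cyclic grid with spacing `h`. -/
noncomputable def fwd (h : ℝ) (f : ZMod N → ℝ) (i : ZMod N) : ℝ := (f (i + 1) - f i) / h

/-- Backward difference quotient on the cyclic grid with spacing `h`. -/
noncomputable def bwd (h : ℝ) (f : ZMod N → ℝ) (i : ZMod N) : ℝ := (f i - f (i - 1)) / h

/-- The square of the discrete `L²` norm on the cyclic grid with spacing `h`. -/
noncomputable def gsq (h : ℝ) (f : ZMod N → ℝ) : ℝ := h * ∑ i, f i ^ 2

theorem gsq_nonneg {h : ℝ} (hh : 0 < h) (f : ZMod N → ℝ) : 0 ≤ gsq h f :=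
  mul_nonneg hh.le (Finset.sum_nonneg fun _ _ => sq_nonneg _)

theorem sum_bwd_mul (h : ℝ) (F g : ZMod N → ℝ) :
    ∑ i, bwd h F i * g i = -∑ i, F i * fwd h g i := by
  have h1 : ∑ i, F (i - 1) * g i = ∑ i, F i * g (i + 1) := by
    rw [← Equiv.sum_comp (Equiv.addRight (1 : ZMod N))]
    simp
  have h2 : ∀ i, bwd h F i * g i = (F i * g i - F (i - 1) * g i) / h := fun i => by
    unfold bwd; ring
  have h3 : ∀ i, F i * fwd h g i = (F i * g (i + 1) - F i * g i) / h := fun i => by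
    unfold fwd; ring
  simp only [h2, h3, ← Finset.sum_div, Finset.sum_sub_distrib, h1]
  ring

theorem sum_range_shift_le (g : ZMod N → ℝ) (hg : ∀ i, 0 ≤ g i) (i : ZMod N) {k : ℕ}
    (hk : k ≤ N) : ∑ l ∈ Finset.range k, g (i + l) ≤ ∑ j, g j := by
  have hinj : Set.InjOn (fun l : ℕ => i + (l : ZMod N)) (Finset.range k) := by
    intro x hx y hy hxy
    simp only [Finset.coe_range, Set.mem_Iio] at hx hy
    have := add_left_cancel hxy
    rw [ZMod.natCast_eq_natCast_iff'] at this
    rwa [Nat.mod_eq_of_lt (by omega), Nat.mod_eq_of_lt (by omega)] at this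
  rw [← Finset.sum_image (f := g) hinj]
  exact Finset.sum_le_sum_of_subset_of_nonneg (Finset.subset_univ _) fun j _ _ => hg j

theorem sub_eq_sum_range_fwd {h : ℝ} (hh : h ≠ 0) (f : ZMod N → ℝ) (i : ZMod N) (k : ℕ) :
    f (i + k) - f i = ∑ l ∈ Finset.range k, h * fwd h f (i + l) := by
  induction k with
  | zero => simp
  | succ k ih =>
    rw [Finset.sum_range_succ, ← ih]
    unfold fwd
    push_cast
    rw [← add_assoc]
    field_simp
    ring

theorem sq_sub_le_gsq_fwd {h : ℝ} (hh : 0 < h) (f : ZMod N → ℝ) (i : ZMod N) {k : ℕ}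
    (hk : k ≤ N) : (f (i + k) - f i) ^ 2 ≤ k * h * gsq h (fwd h f) := by
  rw [sub_eq_sum_range_fwd hh.ne']
  calc (∑ l ∈ Finset.range k, h * fwd h f (i + l)) ^ 2
      ≤ k * ∑ l ∈ Finset.range k, (h * fwd h f (i + l)) ^ 2 := by
        have := sq_sum_le_card_mul_sum_sq (s := Finset.range k)
          (f := fun l : ℕ => h * fwd h f (i + l))
        simpa using this
    _ ≤ k * ∑ j, (h * fwd h f j) ^ 2 := by
        gcongr
        exact sum_range_shift_le (fun j => (h * fwd h f j) ^ 2) (fun _ => sq_nonneg _) i hk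
    _ = k * h * gsq h (fwd h f) := by
        simp only [gsq, mul_pow, ← Finset.mul_sum]
        ring

theorem sub_le_sum_abs_fwd {h : ℝ} (hh : 0 < h) (f : ZMod N → ℝ) (i j : ZMod N) :
    f i - f j ≤ h * ∑ l, |fwd h f l| := by
  have hk : (i - j).val ≤ N := (ZMod.val_lt _).le
  have hij : i = j + ((i - j).val : ZMod N) := by simp
  calc f i - f j = f (j + ((i - j).val : ZMod N)) - f j := by rw [← hij]
    _ = ∑ l ∈ Finset.range (i - j).val, h * fwd h f (j + l) := sub_eq_sum_range_fwd hh.ne' _ _ _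
    _ ≤ ∑ l ∈ Finset.range (i - j).val, h * |fwd h f (j + l)| := by
        gcongr; exact le_abs_self _
    _ ≤ ∑ l, h * |fwd h f l| :=
        sum_range_shift_le (fun l => h * |fwd h f l|) (fun _ => by positivity) j hk
    _ = _ := by rw [Finset.mul_sum]

/-- A discrete Agmon inequality. -/
theorem sq_le_gsq_add {h L : ℝ} (hh : 0 < h) (hL : N * h = L) (d : ZMod N → ℝ) (i : ZMod N)
    {η : ℝ} (hη : 0 < η) :
    d i ^ 2 ≤ gsq h d / L + η * gsq h d + gsq h (fwd h d) / η := by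
  obtain ⟨j, -, hj⟩ := Finset.exists_min_image Finset.univ (fun j => d j ^ 2) ⟨i, Finset.mem_univ i⟩
  have hNpos : (0 : ℝ) < N := by exact_mod_cast NeZero.pos N
  have hLpos : 0 < L := hL ▸ mul_pos hNpos hh
  have h1 : d j ^ 2 ≤ gsq h d / L := by
    rw [le_div_iff₀ hLpos, gsq, ← hL]
    have := Finset.card_nsmul_le_sum Finset.univ (fun l => d l ^ 2) (d j ^ 2) (fun l hl => hj l hl)
    simp only [Finset.card_univ, ZMod.card, nsmul_eq_mul] at this
    nlinarith
  have h2 := sub_le_sum_abs_fwd hh (fun l => d l ^ 2) i j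
  have h3 : ∀ l, |fwd h (fun l => d l ^ 2) l| ≤
      fwd h d l ^ 2 / η + η * (d l ^ 2 / 2 + d (l + 1) ^ 2 / 2) := by
    intro l
    have e : fwd h (fun l => d l ^ 2) l = fwd h d l * (d l + d (l + 1)) := by
      unfold fwd; ring
    rw [e, abs_le]
    set x := fwd h d l
    have hx : x ^ 2 / η = (x / η) ^ 2 * η := by field_simp
    have hx' : x = x / η * η := by field_simp
    rw [hx]
    set y := x / η
    rw [hx']
    constructor <;>
    nlinarith [mul_nonneg hη.le (sq_nonneg (y + d l)), mul_nonneg hη.le (sq_nonneg (y - d l)),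
      mul_nonneg hη.le (sq_nonneg (y + d (l+1))), mul_nonneg hη.le (sq_nonneg (y - d (l+1)))]
  have h4 : ∑ l, d (l + 1) ^ 2 = ∑ l, d l ^ 2 :=
    Equiv.sum_comp (Equiv.addRight (1 : ZMod N)) fun l => d l ^ 2
  have h5 : h * ∑ l, |fwd h (fun l => d l ^ 2) l| ≤ η * gsq h d + gsq h (fwd h d) / η := by
    calc h * ∑ l, |fwd h (fun l => d l ^ 2) l|
        ≤ h * ∑ l, (fwd h d l ^ 2 / η + η * (d l ^ 2 / 2 + d (l + 1) ^ 2 / 2)) := by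
          gcongr with l; exact h3 l
      _ = _ := by
          rw [Finset.sum_add_distrib, ← Finset.mul_sum, Finset.sum_add_distrib,
            ← Finset.sum_div, ← Finset.sum_div, ← Finset.sum_div, h4]
          unfold gsq; ring
  linarith

end Grid

section Linear

variable {N : ℕ} [NeZero N]

/-- `q` solves the linear semidiscrete equation `∂ₜ q = D⁻ (a D⁺ q)` on `[0, T]`, with
ellipticity constants `lam` and `Lam`. -/
structure LinFlow (h lam Lam T : ℝ) (a q : ℝ → ZMod N → ℝ) : Prop where
  ell : ∀ t ∈ Icc 0 T, ∀ i, lam ≤ a t i ∧ a t i ≤ Lam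
  cont : ∀ i, ContinuousOn (fun t => a t i) (Icc 0 T)
  flow : ∀ t ∈ Icc 0 T, ∀ i,
    HasDerivAt (fun s => q s i) (bwd h (fun j => a t j * fwd h (q t) j) i) t

theorem hasDerivAt_fwd {h t : ℝ} {f : ℝ → ZMod N → ℝ} {f' : ZMod N → ℝ}
    (hf : ∀ i, HasDerivAt (fun s => f s i) (f' i) t) (i : ZMod N) :
    HasDerivAt (fun s => fwd h (f s) i) (fwd h f' i) t :=
  ((hf (i + 1)).sub (hf i)).div_const h

theorem hasDerivAt_gsq_of_flux {h t : ℝ} {f : ℝ → ZMod N → ℝ} {G : ZMod N → ℝ}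
    (hf : ∀ i, HasDerivAt (fun s => f s i) (bwd h G i) t) :
    HasDerivAt (fun s => gsq h (f s)) (-(2 * (h * ∑ i, G i * fwd h (f t) i))) t := by
  have h1 : HasDerivAt (fun s => gsq h (f s)) (h * ∑ i, (2 * f t i * bwd h G i)) t := by
    unfold gsq
    refine HasDerivAt.const_mul h (HasDerivAt.fun_sum fun i _ => ?_)
    simpa using (hf i).fun_pow 2
  convert h1 using 1
  have := sum_bwd_mul h G (f t)
  have e : ∑ i, (2 * f t i * bwd h G i) = 2 * ∑ i, bwd h G i * f t i := by
    rw [Finset.mul_sum]; exact Finset.sum_congr rfl fun i _ => by ring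
  rw [e, this]; ring

theorem continuousOn_gsq_fwd {h : ℝ} {f : ℝ → ZMod N → ℝ} {s : Set ℝ}
    (hf : ∀ i, ContinuousOn (fun t => f t i) s) :
    ContinuousOn (fun t => gsq h (fwd h (f t))) s := by
  unfold gsq fwd
  exact continuousOn_const.mul (continuousOn_finsetSum _ fun i _ =>
    (((hf (i + 1)).sub (hf i)).div_const h).pow 2)

theorem gsq_fwd_sub_le {h : ℝ} (hh : 0 < h) (f g : ZMod N → ℝ) :
    gsq h (fwd h (fun i => f i - g i)) ≤ 2 * gsq h (fwd h f) + 2 * gsq h (fwd h g) := by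
  unfold gsq
  have : ∑ i, fwd h (fun i => f i - g i) i ^ 2 ≤ ∑ i, (2 * fwd h f i ^ 2 + 2 * fwd h g i ^ 2) := by
    refine Finset.sum_le_sum fun i _ => ?_
    have e : fwd h (fun i => f i - g i) i = fwd h f i - fwd h g i := by unfold fwd; ring
    rw [e]
    nlinarith [sq_nonneg (fwd h f i + fwd h g i)]
  rw [Finset.sum_add_distrib, ← Finset.mul_sum, ← Finset.mul_sum] at this
  nlinarith

theorem intervalIntegrable_of_Icc_subset {f : ℝ → ℝ} {a b c d : ℝ} (hf : ContinuousOn f (Icc c d))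
    (hab : a ≤ b) (ha : c ≤ a) (hb : b ≤ d) : IntervalIntegrable f volume a b :=
  (hf.mono (Icc_subset_Icc ha hb)).intervalIntegrable_of_Icc hab

/-- If `φ ≤ -g'` then `∫ φ ≤ g a - g b`. -/
theorem integral_le_sub_of_le_neg_deriv {g g' φ : ℝ → ℝ} {a b : ℝ} (hab : a ≤ b)
    (hg : ∀ x ∈ Icc a b, HasDerivAt g (g' x) x) (hφ : ContinuousOn φ (Icc a b))
    (hle : ∀ x ∈ Icc a b, φ x ≤ -g' x) : ∫ x in a..b, φ x ≤ g a - g b := by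
  have := intervalIntegral.integral_le_sub_of_hasDeriv_right_of_le hab (g := fun x => -g x)
    (g' := fun x => -g' x) (φ := φ)
    (fun x hx => (hg x hx).neg.continuousAt.continuousWithinAt)
    (fun x hx => (hg x (Ioo_subset_Icc_self hx)).neg.hasDerivWithinAt)
    (hφ.integrableOn_Icc) (fun x hx => hle x (Ioo_subset_Icc_self hx))
  linarith

namespace LinFlow

variable {h lam Lam T : ℝ} {a q : ℝ → ZMod N → ℝ}

theorem continuousOn (H : LinFlow h lam Lam T a q) (i : ZMod N) :
    ContinuousOn (fun t => q t i) (Icc 0 T) :=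
  fun t ht => (H.flow t ht i).continuousAt.continuousWithinAt

theorem energy (H : LinFlow h lam Lam T a q) (hh : 0 < h) {s t : ℝ} (hs : 0 ≤ s) (hst : s ≤ t)
    (ht : t ≤ T) :
    ∫ x in s..t, 2 * lam * gsq h (fwd h (q x)) ≤ gsq h (q s) - gsq h (q t) := by
  refine integral_le_sub_of_le_neg_deriv hst
    (fun x hx => hasDerivAt_gsq_of_flux (H.flow x ⟨hs.trans hx.1, hx.2.trans ht⟩))
    (continuousOn_const.mul
      ((continuousOn_gsq_fwd H.continuousOn).mono (Icc_subset_Icc hs ht))) fun x hx => ?_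
  have : lam * ∑ i, fwd h (q x) i ^ 2 ≤ ∑ i, a x i * fwd h (q x) i * fwd h (q x) i := by
    rw [Finset.mul_sum]
    refine Finset.sum_le_sum fun i _ => ?_
    have := (H.ell x ⟨hs.trans hx.1, hx.2.trans ht⟩ i).1
    nlinarith [sq_nonneg (fwd h (q x) i)]
  unfold gsq
  nlinarith

end LinFlow

theorem exists_frozen_flow (h : ℝ) (A z₀ : ZMod N → ℝ) (s : ℝ) :
    ∃ z : ℝ → ZMod N → ℝ, z s = z₀ ∧ ∀ t i,
      HasDerivAt (fun x => z x i) (bwd h (fun j => A j * fwd h (z t) j) i) t := by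
  let M₀ : (ZMod N → ℝ) →ₗ[ℝ] (ZMod N → ℝ) :=
    { toFun := fun f => bwd h (fun j => A j * fwd h f j)
      map_add' := fun f g => by ext i; simp only [bwd, fwd, Pi.add_apply]; ring
      map_smul' := fun c f => by
        ext i; simp only [bwd, fwd, Pi.smul_apply, smul_eq_mul, RingHom.id_apply]; ring }
  let M : (ZMod N → ℝ) →L[ℝ] (ZMod N → ℝ) := M₀.toContinuousLinearMap
  refine ⟨fun t => NormedSpace.exp ((t - s) • M) z₀, by simp, fun t i => ?_⟩
  have h1 := (hasDerivAt_exp_smul_const' (𝕂 := ℝ) M (t - s)).comp_sub_const t s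
  have h2 := (h1.clm_apply (hasDerivAt_const t z₀))
  have h3 := (hasDerivAt_pi.1 h2) i
  refine h3.congr_deriv ?_
  simp only [map_zero, add_zero]
  rfl

/-- Comparison with the flow whose coefficients are frozen at time `T₁ - R`. -/
theorem LinFlow.integral_decay {h lam Lam T : ℝ} {a q : ℝ → ZMod N → ℝ}
    (H : LinFlow h lam Lam T a q) (hh : 0 < h) (hlam : 0 < lam) {T₁ R ρ ω : ℝ} (hρ : 0 < ρ)
    (hρR : ρ < R) (hR : R ≤ T₁) (hT₁ : T₁ ≤ T) (hω : 0 ≤ ω) (hωlam : ω ≤ lam)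
    (ha : ∀ t ∈ Icc (T₁ - R) T₁, ∀ i, |a t i - a (T₁ - R) i| ≤ ω) :
    ∫ t in (T₁ - ρ)..T₁, gsq h (fwd h (q t)) ≤
      (8 * (Lam / lam) * (ρ / (R - ρ)) + 2 * (ω / lam) ^ 2) *
        ∫ t in (T₁ - R)..T₁, gsq h (fwd h (q t)) := by
  set s := T₁ - R with hs
  have hs0 : 0 ≤ s := by linarith
  have hsT : s ≤ T₁ := by linarith
  have hsub : Icc s T₁ ⊆ Icc 0 T := Icc_subset_Icc hs0 hT₁
  have hsm : s ∈ Icc s T₁ := ⟨le_rfl, hsT⟩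
  obtain ⟨z, hz0, hz⟩ := exists_frozen_flow h (a s) (q s) s
  have ella := H.ell s (hsub hsm)
  set Y : ℝ → ℝ := fun t => gsq h (fwd h (q t)) with hY
  set X : ℝ → ℝ := fun t => gsq h (fwd h (fun i => q t i - z t i)) with hX
  set W : ℝ → ℝ := fun t => gsq h (fwd h (z t)) with hW
  set V : ℝ → ℝ := fun t => h * ∑ i, a s i * fwd h (z t) i ^ 2 with hV
  have hzc : ∀ i, ContinuousOn (fun t => z t i) (Icc s T₁) :=
    fun i t _ => (hz t i).continuousAt.continuousWithinAt
  have hqc : ∀ i, ContinuousOn (fun t => q t i) (Icc s T₁) :=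
    fun i => (H.continuousOn i).mono hsub
  have Yc : ContinuousOn Y (Icc s T₁) := continuousOn_gsq_fwd hqc
  have Wc : ContinuousOn W (Icc s T₁) := continuousOn_gsq_fwd hzc
  have Xc : ContinuousOn X (Icc s T₁) := continuousOn_gsq_fwd fun i => (hqc i).sub (hzc i)
  have hVd : ∀ t, HasDerivAt V
      (-(2 * (h * ∑ i, bwd h (fun j => a s j * fwd h (z t) j) i ^ 2))) t := by
    intro t
    have h1 : HasDerivAt V (h * ∑ i, a s i * (2 * fwd h (z t) i *
        fwd h (bwd h (fun j => a s j * fwd h (z t) j)) i)) t := by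
      refine HasDerivAt.const_mul h (HasDerivAt.fun_sum fun i _ => HasDerivAt.const_mul _ ?_)
      simpa using (hasDerivAt_fwd (h := h) (hz t) i).fun_pow 2
    convert h1 using 1
    have := sum_bwd_mul h (fun j => a s j * fwd h (z t) j) (bwd h (fun j => a s j * fwd h (z t) j))
    have e : ∑ i, a s i * (2 * fwd h (z t) i * fwd h (bwd h (fun j => a s j * fwd h (z t) j)) i)
        = 2 * ∑ i, a s i * fwd h (z t) i * fwd h (bwd h (fun j => a s j * fwd h (z t) j)) i := by
      rw [Finset.mul_sum]; exact Finset.sum_congr rfl fun i _ => by ring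
    rw [e]
    simp only [sq]
    rw [this]
    ring
  have hVanti : Antitone V := by
    refine antitone_of_deriv_nonpos (fun t => (hVd t).differentiableAt) fun t => ?_
    rw [(hVd t).deriv]
    have : 0 ≤ ∑ i, bwd h (fun j => a s j * fwd h (z t) j) i ^ 2 :=
      Finset.sum_nonneg fun _ _ => sq_nonneg _
    have := mul_nonneg hh.le this
    linarith
  have Vc : ContinuousOn V (Icc s T₁) := fun t _ => (hVd t).continuousAt.continuousWithinAt
  have hVW : ∀ t, lam * W t ≤ V t ∧ V t ≤ Lam * W t := by
    intro t
    have h1 : lam * ∑ i, fwd h (z t) i ^ 2 ≤ ∑ i, a s i * fwd h (z t) i ^ 2 := by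
      rw [Finset.mul_sum]
      exact Finset.sum_le_sum fun i _ => mul_le_mul_of_nonneg_right (ella i).1 (sq_nonneg _)
    have h2 : ∑ i, a s i * fwd h (z t) i ^ 2 ≤ Lam * ∑ i, fwd h (z t) i ^ 2 := by
      rw [Finset.mul_sum]
      exact Finset.sum_le_sum fun i _ => mul_le_mul_of_nonneg_right (ella i).2 (sq_nonneg _)
    simp only [hV, hW, gsq]
    constructor <;> nlinarith
  have hYXW : ∀ t, Y t ≤ 2 * X t + 2 * W t := by
    intro t
    have := gsq_fwd_sub_le hh (fun i => q t i - z t i) (fun i => - z t i)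
    have e : gsq h (fwd h fun i => - z t i) = W t := by
      simp only [hW, gsq, fwd]; congr 1
      exact Finset.sum_congr rfl fun i _ => by ring
    rw [e] at this
    simpa using this
  have hWYX : ∀ t, W t ≤ 2 * Y t + 2 * X t := by
    intro t
    have := gsq_fwd_sub_le hh (fun i => q t i) (fun i => q t i - z t i)
    simpa using this
  have hX0 : ∀ t, 0 ≤ X t := fun t => gsq_nonneg hh _
  have hW0 : ∀ t, 0 ≤ W t := fun t => gsq_nonneg hh _
  have hY0 : ∀ t, 0 ≤ Y t := fun t => gsq_nonneg hh _
  have hV0 : ∀ t, 0 ≤ V t := fun t => (mul_nonneg hlam.le (hW0 t)).trans (hVW t).1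
  -- the energy estimate for the difference
  have hJ : ∫ t in s..T₁, (lam * X t - ω ^ 2 / lam * Y t) ≤ 0 := by
    have := integral_le_sub_of_le_neg_deriv (g := fun t => gsq h (fun i => q t i - z t i))
      (g' := fun t => -(2 * (h * ∑ i, (a t i * fwd h (q t) i - a s i * fwd h (z t) i) *
        fwd h (fun i => q t i - z t i) i)))
      (φ := fun t => lam * X t - ω ^ 2 / lam * Y t) hsT
      (fun t ht => hasDerivAt_gsq_of_flux (f := fun t i => q t i - z t i) fun i => by
        refine ((H.flow t (hsub ht) i).fun_sub (hz t i)).congr_deriv ?_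
        unfold bwd; ring)
      ((continuousOn_const.mul Xc).sub (continuousOn_const.mul Yc))
      (fun t ht => by
        have key : ∑ i, (lam * fwd h (fun i => q t i - z t i) i ^ 2
            - ω ^ 2 / lam * fwd h (q t) i ^ 2) ≤
            ∑ i, 2 * ((a t i * fwd h (q t) i - a s i * fwd h (z t) i) *
              fwd h (fun i => q t i - z t i) i) := by
          refine Finset.sum_le_sum fun i _ => ?_
          have e : fwd h (z t) i = fwd h (q t) i - fwd h (fun i => q t i - z t i) i := by
            unfold fwd; ring
          rw [e]
          set r := fwd h (q t) i
          set δ := fwd h (fun i => q t i - z t i) i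
          have h1 := abs_le.1 (ha t ht i)
          have h2 := (ella i).1
          set b := a t i - a s i
          have e2 : a t i = a s i + b := by simp [b]
          rw [e2]
          have h3 : b ^ 2 ≤ ω ^ 2 := by nlinarith
          have h4 : b ^ 2 / lam * r ^ 2 ≤ ω ^ 2 / lam * r ^ 2 := by gcongr
          have h5 : 0 ≤ lam * (δ + b / lam * r) ^ 2 := by positivity
          have h6 : lam * (δ + b / lam * r) ^ 2 = lam * δ ^ 2 + 2 * b * r * δ + b ^ 2 / lam * r ^ 2 := by
            field_simp
            ring
          nlinarith [mul_le_mul_of_nonneg_right h2 (sq_nonneg δ)]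
        rw [Finset.sum_sub_distrib, ← Finset.mul_sum, ← Finset.mul_sum, ← Finset.mul_sum] at key
        simp only [hX, hY, gsq]
        nlinarith)
    refine this.trans ?_
    have h1 : gsq h (fun i => q s i - z s i) = 0 := by simp [hz0, gsq]
    have h2 := gsq_nonneg hh (fun i => q T₁ i - z T₁ i)
    linarith
  have ii : ∀ {f : ℝ → ℝ}, ContinuousOn f (Icc s T₁) → ∀ {c d : ℝ}, s ≤ c → c ≤ d → d ≤ T₁ →
      IntervalIntegrable f volume c d := fun hf _ _ h1 h2 h3 =>
    intervalIntegrable_of_Icc_subset hf h2 h1 h3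
  have b1 : s ≤ T₁ - ρ := by linarith
  have b2 : T₁ - ρ ≤ T₁ := by linarith
  rw [intervalIntegral.integral_sub ((ii Xc le_rfl hsT le_rfl).const_mul _)
    ((ii Yc le_rfl hsT le_rfl).const_mul _), intervalIntegral.integral_const_mul,
    intervalIntegral.integral_const_mul] at hJ
  set I := ∫ t in s..T₁, Y t
  set J := ∫ t in s..T₁, X t
  have hI0 : 0 ≤ I := intervalIntegral.integral_nonneg hsT fun t _ => hY0 t
  have hJI : J ≤ (ω / lam) ^ 2 * I := by
    have : lam * J ≤ lam * ((ω / lam) ^ 2 * I) := by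
      have e : lam * ((ω / lam) ^ 2 * I) = ω ^ 2 / lam * I := by field_simp
      rw [e]; linarith
    exact le_of_mul_le_mul_left this hlam
  have hJI' : J ≤ I := by
    have : (ω / lam) ^ 2 ≤ 1 := pow_le_one₀ (by positivity) ((div_le_one hlam).2 hωlam)
    nlinarith
  have hVI : ∫ t in s..T₁, V t ≤ Lam * (2 * I + 2 * J) := by
    have hLam : 0 ≤ Lam := hlam.le.trans ((ella 0).1.trans (ella 0).2)
    calc ∫ t in s..T₁, V t ≤ ∫ t in s..T₁, Lam * (2 * Y t + 2 * X t) := by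
          refine intervalIntegral.integral_mono_on hsT (ii Vc le_rfl hsT le_rfl)
            (ii (continuousOn_const.mul ((continuousOn_const.mul Yc).add
              (continuousOn_const.mul Xc))) le_rfl hsT le_rfl) fun t _ => ?_
          exact (hVW t).2.trans (mul_le_mul_of_nonneg_left (hWYX t) hLam)
      _ = Lam * (2 * I + 2 * J) := by
          rw [intervalIntegral.integral_const_mul, intervalIntegral.integral_add
            ((ii Yc le_rfl hsT le_rfl).const_mul _) ((ii Xc le_rfl hsT le_rfl).const_mul _),
            intervalIntegral.integral_const_mul, intervalIntegral.integral_const_mul]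
  have hV1 : (R - ρ) * V (T₁ - ρ) ≤ ∫ t in s..T₁, V t := by
    have h1 : ∫ t in s..(T₁ - ρ), V (T₁ - ρ) ≤ ∫ t in s..(T₁ - ρ), V t :=
      intervalIntegral.integral_mono_on b1 (by simp) (ii Vc le_rfl b1 b2)
        fun t ht => hVanti ht.2
    have h2 := intervalIntegral.integral_add_adjacent_intervals (ii Vc le_rfl b1 b2)
      (ii Vc b1 b2 le_rfl)
    have h3 : 0 ≤ ∫ t in (T₁ - ρ)..T₁, V t :=
      intervalIntegral.integral_nonneg b2 fun t _ => hV0 t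
    simp only [intervalIntegral.integral_const, smul_eq_mul] at h1
    have : T₁ - ρ - s = R - ρ := by rw [hs]; ring
    rw [this] at h1
    linarith
  have hV2 : ∫ t in (T₁ - ρ)..T₁, V t ≤ ρ * V (T₁ - ρ) := by
    have h1 : ∫ t in (T₁ - ρ)..T₁, V t ≤ ∫ t in (T₁ - ρ)..T₁, V (T₁ - ρ) :=
      intervalIntegral.integral_mono_on b2 (ii Vc b1 b2 le_rfl) (by simp)
        fun t ht => hVanti ht.1
    simpa using h1
  have hW1 : ∫ t in (T₁ - ρ)..T₁, W t ≤ 4 * (Lam / lam) * (ρ / (R - ρ)) * I := by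
    have h1 : lam * ∫ t in (T₁ - ρ)..T₁, W t ≤ ∫ t in (T₁ - ρ)..T₁, V t := by
      rw [← intervalIntegral.integral_const_mul]
      exact intervalIntegral.integral_mono_on b2 (ii (continuousOn_const.mul Wc) b1 b2 le_rfl)
        (ii Vc b1 b2 le_rfl) fun t _ => (hVW t).1
    have hLam : 0 ≤ Lam := hlam.le.trans ((ella 0).1.trans (ella 0).2)
    have h2 : V (T₁ - ρ) ≤ Lam * (4 * I) / (R - ρ) := by
      rw [le_div_iff₀ (by linarith)]
      nlinarith
    have h3 : lam * ∫ t in (T₁ - ρ)..T₁, W t ≤ lam * (4 * (Lam / lam) * (ρ / (R - ρ)) * I) := by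
      have e : lam * (4 * (Lam / lam) * (ρ / (R - ρ)) * I) = ρ * (Lam * (4 * I) / (R - ρ)) := by
        field_simp
      rw [e]
      nlinarith
    exact le_of_mul_le_mul_left h3 hlam
  have hXρ : ∫ t in (T₁ - ρ)..T₁, X t ≤ J := by
    have h2 := intervalIntegral.integral_add_adjacent_intervals (ii Xc le_rfl b1 b2)
      (ii Xc b1 b2 le_rfl)
    have h3 : 0 ≤ ∫ t in s..(T₁ - ρ), X t :=
      intervalIntegral.integral_nonneg b1 fun t _ => hX0 t
    linarith
  calc ∫ t in (T₁ - ρ)..T₁, Y t ≤ ∫ t in (T₁ - ρ)..T₁, (2 * X t + 2 * W t) :=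
        intervalIntegral.integral_mono_on b2 (ii Yc b1 b2 le_rfl)
          (ii ((continuousOn_const.mul Xc).add (continuousOn_const.mul Wc)) b1 b2 le_rfl)
          fun t _ => hYXW t
    _ = 2 * (∫ t in (T₁ - ρ)..T₁, X t) + 2 * ∫ t in (T₁ - ρ)..T₁, W t := by
        rw [intervalIntegral.integral_add ((ii Xc b1 b2 le_rfl).const_mul _)
          ((ii Wc b1 b2 le_rfl).const_mul _), intervalIntegral.integral_const_mul,
          intervalIntegral.integral_const_mul]
    _ ≤ (8 * (Lam / lam) * (ρ / (R - ρ)) + 2 * (ω / lam) ^ 2) * I := by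
        nlinarith

end Linear

section LinearRegularity

variable {N : ℕ} [NeZero N] {h lam Lam T : ℝ} {a q : ℝ → ZMod N → ℝ}

theorem LinFlow.integral_geometric_decay (H : LinFlow h lam Lam T a q) (hh : 0 < h)
    (hlam : 0 < lam) (hLam : lam ≤ Lam) {r R T₁ : ℝ} (hr : r = lam / (32 * Lam)) (hR : 0 < R)
    (hT₁ : T₁ ∈ Icc R T)
    (ha : ∀ s ∈ Icc 0 T, ∀ t ∈ Icc 0 T, |t - s| ≤ R → ∀ i, |a t i - a s i| ≤ lam * r ^ 3 / 2)
    (k : ℕ) :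
    ∫ t in (T₁ - R * r ^ (8 * k))..T₁, gsq h (fwd h (q t)) ≤
      r ^ (6 * k) * ∫ t in (T₁ - R)..T₁, gsq h (fwd h (q t)) := by
  have hLam0 : 0 < Lam := hlam.trans_le hLam
  have hr0 : 0 < r := by rw [hr]; positivity
  have hr1 : r ≤ 1 / 32 := by
    rw [hr, div_le_div_iff₀ (by positivity) (by norm_num)]; linarith
  have hrLam : Lam / lam * r = 1 / 32 := by rw [hr]; field_simp
  have hr8 : r ^ 8 ≤ 1 / 2 :=
    (pow_le_pow_left₀ hr0.le (hr1.trans (by norm_num : (1:ℝ)/32 ≤ 1/2)) 8).trans (by norm_num)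
  induction k with
  | zero => simp
  | succ k ih =>
    set ρ := R * r ^ (8 * k) with hρ
    have hρ0 : 0 < ρ := by positivity
    have hρR : ρ ≤ R := mul_le_of_le_one_right hR.le (pow_le_one₀ hr0.le (by linarith))
    have e : R * r ^ (8 * (k + 1)) = ρ * r ^ 8 := by rw [hρ]; ring
    rw [e]
    have h8 : 0 < r ^ 8 := by positivity
    have h3 : r ^ 3 ≤ 1 := pow_le_one₀ hr0.le (by linarith)
    have step := H.integral_decay hh hlam (T₁ := T₁) (R := ρ) (ρ := ρ * r ^ 8)
      (ω := lam * r ^ 3 / 2) (by positivity) (by nlinarith) (hρR.trans hT₁.1) hT₁.2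
      (by positivity) (by nlinarith)
      (fun t ht i => ha _ ⟨by linarith [hT₁.1], by linarith [hT₁.2]⟩ t
        ⟨by linarith [hT₁.1, ht.1], ht.2.trans hT₁.2⟩
        (by rw [abs_le]; constructor <;> linarith [ht.1, ht.2]) i)
    have hI : 0 ≤ ∫ t in (T₁ - ρ)..T₁, gsq h (fwd h (q t)) :=
      intervalIntegral.integral_nonneg (by linarith) fun t _ => gsq_nonneg hh _
    have hc : 8 * (Lam / lam) * (ρ * r ^ 8 / (ρ - ρ * r ^ 8)) + 2 * (lam * r ^ 3 / 2 / lam) ^ 2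
        ≤ r ^ 6 := by
      have e1 : ρ * r ^ 8 / (ρ - ρ * r ^ 8) = r ^ 8 / (1 - r ^ 8) := by
        rw [show ρ - ρ * r ^ 8 = ρ * (1 - r ^ 8) by ring, mul_div_mul_left _ _ hρ0.ne']
      have e2 : 2 * (lam * r ^ 3 / 2 / lam) ^ 2 = r ^ 6 / 2 := by field_simp
      have e3 : r ^ 8 / (1 - r ^ 8) ≤ 2 * r ^ 8 := by
        rw [div_le_iff₀ (by linarith)]; nlinarith
      rw [e1, e2]
      have e4 : 8 * (Lam / lam) * (r ^ 8 / (1 - r ^ 8)) ≤ 8 * (Lam / lam) * (2 * r ^ 8) := by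
        gcongr
      have e5 : 8 * (Lam / lam) * (2 * r ^ 8) = r ^ 7 / 2 := by
        calc 8 * (Lam / lam) * (2 * r ^ 8) = 16 * r ^ 7 * (Lam / lam * r) := by ring
          _ = _ := by rw [hrLam]; ring
      have e6 : r ^ 7 ≤ r ^ 6 := pow_le_pow_of_le_one hr0.le (by linarith) (by norm_num)
      linarith
    calc _ ≤ _ := step
      _ ≤ r ^ 6 * ∫ t in (T₁ - ρ)..T₁, gsq h (fwd h (q t)) := by gcongr
      _ ≤ r ^ 6 * (r ^ (6 * k) * ∫ t in (T₁ - R)..T₁, gsq h (fwd h (q t))) := by gcongr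
      _ = _ := by ring

theorem gsq_le_of_abs_le {L Q : ℝ} (hh : 0 < h) (hL : N * h = L) {f : ZMod N → ℝ}
    (hQ : ∀ i, |f i| ≤ Q) : gsq h f ≤ L * Q ^ 2 := by
  have : ∑ i, f i ^ 2 ≤ ∑ _i : ZMod N, Q ^ 2 := Finset.sum_le_sum fun i _ => by
    rw [← sq_abs]; exact pow_le_pow_left₀ (abs_nonneg _) (hQ i) 2
  simp only [Finset.sum_const, Finset.card_univ, ZMod.card, nsmul_eq_mul] at this
  rw [gsq, ← hL]
  nlinarith

theorem exists_mul_le_integral {Y : ℝ → ℝ} {c d : ℝ} (hcd : c ≤ d)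
    (hY : ContinuousOn Y (Icc c d)) : ∃ s ∈ Icc c d, (d - c) * Y s ≤ ∫ t in c..d, Y t := by
  obtain ⟨s, hs, hmin⟩ := isCompact_Icc.exists_isMinOn (nonempty_Icc.2 hcd) hY
  refine ⟨s, hs, ?_⟩
  have := intervalIntegral.integral_mono_on hcd (intervalIntegrable_const (μ := volume) (c := Y s))
    (hY.intervalIntegrable_of_Icc hcd) fun t ht => hmin ht
  simpa using this

/-- Values of a linear flow at two times of controlled Dirichlet energy are close. -/
theorem LinFlow.abs_sub_le_of_energy (H : LinFlow h lam Lam T a q) (hh : 0 < h)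
    (hlam : 0 < lam) {L r R T₁ K K₁ : ℝ} (hL : N * h = L) (hr0 : 0 < r) (hr1 : r ≤ 1)
    (hR : 0 < R) (hK : 0 ≤ K)
    (hT₁ : T₁ ∈ Icc R T) {k : ℕ}
    (hΦ : ∫ t in (T₁ - R * r ^ (8 * k))..T₁, gsq h (fwd h (q t)) ≤ K * r ^ (6 * k))
    {S₁ S₂ : ℝ} (hS₁ : S₁ ∈ Icc (T₁ - R * r ^ (8 * k)) T₁)
    (hS₂ : S₂ ∈ Icc (T₁ - R * r ^ (8 * k)) T₁)
    (hY₁ : gsq h (fwd h (q S₁)) * r ^ (2 * k) ≤ K₁)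
    (hY₂ : gsq h (fwd h (q S₂)) * r ^ (2 * k) ≤ K₁) (i : ZMod N) :
    |q S₁ i - q S₂ i| ≤
      √(Lam * (2 * R * K₁ + K / 2) / L + Lam * (2 * R * K₁ + K / 2) + 4 * K₁) * r ^ k := by
  wlog hS : S₁ ≤ S₂ generalizing S₁ S₂
  · rw [abs_sub_comm]; exact this hS₂ hS₁ hY₂ hY₁ (le_of_not_ge hS)
  set ρ := R * r ^ (8 * k) with hρ
  have hρR : ρ ≤ R := mul_le_of_le_one_right hR.le (pow_le_one₀ hr0.le hr1)
  have hNpos : (0 : ℝ) < N := by exact_mod_cast NeZero.pos N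
  have hLpos : 0 < L := hL ▸ mul_pos hNpos hh
  have hsub : Icc (T₁ - ρ) T₁ ⊆ Icc 0 T :=
    Icc_subset_Icc (by linarith [hT₁.1]) hT₁.2
  have hLam : 0 < Lam := hlam.trans_le
    ((H.ell S₁ (hsub hS₁) 0).1.trans (H.ell S₁ (hsub hS₁) 0).2)
  have hK₁ : 0 ≤ K₁ := (mul_nonneg (gsq_nonneg hh _) (by positivity)).trans hY₁
  set d : ZMod N → ℝ := fun i => q S₂ i - q S₁ i with hd
  set Y : ℝ → ℝ := fun t => gsq h (fwd h (q t)) with hY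
  have hYc : ContinuousOn Y (Icc 0 T) := continuousOn_gsq_fwd H.continuousOn
  set D := gsq h (fwd h d) with hD
  have hD0 : 0 ≤ D := gsq_nonneg hh _
  have hDle : D * r ^ (2 * k) ≤ 4 * K₁ := by
    have := gsq_fwd_sub_le hh (q S₂) (q S₁)
    have h2 : D * r ^ (2 * k) ≤ (2 * gsq h (fwd h (q S₂)) + 2 * gsq h (fwd h (q S₁))) * r ^ (2 * k) := by
      gcongr
    linarith
  have hsub2 : Icc S₁ S₂ ⊆ Icc 0 T := (Icc_subset_Icc hS₁.1 hS₂.2).trans hsub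
  have hintegrable := integral_le_sub_of_le_neg_deriv (g := fun t => h * ∑ i, d i * q t i)
    (g' := fun t => h * -∑ i, a t i * fwd h (q t) i * fwd h d i)
    (φ := fun t => -(Lam * (D / 2 + Y t / 2))) hS
    (fun t ht => by
      rw [← sum_bwd_mul h (fun j => a t j * fwd h (q t) j) d]
      refine HasDerivAt.const_mul h ?_
      have := HasDerivAt.fun_sum (u := Finset.univ)
        fun i _ => (H.flow t (hsub2 ht) i).const_mul (d i)
      refine this.congr_deriv (Finset.sum_congr rfl fun i _ => mul_comm _ _))
    ((continuousOn_const.mul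
      (continuousOn_const.add ((hYc.mono hsub2).div_const 2))).neg)
    (fun t ht => by
      have key : ∑ i, -(a t i * fwd h (q t) i * fwd h d i) ≤
          ∑ i, Lam * (fwd h d i ^ 2 / 2 + fwd h (q t) i ^ 2 / 2) := by
        refine Finset.sum_le_sum fun i _ => ?_
        have h1 := (H.ell t (hsub2 ht) i).1
        have h2 := (H.ell t (hsub2 ht) i).2
        have h3 : 0 ≤ a t i := by linarith
        nlinarith [mul_nonneg h3 (sq_nonneg (fwd h d i + fwd h (q t) i)),
          mul_nonneg (sub_nonneg.2 h2) (sq_nonneg (fwd h d i)),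
          mul_nonneg (sub_nonneg.2 h2) (sq_nonneg (fwd h (q t) i))]
      rw [Finset.sum_neg_distrib, ← Finset.mul_sum, Finset.sum_add_distrib, ← Finset.sum_div,
        ← Finset.sum_div] at key
      have := mul_le_mul_of_nonneg_left key hh.le
      simp only [hD, hY, gsq]
      linarith)
  have hYint : IntervalIntegrable Y volume S₁ S₂ :=
    (hYc.mono hsub2).intervalIntegrable_of_Icc hS
  have hYle : ∫ t in S₁..S₂, Y t ≤ K * r ^ (6 * k) := by
    refine le_trans ?_ hΦ
    refine intervalIntegral.integral_mono_interval hS₁.1 hS hS₂.2 ?_ ?_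
    · exact Eventually.of_forall fun t => gsq_nonneg hh _
    · exact intervalIntegrable_of_Icc_subset hYc (hS₁.1.trans hS₁.2) (by linarith [hT₁.1]) hT₁.2
  rw [intervalIntegral.integral_neg, intervalIntegral.integral_const_mul,
    intervalIntegral.integral_add intervalIntegrable_const (hYint.div_const 2),
    intervalIntegral.integral_const, intervalIntegral.integral_div, smul_eq_mul] at hintegrable
  have hgd : gsq h d = h * ∑ i, d i * q S₂ i - h * ∑ i, d i * q S₁ i := by
    rw [← mul_sub, ← Finset.sum_sub_distrib, gsq]
    congr 1
    exact Finset.sum_congr rfl fun i _ => by simp only [hd]; ring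
  set K₂ := Lam * (2 * R * K₁ + K / 2) with hK₂
  have hK₂0 : 0 ≤ K₂ := by positivity
  have hgd2 : gsq h d ≤ K₂ * r ^ (6 * k) := by
    have h1 : (S₂ - S₁) * (D / 2) ≤ ρ * (D / 2) := by
      gcongr; linarith [hS₁.1, hS₂.2]
    have h2 : ρ * (D / 2) = R * r ^ (6 * k) / 2 * (D * r ^ (2 * k)) := by
      rw [hρ, show 8 * k = 6 * k + 2 * k by ring, pow_add]; ring
    have h3 : R * r ^ (6 * k) / 2 * (D * r ^ (2 * k)) ≤ R * r ^ (6 * k) / 2 * (4 * K₁) := by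
      gcongr
    have h4 : Lam * ((S₂ - S₁) * (D / 2) + (∫ t in S₁..S₂, Y t) / 2) ≤
        Lam * (R * r ^ (6 * k) / 2 * (4 * K₁) + K * r ^ (6 * k) / 2) := by
      refine mul_le_mul_of_nonneg_left ?_ hLam.le
      linarith
    have h5 : Lam * (R * r ^ (6 * k) / 2 * (4 * K₁) + K * r ^ (6 * k) / 2) =
        K₂ * r ^ (6 * k) := by rw [hK₂]; ring
    linarith
  have hag := sq_le_gsq_add hh hL d i (η := (r ^ (4 * k))⁻¹) (by positivity)
  have hd2 : d i ^ 2 ≤ (K₂ / L + K₂ + 4 * K₁) * r ^ (2 * k) := by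
    have h1 : gsq h d / L ≤ K₂ / L * r ^ (2 * k) := by
      calc gsq h d / L ≤ K₂ * r ^ (6 * k) / L := by gcongr
        _ = K₂ / L * r ^ (6 * k) := by ring
        _ ≤ K₂ / L * r ^ (2 * k) := by
          gcongr ?_ * ?_
          exact pow_le_pow_of_le_one hr0.le hr1 (by omega)
    have h2 : (r ^ (4 * k))⁻¹ * gsq h d ≤ K₂ * r ^ (2 * k) := by
      rw [inv_mul_le_iff₀ (by positivity)]
      calc _ ≤ _ := hgd2
        _ = _ := by rw [show 6 * k = 4 * k + 2 * k by ring, pow_add]; ring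
    have h3 : gsq h (fwd h d) / (r ^ (4 * k))⁻¹ ≤ 4 * K₁ * r ^ (2 * k) := by
      rw [div_inv_eq_mul]
      calc gsq h (fwd h d) * r ^ (4 * k) = (D * r ^ (2 * k)) * r ^ (2 * k) := by
            rw [show 4 * k = 2 * k + 2 * k by ring, pow_add]; ring
        _ ≤ _ := by gcongr
    linarith
  rw [abs_sub_comm]
  change |d i| ≤ _
  rw [← Real.sqrt_sq (pow_nonneg hr0.le k), ← Real.sqrt_mul (by positivity)]
  refine Real.abs_le_sqrt ?_
  rw [← pow_mul, mul_comm k 2]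
  exact hd2

/-- Interior regularity for linear semidiscrete flows, uniform in the grid. -/
theorem exists_modulus_linFlow {lam Lam L Q T t₀ : ℝ} (hlam : 0 < lam) (hLam : lam ≤ Lam)
    (hL0 : 0 < L) (ht₀ : 0 < t₀) :
    ∃ ω > 0, ∀ R₀ > 0, ∀ ε > 0, ∃ δ > 0, ∀ (N : ℕ) [NeZero N] (h : ℝ) (a q : ℝ → ZMod N → ℝ),
      0 < h → N * h = L → LinFlow h lam Lam T a q → (∀ t ∈ Icc 0 T, ∀ i, |q t i| ≤ Q) →
      (∀ s ∈ Icc 0 T, ∀ t ∈ Icc 0 T, |t - s| ≤ R₀ → ∀ i, |a t i - a s i| ≤ ω) →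
      (∀ t ∈ Icc t₀ T, ∀ i, ∀ k : ℕ, k * h ≤ δ → |q t (i + k) - q t i| ≤ ε) ∧
      (∀ s ∈ Icc t₀ T, ∀ t ∈ Icc t₀ T, |t - s| ≤ δ → ∀ i, |q t i - q s i| ≤ ε) := by
  have hLam0 : 0 < Lam := hlam.trans_le hLam
  obtain ⟨r, hr⟩ : ∃ r, r = lam / (32 * Lam) := ⟨_, rfl⟩
  have hr0 : 0 < r := by rw [hr]; positivity
  have hr32 : r ≤ 1 / 32 := by
    rw [hr, div_le_div_iff₀ (by positivity) (by norm_num)]; linarith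
  have hr1 : r ≤ 1 := by linarith
  refine ⟨lam * r ^ 3 / 2, by positivity, fun R₀ hR₀ ε hε => ?_⟩
  set R := min R₀ t₀ with hRdef
  have hR : 0 < R := lt_min hR₀ ht₀
  set K := L * Q ^ 2 / (2 * lam) with hK
  have hK0 : 0 ≤ K := by positivity
  set K₁ := K / (R * r ^ 2) with hK₁
  have hK₁0 : 0 ≤ K₁ := by positivity
  set C := √(Lam * (2 * R * K₁ + K / 2) / L + Lam * (2 * R * K₁ + K / 2) + 4 * K₁) with hC
  have hC0 : 0 ≤ C := Real.sqrt_nonneg _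
  obtain ⟨k, hk⟩ : ∃ k : ℕ, 5 * C * r ^ k < ε / 2 := by
    have : Tendsto (fun k : ℕ => 5 * C * r ^ k) atTop (𝓝 (5 * C * 0)) :=
      (tendsto_pow_atTop_nhds_zero_of_lt_one hr0.le (by linarith)).const_mul _
    rw [mul_zero] at this
    exact (this.eventually (gt_mem_nhds (half_pos hε))).exists
  set δ := min (min L ((ε / 2) ^ 2 * r ^ (2 * k) / (K₁ + 1)))
    (R * r ^ (8 * k) - R * r ^ (8 * (k + 1))) with hδ
  have hδ0 : 0 < δ := by
    refine lt_min (lt_min hL0 (by positivity)) ?_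
    have : r ^ (8 * (k + 1)) < r ^ (8 * k) :=
      pow_lt_pow_right_of_lt_one₀ hr0 (by linarith) (by omega)
    nlinarith
  refine ⟨δ, hδ0, fun N _ h a q hh hNL H hq ha => ?_⟩
  have hΦ : ∀ T₁ ∈ Icc R T, ∀ k : ℕ,
      ∫ t in (T₁ - R * r ^ (8 * k))..T₁, gsq h (fwd h (q t)) ≤ K * r ^ (6 * k) := by
    intro T₁ hT₁ k
    refine (H.integral_geometric_decay hh hlam hLam hr hR hT₁
      (fun s hs t ht hst => ha s hs t ht (hst.trans (min_le_left _ _))) k).trans ?_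
    rw [mul_comm]
    gcongr
    have h1 := H.energy hh (s := T₁ - R) (t := T₁) (by linarith [hT₁.1]) (by linarith) hT₁.2
    have h2 := gsq_le_of_abs_le hh hNL (hq (T₁ - R) ⟨by linarith [hT₁.1], by linarith [hT₁.2]⟩)
    have h3 := gsq_nonneg hh (q T₁)
    rw [intervalIntegral.integral_const_mul] at h1
    rw [hK, le_div_iff₀ (by positivity)]
    linarith
  have hgood : ∀ T₁ ∈ Icc R T, ∀ k : ℕ, ∃ S ∈ Icc (T₁ - R * r ^ (8 * k)) T₁,
      gsq h (fwd h (q S)) * r ^ (2 * k) ≤ K / R := by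
    intro T₁ hT₁ k
    have hρ : 0 < R * r ^ (8 * k) := by positivity
    have hρR : R * r ^ (8 * k) ≤ R := mul_le_of_le_one_right hR.le (pow_le_one₀ hr0.le hr1)
    obtain ⟨S, hS, hS2⟩ := exists_mul_le_integral (c := T₁ - R * r ^ (8 * k)) (d := T₁)
      (by linarith) ((continuousOn_gsq_fwd (h := h) H.continuousOn).mono
        (Icc_subset_Icc (by linarith [hT₁.1]) hT₁.2))
    refine ⟨S, hS, ?_⟩
    have h1 := hS2.trans (hΦ T₁ hT₁ k)
    rw [le_div_iff₀ hR]
    have e : (T₁ - (T₁ - R * r ^ (8 * k))) * gsq h (fwd h (q S)) =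
        (gsq h (fwd h (q S)) * r ^ (2 * k) * R) * r ^ (6 * k) := by
      rw [show 8 * k = 6 * k + 2 * k by ring, pow_add]; ring
    rw [e] at h1
    exact le_of_mul_le_mul_right h1 (by positivity)
  have hKK₁ : K / R ≤ K₁ := by
    rw [hK₁]
    exact div_le_div_of_nonneg_left hK0 (by positivity)
      (mul_le_of_le_one_right hR.le (pow_le_one₀ hr0.le hr1))
  have hKK₁' : ∀ (k : ℕ) (y : ℝ), y * r ^ (2 * (k + 1)) ≤ K / R → y * r ^ (2 * k) ≤ K₁ := by
    intro k y hy
    rw [hK₁, le_div_iff₀ (by positivity)]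
    rw [le_div_iff₀ hR] at hy
    calc _ = y * r ^ (2 * (k + 1)) * R := by ring
      _ ≤ K := hy
  have hclose : ∀ T₁ ∈ Icc R T, ∀ k : ℕ, ∀ S₁ ∈ Icc (T₁ - R * r ^ (8 * k)) T₁,
      ∀ S₂ ∈ Icc (T₁ - R * r ^ (8 * k)) T₁, gsq h (fwd h (q S₁)) * r ^ (2 * k) ≤ K₁ →
      gsq h (fwd h (q S₂)) * r ^ (2 * k) ≤ K₁ → ∀ i, |q S₁ i - q S₂ i| ≤ C * r ^ k :=
    fun T₁ hT₁ k S₁ hS₁ S₂ hS₂ h1 h2 i =>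
      H.abs_sub_le_of_energy hh hlam hNL hr0 hr1 hR hK0 hT₁ (hΦ T₁ hT₁ k) hS₁ hS₂ h1 h2 i
  have hpow : ∀ k : ℕ, R * r ^ (8 * (k + 1)) ≤ R * r ^ (8 * k) := fun k => by
    gcongr ?_ * ?_
    exact pow_le_pow_of_le_one hr0.le hr1 (by omega)
  have hlim : ∀ T₁ ∈ Icc R T, ∀ k : ℕ, ∃ S ∈ Icc (T₁ - R * r ^ (8 * k)) T₁,
      gsq h (fwd h (q S)) * r ^ (2 * k) ≤ K / R ∧ ∀ i, |q S i - q T₁ i| ≤ 2 * C * r ^ k := by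
    intro T₁ hT₁ k
    choose S hS hSY using hgood T₁ hT₁
    refine ⟨S k, hS k, hSY k, fun i => ?_⟩
    have hST : Tendsto S atTop (𝓝 T₁) := by
      have h1 : Tendsto (fun k : ℕ => T₁ - R * r ^ (8 * k)) atTop (𝓝 (T₁ - R * 0)) := by
        refine tendsto_const_nhds.sub (Tendsto.const_mul _ ?_)
        simp only [pow_mul]
        exact tendsto_pow_atTop_nhds_zero_of_lt_one (by positivity)
          (pow_lt_one₀ hr0.le (by linarith) (by norm_num))
      rw [mul_zero, sub_zero] at h1
      exact tendsto_of_tendsto_of_tendsto_of_le_of_le h1 tendsto_const_nhds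
        (fun k => (hS k).1) (fun k => (hS k).2)
    have hqT : Tendsto (fun k => q (S k) i) atTop (𝓝 (q T₁ i)) :=
      (H.flow T₁ ⟨hR.le.trans hT₁.1, hT₁.2⟩ i).continuousAt.tendsto.comp hST
    have := dist_le_of_le_geometric_of_tendsto r C (by linarith) (fun n => by
      rw [Real.dist_eq]
      exact hclose T₁ hT₁ n _ (hS n) _ ⟨by linarith [(hS (n + 1)).1, hpow n], (hS (n + 1)).2⟩
        ((hSY n).trans hKK₁) (hKK₁' _ _ (hSY (n + 1))) i) hqT k
    rw [Real.dist_eq] at this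
    refine this.trans ?_
    rw [div_le_iff₀ (by linarith)]
    have : 0 ≤ C * r ^ k := by positivity
    nlinarith
  have hsubT : ∀ t ∈ Icc t₀ T, t ∈ Icc R T := fun t ht => ⟨(min_le_right _ _).trans ht.1, ht.2⟩
  have hCk : 0 ≤ C * r ^ k := by positivity
  constructor
  · intro t ht i n hn
    obtain ⟨S, hS, hSY, hSq⟩ := hlim t (hsubT t ht) k
    have hnN : n ≤ N := by
      have h1 : (n : ℝ) * h ≤ N * h := by
        rw [hNL]; exact hn.trans ((min_le_left _ _).trans (min_le_left _ _))
      exact_mod_cast le_of_mul_le_mul_right h1 hh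
    have h1 := sq_sub_le_gsq_fwd hh (q S) i hnN
    have h2 : (q S (i + n) - q S i) ^ 2 ≤ (ε / 2) ^ 2 := by
      refine h1.trans ?_
      have h3 : n * h ≤ (ε / 2) ^ 2 * r ^ (2 * k) / (K₁ + 1) :=
        hn.trans ((min_le_left _ _).trans (min_le_right _ _))
      have h4 : gsq h (fwd h (q S)) * r ^ (2 * k) ≤ K₁ + 1 := by linarith
      rw [le_div_iff₀ (by positivity)] at h3
      have h5 : (n * h * gsq h (fwd h (q S))) * r ^ (2 * k) ≤ (ε / 2) ^ 2 * r ^ (2 * k) := by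
        refine le_trans ?_ h3
        calc _ = n * h * (gsq h (fwd h (q S)) * r ^ (2 * k)) := by ring
          _ ≤ _ := by gcongr
      exact le_of_mul_le_mul_right h5 (by positivity)
    have h3 := abs_le.1 (abs_le_of_sq_le_sq h2 (by positivity))
    have h4 := abs_le.1 (hSq i)
    have h5 := abs_le.1 (hSq (i + n))
    rw [abs_le]
    constructor <;> linarith [h3.1, h3.2]
  · intro s hs t ht hst i
    wlog hst' : s ≤ t generalizing s t
    · rw [abs_sub_comm]
      exact this t ht s hs (by rwa [abs_sub_comm]) (le_of_not_ge hst')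
    obtain ⟨S, hS, hSY, hSq⟩ := hlim s (hsubT s hs) (k + 1)
    obtain ⟨S', hS', hSY', hSq'⟩ := hlim t (hsubT t ht) k
    have h0 : t - s ≤ R * r ^ (8 * k) - R * r ^ (8 * (k + 1)) :=
      ((le_abs_self _).trans hst).trans (min_le_right _ _)
    have h1 := hclose t (hsubT t ht) k S ⟨by linarith [hS.1], hS.2.trans hst'⟩ S' hS'
      (hKK₁' _ _ hSY) (hSY'.trans hKK₁) i
    have h2 := abs_le.1 h1
    have h3 := abs_le.1 (hSq i)
    have h4 := abs_le.1 (hSq' i)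
    have h5 : 2 * C * r ^ (k + 1) ≤ 2 * C * r ^ k := by
      gcongr ?_ * ?_
      exact pow_le_pow_of_le_one hr0.le hr1 (by omega)
    rw [abs_le]
    constructor <;> linarith [h2.1, h2.2, h3.1, h3.2, h4.1, h4.2]

end LinearRegularity

section GridFlow

/-- An ordinary differential equation with bounded Lipschitz right-hand side is solvable on any
time interval. -/
theorem exists_ode_of_bounded_lipschitz {E : Type*} [NormedAddCommGroup E] [NormedSpace ℝ E]
    [CompleteSpace E] {F : E → E} {K : NNReal} (hF : LipschitzWith K F) {C : ℝ}
    (hC : ∀ x, ‖F x‖ ≤ C) (x₀ : E) (T : ℝ) :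
    ∃ x : ℝ → E, x 0 = x₀ ∧ ∀ t ∈ Icc 0 T, HasDerivAt x (F (x t)) t := by
  rcases lt_or_ge T 0 with hT | hT
  · exact ⟨fun _ => x₀, rfl, fun t ht => absurd (ht.1.trans ht.2) (not_le.2 hT)⟩
  have hC0 : 0 ≤ C := (norm_nonneg _).trans (hC x₀)
  have h0 : (0 : ℝ) ∈ Icc (-1 : ℝ) (T + 1) := ⟨by norm_num, by linarith⟩
  have hPL : IsPicardLindelof (fun _ => F) (⟨0, h0⟩ : Icc (-1 : ℝ) (T + 1)) x₀
      (C * (T + 1)).toNNReal 0 C.toNNReal K := by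
    refine IsPicardLindelof.of_time_independent
      (fun x _ => (hC x).trans (le_coe_toNNReal C)) hF.lipschitzOnWith ?_
    rw [coe_toNNReal C hC0, coe_toNNReal _ (by positivity : 0 ≤ C * (T + 1)), NNReal.coe_zero]
    change C * max (T + 1 - 0) (0 - -1) ≤ C * (T + 1) - 0
    rw [sub_zero (C * (T + 1))]
    refine mul_le_mul_of_nonneg_left (max_le ?_ ?_) hC0 <;> linarith
  obtain ⟨x, hx0, hx⟩ := hPL.exists_eq_forall_mem_Icc_hasDerivWithinAt₀
  exact ⟨x, hx0, fun t ht => (hx t ⟨by linarith [ht.1], by linarith [ht.2]⟩).hasDerivAt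
    (Icc_mem_nhds (by linarith [ht.1]) (by linarith [ht.2]))⟩

/-- The derivative at a point where the past values are not larger is nonnegative. -/
theorem HasDerivAt.nonneg_of_left_max {g : ℝ → ℝ} {g' a t : ℝ} (hg : HasDerivAt g g' t)
    (hat : a < t) (hmax : ∀ s ∈ Icc a t, g s ≤ g t) : 0 ≤ g' := by
  have h1 := (hasDerivWithinAt_iff_tendsto_slope' (by simp)).1 (hg.hasDerivWithinAt (s := Iio t))
  refine ge_of_tendsto h1 ?_
  filter_upwards [Ioo_mem_nhdsLT hat] with s hs
  rw [slope_def_field]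
  exact div_nonneg_of_nonpos (by linarith [hmax s ⟨hs.1.le, hs.2.le⟩]) (by linarith [hs.2])

/-- Maximum principle for finitely many functions of time. -/
theorem finite_max_principle {ι : Type*} [Finite ι] {f f' : ℝ → ι → ℝ} {T m : ℝ}
    (hf : ∀ t ∈ Icc 0 T, ∀ i, HasDerivAt (fun s => f s i) (f' t i) t)
    (hmax : ∀ t ∈ Icc 0 T, ∀ i, (∀ j, f t j ≤ f t i) → f' t i ≤ 0) (h0 : ∀ i, f 0 i ≤ m) :
    ∀ t ∈ Icc 0 T, ∀ i, f t i ≤ m := by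
  intro t₁ ht₁ i₁
  by_contra! hcon
  have : Nonempty ι := ⟨i₁⟩
  set ε := (f t₁ i₁ - m) / (2 * (t₁ + 1)) with hε
  have hε0 : 0 < ε := div_pos (by linarith) (by linarith [ht₁.1])
  have hεt : ε * t₁ < f t₁ i₁ - m := by
    have : ε * (2 * (t₁ + 1)) = f t₁ i₁ - m := by
      rw [hε]; exact div_mul_cancel₀ _ (by linarith [ht₁.1])
    nlinarith [ht₁.1]
  have hsub : ∀ t ∈ Icc 0 t₁, t ∈ Icc 0 T := fun t ht => ⟨ht.1, ht.2.trans ht₁.2⟩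
  have hex : ∀ i, ∃ t ∈ Icc 0 t₁, ∀ s ∈ Icc 0 t₁, f s i - ε * s ≤ f t i - ε * t := by
    intro i
    have hc : ContinuousOn (fun s => f s i - ε * s) (Icc 0 t₁) := fun s hs =>
      ((hf s (hsub s hs) i).continuousAt.sub (by fun_prop)).continuousWithinAt
    exact isCompact_Icc.exists_isMaxOn (nonempty_Icc.2 ht₁.1) hc
  choose τ hτ hτmax using hex
  obtain ⟨i, hi⟩ := Finite.exists_max fun i => f (τ i) i - ε * τ i
  have hall : ∀ j, ∀ s ∈ Icc 0 t₁, f s j - ε * s ≤ f (τ i) i - ε * τ i := fun j s hs =>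
    (hτmax j s hs).trans (hi j)
  have hpos : 0 < τ i := by
    refine lt_of_le_of_ne (hτ i).1 fun h => ?_
    have h1 := hall i₁ t₁ ⟨ht₁.1, le_rfl⟩
    rw [← h] at h1
    linarith [h0 i]
  have hd := (hf _ (hsub _ (hτ i)) i).sub ((hasDerivAt_id (τ i)).const_mul ε)
  have h1 := hd.nonneg_of_left_max hpos fun s hs => hτmax i s ⟨hs.1, hs.2.trans (hτ i).2⟩
  have h2 := hmax _ (hsub _ (hτ i)) i fun j => by linarith [hall j _ (hτ i)]
  simp only [mul_one] at h1
  linarith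

theorem finite_abs_max_principle {ι : Type*} [Finite ι] {f f' : ℝ → ι → ℝ} {T m : ℝ}
    (hf : ∀ t ∈ Icc 0 T, ∀ i, HasDerivAt (fun s => f s i) (f' t i) t)
    (hmax : ∀ t ∈ Icc 0 T, ∀ i, (∀ j, f t j ≤ f t i) → f' t i ≤ 0)
    (hmin : ∀ t ∈ Icc 0 T, ∀ i, (∀ j, f t i ≤ f t j) → 0 ≤ f' t i) (h0 : ∀ i, |f 0 i| ≤ m) :
    ∀ t ∈ Icc 0 T, ∀ i, |f t i| ≤ m := by
  intro t ht i
  refine abs_le'.2 ⟨finite_max_principle hf hmax (fun i => (abs_le'.1 (h0 i)).1) t ht i,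
    finite_max_principle (f := fun t i => -f t i) (f' := fun t i => -f' t i)
      (fun t ht i => (hf t ht i).neg) (fun t ht i h => ?_) (fun i => (abs_le'.1 (h0 i)).2) t ht i⟩
  have := hmin t ht i fun j => by linarith [h j]
  linarith

variable {N : ℕ}

/-- The semidiscrete version of `A(u_x)_x`. -/
noncomputable def gridFlux (A : ℝ → ℝ) (h : ℝ) (w : ZMod N → ℝ) : ZMod N → ℝ :=
  bwd h fun j => A (fwd h w j)

/-- `u` solves the semidiscrete equation `∂ₜ u = A(u_x)_x` on `[0, T]`, with bounds. -/
structure GridFlow (A : ℝ → ℝ) (h T M P Q : ℝ) (u : ℝ → ZMod N → ℝ) : Prop where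
  deriv : ∀ t ∈ Icc 0 T, ∀ i, HasDerivAt (fun s => u s i) (gridFlux A h (u t) i) t
  bdd : ∀ t ∈ Icc 0 T, ∀ i, |u t i| ≤ M
  abs_fwd_le : ∀ t ∈ Icc 0 T, ∀ i, |fwd h (u t) i| ≤ P
  abs_flux_le : ∀ t ∈ Icc 0 T, ∀ i, |gridFlux A h (u t) i| ≤ Q

variable {A α : ℝ → ℝ} {h T M P Q : ℝ}

theorem hasDerivAt_fwd_of_flow {u : ℝ → ZMod N → ℝ} {t : ℝ}
    (hu : ∀ i, HasDerivAt (fun s => u s i) (gridFlux A h (u t) i) t) (i : ZMod N) :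
    HasDerivAt (fun s => fwd h (u s) i) (fwd h (gridFlux A h (u t)) i) t :=
  ((hu (i + 1)).sub (hu i)).div_const h

theorem hasDerivAt_gridFlux (hA : ∀ p, HasDerivAt A (α p) p) {u : ℝ → ZMod N → ℝ} {t : ℝ}
    (hu : ∀ i, HasDerivAt (fun s => u s i) (gridFlux A h (u t) i) t) (i : ZMod N) :
    HasDerivAt (fun s => gridFlux A h (u s) i)
      (bwd h (fun j => α (fwd h (u t) j) * fwd h (gridFlux A h (u t)) j) i) t := by
  have h1 : ∀ j, HasDerivAt (fun s => A (fwd h (u s) j))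
      (α (fwd h (u t) j) * fwd h (gridFlux A h (u t)) j) t := fun j =>
    (hA _).comp t (hasDerivAt_fwd_of_flow hu j)
  exact ((h1 i).sub (h1 (i - 1))).div_const h

theorem bwd_nonpos_of_max {A : ℝ → ℝ} (hA : Monotone A) (hh : 0 < h) {f : ZMod N → ℝ}
    {i : ZMod N} (hi : ∀ j, f j ≤ f i) : gridFlux A h f i ≤ 0 := by
  have h1 : fwd h f i ≤ fwd h f (i - 1) := by
    unfold fwd
    have := hi (i + 1)
    have := hi (i - 1)
    rw [sub_add_cancel]
    exact div_le_div_of_nonneg_right (by linarith) hh.le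
  exact div_nonpos_of_nonpos_of_nonneg (by linarith [hA h1]) hh.le

theorem bwd_nonneg_of_min {A : ℝ → ℝ} (hA : Monotone A) (hh : 0 < h) {f : ZMod N → ℝ}
    {i : ZMod N} (hi : ∀ j, f i ≤ f j) : 0 ≤ gridFlux A h f i := by
  have h1 : fwd h f (i - 1) ≤ fwd h f i := by
    unfold fwd
    have := hi (i + 1)
    have := hi (i - 1)
    rw [sub_add_cancel]
    exact div_le_div_of_nonneg_right (by linarith) hh.le
  exact div_nonneg (by linarith [hA h1]) hh.le

theorem fwd_gridFlux_nonpos_of_max {A : ℝ → ℝ} (hA : Monotone A) (hh : 0 < h) {f : ZMod N → ℝ}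
    {i : ZMod N} (hi : ∀ j, fwd h f j ≤ fwd h f i) : fwd h (gridFlux A h f) i ≤ 0 := by
  have h1 := hA (hi (i + 1))
  have h2 := hA (hi (i - 1))
  unfold gridFlux
  rw [fwd, bwd, bwd, add_sub_cancel_right]
  refine div_nonpos_of_nonpos_of_nonneg ?_ hh.le
  rw [← sub_div]
  exact div_nonpos_of_nonpos_of_nonneg (by linarith) hh.le

theorem fwd_gridFlux_nonneg_of_min {A : ℝ → ℝ} (hA : Monotone A) (hh : 0 < h) {f : ZMod N → ℝ}
    {i : ZMod N} (hi : ∀ j, fwd h f i ≤ fwd h f j) : 0 ≤ fwd h (gridFlux A h f) i := by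
  have h1 := hA (hi (i + 1))
  have h2 := hA (hi (i - 1))
  unfold gridFlux
  rw [fwd, bwd, bwd, add_sub_cancel_right]
  refine div_nonneg ?_ hh.le
  rw [← sub_div]
  exact div_nonneg (by linarith) hh.le

theorem bwd_mul_fwd_nonpos_of_max (hh : 0 < h) {a f : ZMod N → ℝ} (ha : ∀ j, 0 ≤ a j)
    {i : ZMod N} (hi : ∀ j, f j ≤ f i) : bwd h (fun j => a j * fwd h f j) i ≤ 0 := by
  have h1 : fwd h f i ≤ 0 := div_nonpos_of_nonpos_of_nonneg (by linarith [hi (i + 1)]) hh.le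
  have h2 : 0 ≤ fwd h f (i - 1) := by
    unfold fwd; rw [sub_add_cancel]; exact div_nonneg (by linarith [hi (i - 1)]) hh.le
  refine div_nonpos_of_nonpos_of_nonneg ?_ hh.le
  linarith [mul_nonpos_of_nonneg_of_nonpos (ha i) h1, mul_nonneg (ha (i - 1)) h2]

theorem bwd_mul_fwd_nonneg_of_min (hh : 0 < h) {a f : ZMod N → ℝ} (ha : ∀ j, 0 ≤ a j)
    {i : ZMod N} (hi : ∀ j, f i ≤ f j) : 0 ≤ bwd h (fun j => a j * fwd h f j) i := by
  have h1 : 0 ≤ fwd h f i := div_nonneg (by linarith [hi (i + 1)]) hh.le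
  have h2 : fwd h f (i - 1) ≤ 0 := by
    unfold fwd; rw [sub_add_cancel]
    exact div_nonpos_of_nonpos_of_nonneg (by linarith [hi (i - 1)]) hh.le
  refine div_nonneg ?_ hh.le
  linarith [mul_nonneg (ha i) h1, mul_nonpos_of_nonneg_of_nonpos (ha (i - 1)) h2]

theorem exists_gridFlow_of_lipschitz [NeZero N] {A : ℝ → ℝ} {K : NNReal} (hA : LipschitzWith K A) {C : ℝ}
    (hC : ∀ p, |A p| ≤ C) (hh : 0 < h) (U : ZMod N → ℝ) (T : ℝ) :
    ∃ u : ℝ → ZMod N → ℝ, u 0 = U ∧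
      ∀ t ∈ Icc 0 T, ∀ i, HasDerivAt (fun s => u s i) (gridFlux A h (u t) i) t := by
  obtain ⟨D, hD⟩ : ∃ D : NNReal, (D : ℝ) = 2 / h := ⟨⟨2 / h, by positivity⟩, rfl⟩
  have hfwd : ∀ i : ZMod N, LipschitzWith D (fun w : ZMod N → ℝ => fwd h w i) := by
    intro i
    refine LipschitzWith.of_dist_le_mul fun w w' => ?_
    rw [Real.dist_eq, hD]
    have h1 := dist_le_pi_dist w w' i
    have h2 := dist_le_pi_dist w w' (i + 1)
    rw [Real.dist_eq] at h1 h2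
    have e : fwd h w i - fwd h w' i = ((w (i + 1) - w' (i + 1)) - (w i - w' i)) / h := by
      unfold fwd; ring
    rw [e, abs_div, abs_of_pos hh, div_mul_eq_mul_div]
    refine div_le_div_of_nonneg_right ?_ hh.le
    linarith [abs_sub (w (i + 1) - w' (i + 1)) (w i - w' i)]
  have hF : LipschitzWith (D * (K * D))
      (gridFlux A h : (ZMod N → ℝ) → ZMod N → ℝ) := by
    refine LipschitzWith.of_dist_le_mul fun w w' => ?_
    rw [dist_pi_le_iff (by positivity)]
    intro i
    have h1 := (hA.comp (hfwd i)).dist_le_mul w w'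
    have h2 := (hA.comp (hfwd (i - 1))).dist_le_mul w w'
    rw [Real.dist_eq] at h1 h2 ⊢
    simp only [NNReal.coe_mul, hD] at h1 h2 ⊢
    simp only [Function.comp] at h1 h2
    have e : gridFlux A h w i - gridFlux A h w' i = ((A (fwd h w i) - A (fwd h w' i)) -
        (A (fwd h w (i - 1)) - A (fwd h w' (i - 1)))) / h := by
      unfold gridFlux bwd; ring
    rw [e, abs_div, abs_of_pos hh, div_mul_eq_mul_div, div_mul_eq_mul_div]
    refine div_le_div_of_nonneg_right ?_ hh.le
    refine (abs_sub _ _).trans ?_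
    linarith
  have hC0 : 0 ≤ C := (abs_nonneg _).trans (hC 0)
  have hb : ∀ w : ZMod N → ℝ, ‖gridFlux A h w‖ ≤ 2 * C / h := by
    intro w
    rw [pi_norm_le_iff_of_nonneg (by positivity)]
    intro i
    unfold gridFlux bwd
    rw [Real.norm_eq_abs, abs_div, abs_of_pos hh]
    refine div_le_div_of_nonneg_right ?_ hh.le
    linarith [abs_sub (A (fwd h w i)) (A (fwd h w (i - 1))), hC (fwd h w i), hC (fwd h w (i - 1))]
  obtain ⟨u, hu0, hu⟩ := exists_ode_of_bounded_lipschitz hF hb U T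
  exact ⟨u, hu0, fun t ht i => (hasDerivAt_pi.1 (hu t ht)) i⟩

theorem exists_gridFlow [NeZero N] (hα : Continuous α) (hα0 : ∀ p, 0 < α p)
    (hA : ∀ p, HasDerivAt A (α p) p) (hh : 0 < h) (U : ZMod N → ℝ) (T : ℝ)
    (hM : ∀ i, |U i| ≤ M) (hP : ∀ i, |fwd h U i| ≤ P) (hQ : ∀ i, |gridFlux A h U i| ≤ Q) :
    ∃ u : ℝ → ZMod N → ℝ, u 0 = U ∧ GridFlow A h T M P Q u := by
  have hP0 : 0 ≤ P := (abs_nonneg _).trans (hP 0)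
  have hAmono : Monotone A := (strictMono_of_hasDerivAt_pos hA hα0).monotone
  have hle : -P ≤ P := by linarith
  let Ac : ℝ → ℝ := fun p => A (projIcc (-P) P hle p)
  have hAcmono : Monotone Ac := fun x y hxy => hAmono (monotone_projIcc hle hxy)
  have hAcA : ∀ p, |p| ≤ P → Ac p = A p := fun p hp => by
    simp only [Ac]; rw [projIcc_of_mem hle (abs_le.1 hp)]
  obtain ⟨Λ, hΛ⟩ := isCompact_Icc.exists_bound_of_continuousOn (hα.continuousOn (s := Icc (-P) P))
  have hΛ0 : 0 ≤ Λ := (norm_nonneg _).trans (hΛ 0 ⟨by linarith, hP0⟩)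
  obtain ⟨Λ', hΛ'⟩ : ∃ D : NNReal, (D : ℝ) = Λ := ⟨⟨Λ, hΛ0⟩, rfl⟩
  have hLip : LipschitzOnWith Λ' A (Icc (-P) P) :=
    (convex_Icc _ _).lipschitzOnWith_of_nnnorm_hasDerivWithin_le
      (fun p _ => (hA p).hasDerivWithinAt) fun p hp => by
        rw [← NNReal.coe_le_coe, hΛ']; exact hΛ p hp
  have hAcL : LipschitzWith Λ' Ac := by
    refine LipschitzWith.of_dist_le_mul fun x y => ?_
    refine (hLip.dist_le_mul _ (projIcc (-P) P hle x).2 _ (projIcc (-P) P hle y).2).trans ?_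
    refine mul_le_mul_of_nonneg_left ?_ Λ'.2
    have := (LipschitzWith.projIcc hle).dist_le_mul x y
    simpa [Subtype.dist_eq] using this
  have hAcb : ∀ p, |Ac p| ≤ max |A (-P)| |A P| := fun p =>
    abs_le_max_abs_abs (hAmono (projIcc (-P) P hle p).2.1) (hAmono (projIcc (-P) P hle p).2.2)
  obtain ⟨u, hu0, hu⟩ := exists_gridFlow_of_lipschitz hAcL hAcb hh U T
  have hp : ∀ t ∈ Icc 0 T, ∀ i, |fwd h (u t) i| ≤ P :=
    finite_abs_max_principle (fun t ht i => hasDerivAt_fwd_of_flow (hu t ht) i)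
      (fun t _ i hi => fwd_gridFlux_nonpos_of_max hAcmono hh hi)
      (fun t _ i hi => fwd_gridFlux_nonneg_of_min hAcmono hh hi) (by simpa [hu0] using hP)
  have hu' : ∀ t ∈ Icc 0 T, ∀ i, HasDerivAt (fun s => u s i) (gridFlux A h (u t) i) t := by
    intro t ht i
    have e : gridFlux A h (u t) i = gridFlux Ac h (u t) i := by
      simp only [gridFlux, bwd]
      rw [hAcA _ (hp t ht _), hAcA _ (hp t ht _)]
    rw [e]; exact hu t ht i
  refine ⟨u, hu0, hu', ?_, hp, ?_⟩
  · exact finite_abs_max_principle hu' (fun t _ i hi => bwd_nonpos_of_max hAmono hh hi)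
      (fun t _ i hi => bwd_nonneg_of_min hAmono hh hi) (by simpa [hu0] using hM)
  · exact finite_abs_max_principle (fun t ht i => hasDerivAt_gridFlux hA (hu' t ht) i)
      (fun t _ i hi => bwd_mul_fwd_nonpos_of_max hh (fun j => (hα0 _).le) hi)
      (fun t _ i hi => bwd_mul_fwd_nonneg_of_min hh (fun j => (hα0 _).le) hi)
      (by simpa [hu0] using hQ)

end GridFlow

section GridEstimates

variable {N : ℕ} {A α : ℝ → ℝ} {h T M P Q lam Lam : ℝ}

theorem abs_sub_le_of_step (hh : 0 < h) {f g : ZMod N → ℝ}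
    (hfg : ∀ i, f (i + 1) - f i = h * g i) {i : ZMod N} {k : ℕ} {c ε : ℝ}
    (hg : ∀ l < k, |g (i + l) - c| ≤ ε) : |f (i + k) - f i - k * h * c| ≤ k * h * ε := by
  induction k with
  | zero => simp
  | succ k ih =>
    have h1 := ih fun l hl => hg l (by omega)
    have h2 := hfg (i + k)
    have h3 := mul_le_mul_of_nonneg_left (hg k (by omega)) hh.le
    push_cast
    rw [← add_assoc]
    have e : f (i + k + 1) - f i - (k + 1) * h * c =
        (f (i + k) - f i - k * h * c) + h * (g (i + k) - c) := by linarith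
    rw [e]
    refine (abs_add_le _ _).trans ?_
    rw [abs_mul h, abs_of_pos hh]
    linarith

theorem mul_abs_sub_le_of_hasDerivAt (hA : ∀ p, HasDerivAt A (α p) p)
    (hlam : ∀ p ∈ Icc (-P) P, lam ≤ α p) {x y : ℝ} (hx : |x| ≤ P) (hy : |y| ≤ P) :
    lam * |x - y| ≤ |A x - A y| := by
  wlog hxy : y ≤ x generalizing x y
  · rw [abs_sub_comm, abs_sub_comm (A x)]; exact this hy hx (le_of_not_ge hxy)
  have hmono : MonotoneOn (fun p => A p - lam * p) (Icc (-P) P) := by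
    refine monotoneOn_of_deriv_nonneg (convex_Icc _ _)
      (fun p _ => ((hA p).continuousAt.sub (by fun_prop)).continuousWithinAt)
      (fun p _ => ((hA p).differentiableAt.sub (by fun_prop)).differentiableWithinAt) fun p hp => ?_
    have hd := (hA p).sub ((hasDerivAt_id p).const_mul lam)
    have := hlam p (interior_subset hp)
    rw [show (fun p => A p - lam * p) = A - fun y => lam * id y from rfl, hd.deriv]
    linarith
  have h1 := hmono (abs_le.1 hy) (abs_le.1 hx) hxy
  simp only at h1
  rw [abs_of_nonneg (by linarith : 0 ≤ x - y)]
  exact le_trans (by linarith) (le_abs_self _)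

variable {u : ℝ → ZMod N → ℝ}

theorem sub_eq_mul_fwd (hh : 0 < h) (w : ZMod N → ℝ) (i : ZMod N) :
    w (i + 1) - w i = h * fwd h w i := by
  unfold fwd; field_simp

theorem sub_eq_mul_gridFlux (hh : 0 < h) (w : ZMod N → ℝ) (i : ZMod N) :
    A (fwd h w (i + 1)) - A (fwd h w i) = h * gridFlux A h w (i + 1) := by
  unfold gridFlux bwd; rw [add_sub_cancel_right]; field_simp

theorem GridFlow.abs_fwd_sub_le (H : GridFlow A h T M P Q u) (hh : 0 < h)
    (hA : ∀ p, HasDerivAt A (α p) p) (hlam0 : 0 < lam) (hlam : ∀ p ∈ Icc (-P) P, lam ≤ α p)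
    {t : ℝ} (ht : t ∈ Icc 0 T) (i : ZMod N) (k : ℕ) :
    |fwd h (u t) (i + k) - fwd h (u t) i| ≤ k * h * (Q / lam) := by
  have h1 := abs_sub_le_of_step hh (f := fun j => A (fwd h (u t) j)) (i := i) (k := k) (c := 0)
    (ε := Q) (sub_eq_mul_gridFlux hh (u t)) fun l _ => by
      simpa using H.abs_flux_le t ht (i + l + 1)
  have h2 := mul_abs_sub_le_of_hasDerivAt hA hlam (H.abs_fwd_le t ht (i + k))
    (H.abs_fwd_le t ht i)
  simp only [mul_zero, sub_zero] at h1
  rw [← mul_div_assoc, le_div_iff₀ hlam0]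
  linarith

theorem GridFlow.abs_sub_time_le (H : GridFlow A h T M P Q u) {s t : ℝ} (hs : s ∈ Icc 0 T)
    (ht : t ∈ Icc 0 T) (i : ZMod N) : |u t i - u s i| ≤ Q * |t - s| := by
  have := (convex_Icc (0 : ℝ) T).norm_image_sub_le_of_norm_hasDerivWithin_le
    (f := fun s => u s i) (fun x hx => (H.deriv x hx i).hasDerivWithinAt)
    (fun x hx => H.abs_flux_le x hx i) hs ht
  simpa using this

theorem GridFlow.linFlow [NeZero N] (H : GridFlow A h T M P Q u) (hα : Continuous α)
    (hA : ∀ p, HasDerivAt A (α p) p) (hlam : ∀ p ∈ Icc (-P) P, lam ≤ α p ∧ α p ≤ Lam) :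
    LinFlow h lam Lam T (fun t i => α (fwd h (u t) i)) (fun t => gridFlux A h (u t)) where
  ell t ht i := hlam _ (abs_le.1 (H.abs_fwd_le t ht i))
  cont i t ht := (hα.continuousAt.comp
    (hasDerivAt_fwd_of_flow (H.deriv t ht) i).continuousAt).continuousWithinAt
  flow t ht i := hasDerivAt_gridFlux hA (H.deriv t ht) i

theorem exists_modulus_fwd (hA : ∀ p, HasDerivAt A (α p) p) (hlam0 : 0 < lam)
    (hlam : ∀ p ∈ Icc (-P) P, lam ≤ α p) (hQ : 0 ≤ Q) (T M : ℝ) {ε : ℝ} (hε : 0 < ε) :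
    ∃ δ > 0, ∃ h₀ > 0, ∀ (N : ℕ) [NeZero N] (h : ℝ) (u : ℝ → ZMod N → ℝ), 0 < h → h ≤ h₀ →
      GridFlow A h T M P Q u → ∀ s ∈ Icc 0 T, ∀ t ∈ Icc 0 T, |t - s| ≤ δ → ∀ i,
        |fwd h (u t) i - fwd h (u s) i| ≤ ε := by
  set d := ε / (8 * (Q / lam + 1)) with hd
  have hQl : 0 ≤ Q / lam := by positivity
  have hd0 : 0 < d := by positivity
  have hd1 : d * (Q / lam) ≤ ε / 8 := by
    have : d * (8 * (Q / lam + 1)) = ε := by rw [hd]; field_simp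
    nlinarith
  refine ⟨d * ε / (4 * (Q + 1)), by positivity, d, hd0, fun N _ h u hh hhd H s hs t ht hst i => ?_⟩
  obtain ⟨k, hk1, hk2⟩ : ∃ k : ℕ, d ≤ k * h ∧ k * h ≤ 2 * d := by
    refine ⟨⌈d / h⌉₊, ?_, ?_⟩
    · have := Nat.le_ceil (d / h)
      rwa [div_le_iff₀ hh] at this
    · have := (Nat.ceil_lt_add_one (div_nonneg hd0.le hh.le)).le
      have h1 := mul_le_mul_of_nonneg_right this hh.le
      rw [add_mul, div_mul_cancel₀ _ hh.ne'] at h1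
      linarith
  have hkh : 0 < k * h := by linarith
  have key : ∀ τ ∈ Icc 0 T, |u τ (i + k) - u τ i - k * h * fwd h (u τ) i| ≤
      k * h * (2 * d * (Q / lam)) := fun τ hτ =>
    abs_sub_le_of_step hh (sub_eq_mul_fwd hh (u τ)) fun l hl => by
      refine (H.abs_fwd_sub_le hh hA hlam0 hlam hτ i l).trans ?_
      refine mul_le_mul_of_nonneg_right (le_trans ?_ hk2) hQl
      exact mul_le_mul_of_nonneg_right (by exact_mod_cast hl.le) hh.le
  have h1 := abs_le.1 (key s hs)
  have h2 := abs_le.1 (key t ht)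
  have h3 := abs_le.1 (H.abs_sub_time_le hs ht i)
  have h4 := abs_le.1 (H.abs_sub_time_le hs ht (i + k))
  have h5 : Q * |t - s| ≤ d * ε / 4 := by
    have : (Q + 1) * |t - s| ≤ (Q + 1) * (d * ε / (4 * (Q + 1))) :=
      mul_le_mul_of_nonneg_left hst (by linarith)
    have e : (Q + 1) * (d * ε / (4 * (Q + 1))) = d * ε / 4 := by field_simp
    nlinarith [abs_nonneg (t - s)]
  have h6 : k * h * (2 * d * (Q / lam)) ≤ k * h * (ε / 4) :=
    mul_le_mul_of_nonneg_left (by linarith) hkh.le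
  have h7 : d * ε ≤ k * h * ε := mul_le_mul_of_nonneg_right hk1 hε.le
  have h8 : |k * h * (fwd h (u t) i - fwd h (u s) i)| ≤ k * h * ε := by
    rw [abs_le]
    constructor <;> linarith [h1.1, h1.2, h2.1, h2.2, h3.1, h3.2, h4.1, h4.2]
  rw [abs_mul, abs_of_pos hkh] at h8
  exact le_of_mul_le_mul_left h8 hkh

theorem exists_modulus_flux (hα : Continuous α) (hA : ∀ p, HasDerivAt A (α p) p)
    (hlam0 : 0 < lam) (hlamLam : lam ≤ Lam)
    (hlam : ∀ p ∈ Icc (-P) P, lam ≤ α p ∧ α p ≤ Lam) (hQ : 0 ≤ Q) {L t₀ : ℝ} (hL : 0 < L)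
    (ht₀ : 0 < t₀) (T M : ℝ) {ε : ℝ} (hε : 0 < ε) :
    ∃ δ > 0, ∃ h₀ > 0, ∀ (N : ℕ) [NeZero N] (h : ℝ) (u : ℝ → ZMod N → ℝ), 0 < h → h ≤ h₀ →
      N * h = L → GridFlow A h T M P Q u →
      (∀ t ∈ Icc t₀ T, ∀ i, ∀ k : ℕ, k * h ≤ δ →
        |gridFlux A h (u t) (i + k) - gridFlux A h (u t) i| ≤ ε) ∧
      (∀ s ∈ Icc t₀ T, ∀ t ∈ Icc t₀ T, |t - s| ≤ δ → ∀ i,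
        |gridFlux A h (u t) i - gridFlux A h (u s) i| ≤ ε) := by
  obtain ⟨ω, hω, hmod⟩ := exists_modulus_linFlow (Q := Q) (T := T) hlam0 hlamLam hL ht₀
  have huc := (isCompact_Icc (a := -P) (b := P)).uniformContinuousOn_of_continuous hα.continuousOn
  obtain ⟨η, hη, hαη⟩ := Metric.uniformContinuousOn_iff_le.1 huc ω hω
  obtain ⟨R₀, hR₀, h₀, hh₀, hp⟩ := exists_modulus_fwd hA hlam0 (fun p hp => (hlam p hp).1) hQ T M hη
  obtain ⟨δ, hδ, hq⟩ := hmod R₀ hR₀ ε hε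
  refine ⟨δ, hδ, h₀, hh₀, fun N _ h u hh hhh₀ hNh H => ?_⟩
  exact hq N h _ _ hh hNh (H.linFlow hα hA hlam) H.abs_flux_le fun s hs t ht hst i =>
    hαη _ (abs_le.1 (H.abs_fwd_le t ht i)) _ (abs_le.1 (H.abs_fwd_le s hs i))
      (hp N h u hh hhh₀ H s hs t ht hst i)

end GridEstimates

section InitialData

variable {A α : ℝ → ℝ} {T M P L : ℝ}

theorem abs_sub_le_of_abs_deriv_le {f f' : ℝ → ℝ} (hf : ∀ x, HasDerivAt f (f' x) x) {C : ℝ}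
    (hC : ∀ x, |f' x| ≤ C) (x y : ℝ) : |f y - f x| ≤ C * |y - x| := by
  have := convex_univ.norm_image_sub_le_of_norm_hasDerivWithin_le
    (f := f) (fun x _ => (hf x).hasDerivWithinAt) (fun x _ => hC x) (mem_univ x) (mem_univ y)
  simpa using this

/-- Solvability of the semidiscrete problems with bounds that do not depend on the grid. -/
theorem exists_gridFlow_of_periodic (hα : Continuous α) (hα0 : ∀ p, 0 < α p)
    (hA : ∀ p, HasDerivAt A (α p) p) (hL : 0 < L) {f f' f'' : ℝ → ℝ}
    (hf : ∀ x, HasDerivAt f (f' x) x) (hf' : ∀ x, HasDerivAt f' (f'' x) x)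
    (hper : ∀ x, f (x + L) = f x) {D : ℝ} (hM : ∀ x, |f x| ≤ M) (hP : ∀ x, |f' x| ≤ P)
    (hD : ∀ x, |f'' x| ≤ D) (T : ℝ) :
    ∃ Q, 0 ≤ Q ∧ ∀ n : ℕ, ∃ u : ℝ → ZMod (n + 1) → ℝ, GridFlow A (L / (n + 1)) T M P Q u ∧
      ∀ z : ℤ, u 0 z = f (z * (L / (n + 1))) := by
  obtain ⟨Λ, hΛ⟩ := isCompact_Icc.exists_bound_of_continuousOn (hα.continuousOn (s := Icc (-P) P))
  have hP0 : 0 ≤ P := (abs_nonneg _).trans (hP 0)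
  have hD0 : 0 ≤ D := (abs_nonneg _).trans (hD 0)
  have hΛ0 : 0 ≤ Λ := (norm_nonneg _).trans (hΛ 0 ⟨by linarith, hP0⟩)
  refine ⟨Λ * D, by positivity, fun n => ?_⟩
  set h : ℝ := L / (n + 1) with hh
  have hh0 : 0 < h := by positivity
  set U : ZMod (n + 1) → ℝ := fun i => f (i.val * h) with hU
  have hUz : ∀ z : ℤ, U z = f (z * h) := by
    intro z
    have h1 : (((z : ZMod (n + 1)).val : ℤ)) = z % ((n + 1 : ℕ) : ℤ) := ZMod.val_intCast z
    have h2 : z = z % ((n + 1 : ℕ) : ℤ) + ((n + 1 : ℕ) : ℤ) * (z / ((n + 1 : ℕ) : ℤ)) :=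
      (Int.emod_add_mul_ediv z _).symm
    have h3 : Function.Periodic f L := hper
    simp only [hU]
    have h4 : ((z : ZMod (n + 1)).val : ℝ) = ((z % ((n + 1 : ℕ) : ℤ) : ℤ) : ℝ) := by
      rw [← h1]; simp
    rw [h4]
    have h5 : (z : ℝ) * h = ((z % ((n + 1 : ℕ) : ℤ) : ℤ) : ℝ) * h +
        ((z / ((n + 1 : ℕ) : ℤ) : ℤ) : ℝ) * L := by
      conv_lhs => rw [h2]
      push_cast
      rw [hh]; field_simp
    rw [h5]
    exact (h3.int_mul _ _).symm
  have hsurj : ∀ i : ZMod (n + 1), ∃ z : ℤ, (z : ZMod (n + 1)) = i := ZMod.intCast_surjective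
  have hfwdz : ∀ z : ℤ, fwd h U z = (f (z * h + h) - f (z * h)) / h := by
    intro z
    have : (z : ZMod (n + 1)) + 1 = ((z + 1 : ℤ) : ZMod (n + 1)) := by push_cast; rfl
    unfold fwd
    rw [this, hUz, hUz]
    push_cast
    rw [add_mul, one_mul]
  have hfwdP : ∀ i, |fwd h U i| ≤ P := by
    intro i
    obtain ⟨z, rfl⟩ := hsurj i
    rw [hfwdz, abs_div, abs_of_pos hh0, div_le_iff₀ hh0]
    have := abs_sub_le_of_abs_deriv_le hf hP (z * h) (z * h + h)
    rwa [add_sub_cancel_left, abs_of_pos hh0] at this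
  have hflux : ∀ i, |gridFlux A h U i| ≤ Λ * D := by
    intro i
    obtain ⟨z, rfl⟩ := hsurj i
    have e : (z : ZMod (n + 1)) - 1 = ((z - 1 : ℤ) : ZMod (n + 1)) := by push_cast; rfl
    have h1 : |A (fwd h U z) - A (fwd h U (z - 1))| ≤ Λ * |fwd h U z - fwd h U (z - 1)| := by
      have := (convex_Icc (-P) P).norm_image_sub_le_of_norm_hasDerivWithin_le
        (f := A) (fun x _ => (hA x).hasDerivWithinAt) hΛ (abs_le.1 (hfwdP (z - 1)))
        (abs_le.1 (hfwdP z))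
      simpa using this
    have h2 : |fwd h U z - fwd h U (z - 1)| ≤ D * h := by
      rw [e, hfwdz, hfwdz]
      have hg : ∀ x, HasDerivAt (fun x => f (x + h) - f x) (f' (x + h) - f' x) x := fun x =>
        ((hf (x + h)).comp_add_const x h).sub (hf x)
      have hgb : ∀ x, |f' (x + h) - f' x| ≤ D * h := fun x => by
        have := abs_sub_le_of_abs_deriv_le hf' hD x (x + h)
        rwa [add_sub_cancel_left, abs_of_pos hh0] at this
      have := abs_sub_le_of_abs_deriv_le hg hgb (((z - 1 : ℤ) : ℝ) * h) (z * h)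
      rw [← sub_div, abs_div, abs_of_pos hh0, div_le_iff₀ hh0]
      refine this.trans (le_of_eq ?_)
      push_cast
      rw [show (z : ℝ) * h - (z - 1) * h = h by ring, abs_of_pos hh0]
    unfold gridFlux bwd
    rw [abs_div, abs_of_pos hh0, div_le_iff₀ hh0]
    calc _ ≤ _ := h1
      _ ≤ Λ * (D * h) := mul_le_mul_of_nonneg_left h2 hΛ0
      _ = _ := by ring
  obtain ⟨u, hu0, hu⟩ := exists_gridFlow (T := T) hα hα0 hA hh0 U
    (fun i => hM _) hfwdP hflux
  exact ⟨u, hu, fun z => by rw [hu0]; exact hUz z⟩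

end InitialData

section GridDifferences

variable {N : ℕ} {A α : ℝ → ℝ} {h T M P Q lam Lam : ℝ} {u : ℝ → ZMod N → ℝ}

theorem GridFlow.abs_sub_le (H : GridFlow A h T M P Q u) (hh : 0 < h) {t : ℝ}
    (ht : t ∈ Icc 0 T) (i : ZMod N) (k : ℕ) : |u t (i + k) - u t i| ≤ k * h * P := by
  have := abs_sub_le_of_step hh (i := i) (k := k) (c := 0) (ε := P) (sub_eq_mul_fwd hh (u t))
    fun l _ => by simpa using H.abs_fwd_le t ht (i + l)
  simpa using this

theorem GridFlow.abs_sub_sub_fwd_le (H : GridFlow A h T M P Q u) (hh : 0 < h)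
    (hA : ∀ p, HasDerivAt A (α p) p) (hlam0 : 0 < lam) (hlam : ∀ p ∈ Icc (-P) P, lam ≤ α p)
    (hQ : 0 ≤ Q) {t : ℝ} (ht : t ∈ Icc 0 T) (i : ZMod N) (k : ℕ) :
    |u t (i + k) - u t i - k * h * fwd h (u t) i| ≤ k * h * (k * h * (Q / lam)) :=
  abs_sub_le_of_step hh (sub_eq_mul_fwd hh (u t)) fun l hl =>
    (H.abs_fwd_sub_le hh hA hlam0 hlam ht i l).trans <| by
      have : (l : ℝ) ≤ k := by exact_mod_cast hl.le
      gcongr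

theorem abs_sub_sub_flux_le (hh : 0 < h) {w : ZMod N → ℝ} {δ ε : ℝ} {i : ZMod N} {k : ℕ}
    (hq : ∀ l : ℕ, l * h ≤ δ → |gridFlux A h w (i + l) - gridFlux A h w i| ≤ ε)
    (hk : k * h ≤ δ) :
    |A (fwd h w (i + k)) - A (fwd h w i) - k * h * gridFlux A h w i| ≤ k * h * ε :=
  abs_sub_le_of_step hh (f := fun j => A (fwd h w j)) (sub_eq_mul_gridFlux hh w) fun l hl => by
    have h1 : ((l + 1 : ℕ) : ℝ) ≤ k := by exact_mod_cast hl
    have := hq (l + 1) ((mul_le_mul_of_nonneg_right h1 hh.le).trans hk)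
    push_cast at this
    rwa [← add_assoc] at this

theorem GridFlow.abs_sub_sub_flux_time_le (H : GridFlow A h T M P Q u) {t₀ δ ε : ℝ}
    (ht₀ : 0 ≤ t₀) {i : ZMod N}
    (hq : ∀ s ∈ Icc t₀ T, ∀ t ∈ Icc t₀ T, |t - s| ≤ δ →
      |gridFlux A h (u t) i - gridFlux A h (u s) i| ≤ ε)
    {s t : ℝ} (hs : s ∈ Icc t₀ T) (ht : t ∈ Icc t₀ T) (hst : |t - s| ≤ δ) :
    |u t i - u s i - (t - s) * gridFlux A h (u s) i| ≤ ε * |t - s| := by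
  have hsub : uIcc s t ⊆ Icc t₀ T := uIcc_subset_Icc hs ht
  have := (convex_uIcc s t).norm_image_sub_le_of_norm_hasDerivWithin_le
    (f := fun τ => u τ i - τ * gridFlux A h (u s) i)
    (f' := fun τ => gridFlux A h (u τ) i - 1 * gridFlux A h (u s) i) (C := ε)
    (fun x hx => (((H.deriv x ⟨ht₀.trans (hsub hx).1, (hsub hx).2⟩ i).sub
      ((hasDerivAt_id x).mul_const _))).hasDerivWithinAt)
    (fun x hx => by
      rw [one_mul]
      refine hq s hs x (hsub hx) (le_trans ?_ hst)
      exact abs_sub_left_of_mem_uIcc hx) left_mem_uIcc right_mem_uIcc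
  rw [Real.norm_eq_abs, Real.norm_eq_abs] at this
  convert this using 2
  ring

end GridDifferences

section Limit

/-- The estimates satisfied by a limit `u` of grid flows, together with the limits `p` and `q` of
its difference quotients in space and time. -/
structure LimitFlow (A f : ℝ → ℝ) (L T M P Q C : ℝ) (u p q : ℝ → ℝ → ℝ) : Prop where
  initial : ∀ x, u x 0 = f x
  bdd : ∀ t ∈ Icc 0 T, ∀ x, |u x t| ≤ M
  bdd_p : ∀ t ∈ Icc 0 T, ∀ x, |p x t| ≤ P
  periodic : ∀ t ∈ Icc 0 T, ∀ x, u (x + L) t = u x t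
  lip : ∀ t ∈ Icc 0 T, ∀ x y, x ≤ y → |u y t - u x t| ≤ (y - x) * P
  lip_time : ∀ s ∈ Icc 0 T, ∀ t ∈ Icc 0 T, ∀ x, |u x t - u x s| ≤ Q * |t - s|
  lip_p : ∀ t ∈ Icc 0 T, ∀ x y, x ≤ y → |p y t - p x t| ≤ (y - x) * C
  modulus_p : ∀ ε > 0, ∃ δ > 0, ∀ s ∈ Icc 0 T, ∀ t ∈ Icc 0 T, |t - s| ≤ δ →
    ∀ x, |p x t - p x s| ≤ ε
  taylor : ∀ t ∈ Icc 0 T, ∀ x y, x ≤ y →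
    |u y t - u x t - (y - x) * p x t| ≤ (y - x) * ((y - x) * C)
  modulus : ∀ t₀ > 0, ∀ ε > 0, ∃ δ > 0,
    (∀ t ∈ Icc t₀ T, ∀ x y, x ≤ y → y - x < δ → |q y t - q x t| ≤ ε) ∧
    (∀ s ∈ Icc t₀ T, ∀ t ∈ Icc t₀ T, |t - s| ≤ δ → ∀ x, |q x t - q x s| ≤ ε) ∧
    (∀ t ∈ Icc t₀ T, ∀ x y, x ≤ y → y - x < δ →
      |A (p y t) - A (p x t) - (y - x) * q x t| ≤ (y - x) * ε) ∧
    (∀ s ∈ Icc t₀ T, ∀ t ∈ Icc t₀ T, |t - s| ≤ δ → ∀ x,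
      |u x t - u x s - (t - s) * q x s| ≤ ε * |t - s|)

theorem exists_tendsto_hyperfilter {f : ℕ → ℝ} {C : ℝ} (hf : ∀ n, |f n| ≤ C) :
    ∃ l, Tendsto f (hyperfilter ℕ) (𝓝 l) := by
  have h1 : ((hyperfilter ℕ).map f : Filter ℝ) ≤ 𝓟 (Icc (-C) C) := by
    rw [Filter.le_principal_iff]
    exact Filter.mem_map.2 (univ_mem' fun n => abs_le.1 (hf n))
  obtain ⟨l, -, hl⟩ := isCompact_Icc.ultrafilter_le_nhds _ h1
  exact ⟨l, hl⟩

theorem exists_shift {h x y : ℝ} (hh : 0 < h) (hxy : x ≤ y) :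
    ∃ k : ℕ, ⌊y / h⌋ = ⌊x / h⌋ + k ∧ |k * h - (y - x)| ≤ h := by
  have h1 : ⌊x / h⌋ ≤ ⌊y / h⌋ := Int.floor_mono (div_le_div_of_nonneg_right hxy hh.le)
  obtain ⟨k, hk⟩ := Int.le.dest h1
  refine ⟨k, hk.symm, ?_⟩
  have e : (k : ℝ) = (⌊y / h⌋ : ℝ) - ⌊x / h⌋ := by
    rw [eq_sub_iff_add_eq', ← hk]; push_cast; ring
  have h2 := mul_le_mul_of_nonneg_right (Int.floor_le (y / h)) hh.le
  have h3 := mul_le_mul_of_nonneg_right (Int.floor_le (x / h)) hh.le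
  have h4 := mul_le_mul_of_nonneg_right (Int.lt_floor_add_one (y / h)).le hh.le
  have h5 := mul_le_mul_of_nonneg_right (Int.lt_floor_add_one (x / h)).le hh.le
  rw [add_mul, div_mul_cancel₀ _ hh.ne'] at h4 h5
  rw [div_mul_cancel₀ _ hh.ne'] at h2 h3
  rw [e, sub_mul, abs_le]
  constructor <;> linarith

theorem exists_limitFlow {A α : ℝ → ℝ} {L M P : ℝ} (hα : Continuous α) (hα0 : ∀ p, 0 < α p)
    (hA : ∀ p, HasDerivAt A (α p) p) (hL : 0 < L) {f f' f'' : ℝ → ℝ}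
    (hf : ∀ x, HasDerivAt f (f' x) x) (hf' : ∀ x, HasDerivAt f' (f'' x) x)
    (hper : ∀ x, f (x + L) = f x) {D : ℝ} (hM : ∀ x, |f x| ≤ M) (hP : ∀ x, |f' x| ≤ P)
    (hD : ∀ x, |f'' x| ≤ D) {T : ℝ} (hT : 0 ≤ T) :
    ∃ Q C u p q, LimitFlow A f L T M P Q C u p q := by
  obtain ⟨Q, hQ, hex⟩ := exists_gridFlow_of_periodic hα hα0 hA hL hf hf' hper hM hP hD T
  choose w hw hw0 using hex
  have hP0 : 0 ≤ P := (abs_nonneg _).trans (hP 0)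
  have hne : (Icc (-P) P).Nonempty := ⟨0, by linarith, hP0⟩
  obtain ⟨a, -, ha⟩ := isCompact_Icc.exists_isMinOn hne hα.continuousOn
  obtain ⟨b, -, hb⟩ := isCompact_Icc.exists_isMaxOn hne hα.continuousOn
  have hell : ∀ p ∈ Icc (-P) P, α a ≤ α p ∧ α p ≤ α b := fun p hp => ⟨ha hp, hb hp⟩
  have hlamLam : α a ≤ α b := (ha hne.some_mem).trans (hb hne.some_mem)
  set h : ℕ → ℝ := fun n => L / (n + 1) with hh
  have hh0 : ∀ n, 0 < h n := fun n => by positivity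
  have hNh : ∀ n, ((n + 1 : ℕ) : ℝ) * h n = L := fun n => by
    simp only [hh]; push_cast; field_simp
  set 𝒰 : Filter ℕ := (hyperfilter ℕ : Filter ℕ) with h𝒰
  have hhlim : Tendsto h 𝒰 (𝓝 0) :=
    (tendsto_const_div_atTop_nhds_zero_nat L |>.comp (tendsto_add_atTop_nat 1) |>.congr
      fun n => by simp [hh]).mono_left Nat.hyperfilter_le_atTop
  have hhsmall : ∀ δ > 0, ∀ᶠ n in 𝒰, h n ≤ δ := fun δ hδ => hhlim.eventually_le_const hδ
  set idx : (n : ℕ) → ℝ → ZMod (n + 1) := fun n x => (⌊x / h n⌋ : ℤ) with hidx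
  have hshift : ∀ x y, x ≤ y → ∃ k : ℕ → ℕ, (∀ n, idx n y = idx n x + k n) ∧
      Tendsto (fun n => k n * h n) 𝒰 (𝓝 (y - x)) := by
    intro x y hxy
    choose k hk1 hk2 using fun n => exists_shift (hh0 n) hxy
    refine ⟨k, fun n => by simp only [hidx, hk1]; push_cast; rfl, ?_⟩
    rw [tendsto_iff_dist_tendsto_zero]
    exact squeeze_zero (fun _ => dist_nonneg) hk2 hhlim
  choose! u hu using fun x t => fun ht : t ∈ Icc 0 T =>
    exists_tendsto_hyperfilter fun n => (hw n).bdd t ht (idx n x)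
  choose! p hp using fun x t => fun ht : t ∈ Icc 0 T =>
    exists_tendsto_hyperfilter fun n => (hw n).abs_fwd_le t ht (idx n x)
  choose! q hq using fun x t => fun ht : t ∈ Icc 0 T =>
    exists_tendsto_hyperfilter fun n => (hw n).abs_flux_le t ht (idx n x)
  have hAp : ∀ x t, t ∈ Icc 0 T → Tendsto (fun n => A (fwd (h n) (w n t) (idx n x))) 𝒰
      (𝓝 (A (p x t))) := fun x t ht => ((hA _).continuousAt.tendsto).comp (hp x t ht)
  refine ⟨Q, Q / α a, u, p, q, ?_⟩
  constructor
  · intro x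
    refine tendsto_nhds_unique (hu x 0 ⟨le_rfl, hT⟩) ?_
    have h1 : Tendsto (fun n => (⌊x / h n⌋ : ℝ) * h n) 𝒰 (𝓝 x) := by
      rw [tendsto_iff_dist_tendsto_zero]
      refine squeeze_zero (fun _ => dist_nonneg) (fun n => ?_) hhlim
      have h2 := mul_le_mul_of_nonneg_right (Int.floor_le (x / h n)) (hh0 n).le
      have h4 := mul_le_mul_of_nonneg_right (Int.lt_floor_add_one (x / h n)).le (hh0 n).le
      rw [add_mul, div_mul_cancel₀ _ (hh0 n).ne'] at h4
      rw [div_mul_cancel₀ _ (hh0 n).ne'] at h2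
      rw [Real.dist_eq, abs_le]
      constructor <;> linarith
    exact ((hf x).continuousAt.tendsto.comp h1).congr fun n => (hw0 n _).symm
  · exact fun t ht x => le_of_tendsto (hu x t ht).abs
      (Eventually.of_forall fun n => (hw n).bdd t ht _)
  · exact fun t ht x => le_of_tendsto (hp x t ht).abs
      (Eventually.of_forall fun n => (hw n).abs_fwd_le t ht _)
  · intro t ht x
    refine tendsto_nhds_unique (hu (x + L) t ht) ((hu x t ht).congr fun n => ?_)
    congr 1
    have : (x + L) / h n = x / h n + ((n + 1 : ℕ) : ℤ) := by
      rw [add_div, ← hNh n, mul_div_assoc, div_self (hh0 n).ne']; push_cast; ring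
    simp only [hidx]
    rw [this, Int.floor_add_intCast]
    simp
  · intro t ht x y hxy
    obtain ⟨k, hk, hklim⟩ := hshift x y hxy
    refine le_of_tendsto_of_tendsto ((hu y t ht).sub (hu x t ht)).abs (hklim.mul_const P)
      (Eventually.of_forall fun n => ?_)
    simp only [hk]
    exact (hw n).abs_sub_le (hh0 n) ht _ _
  · exact fun s hs t ht x => le_of_tendsto ((hu x t ht).sub (hu x s hs)).abs
      (Eventually.of_forall fun n => (hw n).abs_sub_time_le hs ht _)
  · intro t ht x y hxy
    obtain ⟨k, hk, hklim⟩ := hshift x y hxy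
    refine le_of_tendsto_of_tendsto ((hp y t ht).sub (hp x t ht)).abs (hklim.mul_const _)
      (Eventually.of_forall fun n => ?_)
    simp only [hk]
    exact (hw n).abs_fwd_sub_le (hh0 n) hA (hα0 a) (fun p hp => (hell p hp).1) ht _ _
  · intro ε hε
    obtain ⟨δ, hδ, h₀, hh₀, hmod⟩ := exists_modulus_fwd hA (hα0 a) (fun p hp => (hell p hp).1)
      hQ T M hε
    refine ⟨δ, hδ, fun s hs t ht hst x => le_of_tendsto ((hp x t ht).sub (hp x s hs)).abs ?_⟩
    filter_upwards [hhsmall h₀ hh₀] with n hn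
    exact hmod (n + 1) (h n) (w n) (hh0 n) hn (hw n) s hs t ht hst _
  · intro t ht x y hxy
    obtain ⟨k, hk, hklim⟩ := hshift x y hxy
    refine le_of_tendsto_of_tendsto (((hu y t ht).sub (hu x t ht)).sub
      (hklim.mul (hp x t ht))).abs (hklim.mul (hklim.mul_const _))
      (Eventually.of_forall fun n => ?_)
    simp only [hk]
    exact (hw n).abs_sub_sub_fwd_le (hh0 n) hA (hα0 a) (fun p hp => (hell p hp).1) hQ ht _ _
  · intro t₀ ht₀ ε hε
    obtain ⟨δ, hδ, h₀, hh₀, hmod⟩ := exists_modulus_flux hα hA (hα0 a) hlamLam hell hQ hL ht₀ T M hε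
    have hsub : ∀ t ∈ Icc t₀ T, t ∈ Icc 0 T := fun t ht => ⟨ht₀.le.trans ht.1, ht.2⟩
    have hmod' := fun n (hn : h n ≤ h₀) => hmod (n + 1) (h n) (w n) (hh0 n) hn (hNh n) (hw n)
    refine ⟨δ, hδ, ?_, ?_, ?_, ?_⟩
    · intro t ht x y hxy hδ'
      obtain ⟨k, hk, hklim⟩ := hshift x y hxy
      refine le_of_tendsto ((hq y t (hsub t ht)).sub (hq x t (hsub t ht))).abs ?_
      filter_upwards [hhsmall h₀ hh₀, hklim.eventually_le_const hδ'] with n hn hkn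
      rw [hk]
      exact (hmod' n hn).1 t ht _ _ hkn
    · intro s hs t ht hst x
      refine le_of_tendsto ((hq x t (hsub t ht)).sub (hq x s (hsub s hs))).abs ?_
      filter_upwards [hhsmall h₀ hh₀] with n hn
      exact (hmod' n hn).2 s hs t ht hst _
    · intro t ht x y hxy hδ'
      obtain ⟨k, hk, hklim⟩ := hshift x y hxy
      refine le_of_tendsto_of_tendsto (((hAp y t (hsub t ht)).sub (hAp x t (hsub t ht))).sub
        (hklim.mul (hq x t (hsub t ht)))).abs (hklim.mul_const _) ?_
      filter_upwards [hhsmall h₀ hh₀, hklim.eventually_le_const hδ'] with n hn hkn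
      rw [hk]
      exact abs_sub_sub_flux_le (hh0 n) (fun l hl => (hmod' n hn).1 t ht _ l hl) hkn
    · intro s hs t ht hst x
      refine le_of_tendsto (((hu x t (hsub t ht)).sub (hu x s (hsub s hs))).sub
        ((hq x s (hsub s hs)).const_mul (t - s))).abs ?_
      filter_upwards [hhsmall h₀ hh₀] with n hn
      exact (hw n).abs_sub_sub_flux_time_le ht₀.le
        (fun s hs t ht hst => (hmod' n hn).2 s hs t ht hst _) hs ht hst

end Limit

section Existence

theorem hasDerivAt_of_forward_taylor {f g : ℝ → ℝ}
    (h : ∀ ε > 0, ∃ δ > 0, ∀ x y, x ≤ y → y - x < δ → |f y - f x - (y - x) * g x| ≤ (y - x) * ε)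
    (hg : Continuous g) (x : ℝ) : HasDerivAt f (g x) x := by
  rw [hasDerivAt_iff_isLittleO, Asymptotics.isLittleO_iff]
  intro c hc
  obtain ⟨δ, hδ, hf⟩ := h (c / 2) (half_pos hc)
  filter_upwards [Ioo_mem_nhds (by linarith : x - δ < x) (by linarith : x < x + δ),
    Metric.continuousAt_iff'.1 hg.continuousAt (c / 2) (half_pos hc)] with y hy hgy
  simp only [Real.norm_eq_abs, smul_eq_mul]
  rw [Real.dist_eq] at hgy
  rcases le_total x y with hxy | hxy
  · rw [abs_of_nonneg (by linarith : 0 ≤ y - x)]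
    have := hf x y hxy (by linarith [hy.2])
    nlinarith
  · rw [abs_of_nonpos (by linarith : y - x ≤ 0)]
    have h1 := abs_le.1 (hf y x hxy (by linarith [hy.1]))
    have h2 : |(x - y) * (g y - g x)| ≤ (x - y) * (c / 2) := by
      rw [abs_mul, abs_of_nonneg (by linarith : 0 ≤ x - y)]
      exact mul_le_mul_of_nonneg_left hgy.le (by linarith)
    have h3 := abs_le.1 h2
    rw [abs_le]
    constructor <;> linarith [h1.1, h1.2, h3.1, h3.2]

theorem hasDerivAt_of_comp {A α p : ℝ → ℝ} (hA : ∀ p, HasDerivAt A (α p) p) (hα : Continuous α)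
    {x q : ℝ} (hα0 : α (p x) ≠ 0) (hp : ContinuousAt p x)
    (hAp : HasDerivAt (fun y => A (p y)) q x) : HasDerivAt p (q / α (p x)) x := by
  have hs : HasStrictDerivAt A (α (p x)) (p x) :=
    hasStrictDerivAt_of_hasDerivAt_of_continuousAt (Eventually.of_forall hA) hα.continuousAt
  have h1 : HasDerivAt (hs.localInverse _ _ _ hα0) (α (p x))⁻¹ (A (p x)) :=
    (hs.to_localInverse hα0).hasDerivAt
  have h2 := h1.comp x hAp
  rw [mul_comm, ← div_eq_mul_inv] at h2
  refine h2.congr_of_eventuallyEq ?_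
  have h3 : ∀ᶠ y in 𝓝 (p x), hs.localInverse _ _ _ hα0 (A y) = y :=
    (hs.hasStrictFDerivAt_equiv hα0).eventually_left_inverse
  filter_upwards [hp.eventually h3] with y hy
  exact hy.symm

theorem continuousOn_prod_of_moduli {g : ℝ → ℝ → ℝ} {I : Set ℝ}
    (h : ∀ t ∈ I, ∀ ε > 0, ∃ δ > 0, ∀ s ∈ I, |s - t| < δ →
      (∀ x y, x ≤ y → y - x < δ → |g y s - g x s| ≤ ε) ∧ ∀ x, |g x s - g x t| ≤ ε) :
    ContinuousOn (fun z : ℝ × ℝ => g z.1 z.2) (univ ×ˢ I) := by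
  rintro ⟨x, t⟩ ⟨-, ht⟩
  rw [Metric.continuousWithinAt_iff]
  intro ε hε
  obtain ⟨δ, hδ, hg⟩ := h t ht (ε / 3) (by positivity)
  refine ⟨δ, hδ, fun {z} hz hd => ?_⟩
  obtain ⟨y, s⟩ := z
  obtain ⟨hd1, hd2⟩ := max_lt_iff.1 hd
  simp only [Real.dist_eq] at hd1 hd2 ⊢
  obtain ⟨h1, h2⟩ := hg s hz.2 hd2
  have h3 : |g y s - g x s| ≤ ε / 3 := by
    rcases le_total x y with hxy | hxy
    · exact h1 x y hxy ((le_abs_self _).trans_lt hd1)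
    · rw [abs_sub_comm]
      exact h1 y x hxy ((le_abs_self _).trans_lt (by rwa [abs_sub_comm]))
  have := abs_sub_le (g y s) (g x s) (g x t)
  linarith [h2 x]

theorem exists_delta_mul_le (C : ℝ) {ε : ℝ} (hε : 0 < ε) :
    ∃ δ > 0, ∀ r, 0 ≤ r → r < δ → r * C ≤ ε := by
  refine ⟨ε / (|C| + 1), by positivity, fun r hr hrδ => ?_⟩
  rw [lt_div_iff₀ (by positivity)] at hrδ
  nlinarith [le_abs_self C]

variable {A α f : ℝ → ℝ} {L T M P Q C : ℝ} {u p q : ℝ → ℝ → ℝ}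

theorem LimitFlow.continuous_p (H : LimitFlow A f L T M P Q C u p q) {t : ℝ} (ht : t ∈ Icc 0 T) :
    Continuous fun x => p x t := by
  have : LipschitzWith C.toNNReal fun x => p x t := LipschitzWith.of_dist_le_mul fun x y => by
    wlog hxy : y ≤ x generalizing x y
    · rw [dist_comm, dist_comm x]; exact this y x (le_of_not_ge hxy)
    rw [Real.dist_eq, Real.dist_eq, abs_of_nonneg (by linarith : 0 ≤ x - y)]
    refine (H.lip_p t ht y x hxy).trans ?_
    rw [mul_comm]
    exact mul_le_mul_of_nonneg_right (le_coe_toNNReal C) (by linarith)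
  exact this.continuous

theorem LimitFlow.hasDerivAt_x (H : LimitFlow A f L T M P Q C u p q) {t : ℝ} (ht : t ∈ Icc 0 T)
    (x : ℝ) : HasDerivAt (fun y => u y t) (p x t) x := by
  refine hasDerivAt_of_forward_taylor (fun ε hε => ?_) (H.continuous_p ht) x
  obtain ⟨δ, hδ, h⟩ := exists_delta_mul_le C hε
  refine ⟨δ, hδ, fun x y hxy hd => (H.taylor t ht x y hxy).trans ?_⟩
  exact mul_le_mul_of_nonneg_left (h _ (by linarith) hd) (by linarith)

theorem LimitFlow.continuous_q (H : LimitFlow A f L T M P Q C u p q) {t : ℝ} (ht : t ∈ Ioc 0 T) :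
    Continuous fun x => q x t := by
  rw [Metric.continuous_iff]
  intro x ε hε
  obtain ⟨δ, hδ, h, -⟩ := H.modulus t ht.1 (ε / 2) (half_pos hε)
  refine ⟨δ, hδ, fun y hy => ?_⟩
  rw [Real.dist_eq] at hy ⊢
  have hle : |q y t - q x t| ≤ ε / 2 := by
    rcases le_total x y with hxy | hxy
    · exact h t ⟨le_rfl, ht.2⟩ x y hxy ((le_abs_self _).trans_lt hy)
    · rw [abs_sub_comm]
      exact h t ⟨le_rfl, ht.2⟩ y x hxy ((le_abs_self _).trans_lt (by rwa [abs_sub_comm]))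
  linarith

theorem LimitFlow.hasDerivAt_xx (H : LimitFlow A f L T M P Q C u p q)
    (hA : ∀ p, HasDerivAt A (α p) p) (hα : Continuous α) (hα0 : ∀ p, 0 < α p) {t : ℝ}
    (ht : t ∈ Ioc 0 T) (x : ℝ) : HasDerivAt (fun y => p y t) (q x t / α (p x t)) x := by
  have ht' : t ∈ Icc 0 T := ⟨ht.1.le, ht.2⟩
  refine hasDerivAt_of_comp hA hα (hα0 _).ne' (H.continuous_p ht').continuousAt ?_
  refine hasDerivAt_of_forward_taylor (f := fun y => A (p y t)) (g := fun y => q y t)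
    (fun ε hε => ?_) (H.continuous_q ht) x
  obtain ⟨δ, hδ, -, -, h, -⟩ := H.modulus t ht.1 ε hε
  exact ⟨δ, hδ, fun x y hxy hd => h t ⟨le_rfl, ht.2⟩ x y hxy hd⟩

theorem LimitFlow.hasDerivAt_t (H : LimitFlow A f L T M P Q C u p q) {t : ℝ} (ht : t ∈ Ioo 0 T)
    (x : ℝ) : HasDerivAt (fun s => u x s) (q x t) t := by
  rw [hasDerivAt_iff_isLittleO, Asymptotics.isLittleO_iff]
  intro c hc
  obtain ⟨δ, hδ, -, -, -, h⟩ := H.modulus (t / 2) (half_pos ht.1) c hc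
  filter_upwards [Ioo_mem_nhds (by linarith : t - δ < t) (by linarith : t < t + δ),
    Ioo_mem_nhds (by linarith [ht.1] : t / 2 < t) ht.2] with s hs hs'
  exact h t ⟨by linarith [ht.1], ht.2.le⟩ s ⟨hs'.1.le, hs'.2.le⟩
    (abs_le.2 ⟨by linarith [hs.1], by linarith [hs.2]⟩) x

theorem LimitFlow.continuousOn_u (H : LimitFlow A f L T M P Q C u p q) :
    ContinuousOn (fun z : ℝ × ℝ => u z.1 z.2) (univ ×ˢ Icc 0 T) := by
  refine continuousOn_prod_of_moduli fun t ht ε hε => ?_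
  obtain ⟨δ₁, hδ₁, h₁⟩ := exists_delta_mul_le P hε
  obtain ⟨δ₂, hδ₂, h₂⟩ := exists_delta_mul_le Q hε
  refine ⟨min δ₁ δ₂, lt_min hδ₁ hδ₂, fun s hs hst => ⟨fun x y hxy hd => ?_, fun x => ?_⟩⟩
  · exact (H.lip s hs x y hxy).trans (h₁ _ (by linarith) (hd.trans_le (min_le_left _ _)))
  · refine (H.lip_time t ht s hs x).trans ?_
    rw [mul_comm]
    exact h₂ _ (abs_nonneg _) (hst.trans_le (min_le_right _ _))

theorem LimitFlow.continuousOn_p (H : LimitFlow A f L T M P Q C u p q) :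
    ContinuousOn (fun z : ℝ × ℝ => p z.1 z.2) (univ ×ˢ Ioo 0 T) := by
  refine continuousOn_prod_of_moduli fun t ht ε hε => ?_
  obtain ⟨δ₁, hδ₁, h₁⟩ := exists_delta_mul_le C hε
  obtain ⟨δ₂, hδ₂, h₂⟩ := H.modulus_p ε hε
  refine ⟨min δ₁ δ₂, lt_min hδ₁ hδ₂, fun s hs hst => ⟨fun x y hxy hd => ?_, fun x => ?_⟩⟩
  · exact (H.lip_p s (Ioo_subset_Icc_self hs) x y hxy).trans
      (h₁ _ (by linarith) (hd.trans_le (min_le_left _ _)))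
  · exact h₂ t (Ioo_subset_Icc_self ht) s (Ioo_subset_Icc_self hs)
      (hst.le.trans (min_le_right _ _)) x

theorem LimitFlow.continuousOn_q (H : LimitFlow A f L T M P Q C u p q) :
    ContinuousOn (fun z : ℝ × ℝ => q z.1 z.2) (univ ×ˢ Ioo 0 T) := by
  refine continuousOn_prod_of_moduli fun t ht ε hε => ?_
  obtain ⟨δ, hδ, h₁, h₂, -⟩ := H.modulus (t / 2) (half_pos ht.1) ε hε
  refine ⟨min δ (t / 2), lt_min hδ (half_pos ht.1), fun s hs hst => ?_⟩
  have hs2 : s ∈ Icc (t / 2) T := ⟨by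
    linarith [(abs_lt.1 (hst.trans_le (min_le_right _ _))).1], hs.2.le⟩
  refine ⟨fun x y hxy hd => h₁ s hs2 x y hxy (hd.trans_le (min_le_left _ _)), fun x => ?_⟩
  exact h₂ t ⟨by linarith [ht.1], ht.2.le⟩ s hs2 (hst.le.trans (min_le_left _ _)) x

theorem regularOn_of_hasDerivAt {u p r q : ℝ → ℝ → ℝ} {I : Set ℝ}
    (hu : ContinuousOn (fun z : ℝ × ℝ => u z.1 z.2) (univ ×ˢ I))
    (hx : ∀ t ∈ I, ∀ x, HasDerivAt (fun y => u y t) (p x t) x)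
    (hxx : ∀ t ∈ I, ∀ x, HasDerivAt (fun y => p y t) (r x t) x)
    (ht : ∀ t ∈ I, ∀ x, HasDerivAt (fun s => u x s) (q x t) t)
    (hp : ContinuousOn (fun z : ℝ × ℝ => p z.1 z.2) (univ ×ˢ I))
    (hr : ContinuousOn (fun z : ℝ × ℝ => r z.1 z.2) (univ ×ˢ I))
    (hq : ContinuousOn (fun z : ℝ × ℝ => q z.1 z.2) (univ ×ˢ I)) :
    RegularOn u (univ ×ˢ I) ∧ (∀ t ∈ I, ∀ x, pderivX u x t = p x t ∧ pderivXX u x t = r x t ∧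
      pderivT u x t = q x t) := by
  have e1 : ∀ t ∈ I, (fun y => pderivX u y t) = fun y => p y t := fun t h =>
    funext fun y => (hx t h y).deriv
  have e2 : ∀ t ∈ I, ∀ x, pderivXX u x t = r x t := fun t h x => by
    unfold pderivXX; rw [e1 t h]; exact (hxx t h x).deriv
  have e3 : ∀ t ∈ I, ∀ x, pderivT u x t = q x t := fun t h x => (ht t h x).deriv
  refine ⟨⟨hu, fun z hz => (hx _ hz.2 _).differentiableAt, fun z hz => ?_,
    fun z hz => (ht _ hz.2 _).differentiableAt, hp.congr fun z hz => (hx _ hz.2 _).deriv,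
    hr.congr fun z hz => e2 _ hz.2 _, hq.congr fun z hz => e3 _ hz.2 _⟩,
    fun t h x => ⟨(hx t h x).deriv, e2 t h x, e3 t h x⟩⟩
  rw [e1 _ hz.2]
  exact (hxx _ hz.2 _).differentiableAt

/-- Solvability of the periodic initial value problem. -/
theorem exists_solution (hα : Continuous α) (hα0 : ∀ p, 0 < α p) (hL : 0 < L) {f' f'' : ℝ → ℝ}
    (hf : ∀ x, HasDerivAt f (f' x) x) (hf' : ∀ x, HasDerivAt f' (f'' x) x)
    (hf'' : Continuous f'') (hper : ∀ x, f (x + L) = f x) (hM : ∀ x, |f x| ≤ M)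
    (hT : 0 < T) :
    ∃ u : ℝ → ℝ → ℝ, ContinuousOn (fun z : ℝ × ℝ => u z.1 z.2) (univ ×ˢ Icc 0 T) ∧
      (∀ x s, u (x + L) s = u x s) ∧ (∀ x, u x 0 = f x) ∧ (∀ x, ∀ s ∈ Icc 0 T, |u x s| ≤ M) ∧
      RegularOn u (univ ×ˢ Ioo 0 T) ∧
      ∀ x, ∀ s ∈ Ioo 0 T, pderivT u x s = α (pderivX u x s) * pderivXX u x s := by
  have hper1 : Function.Periodic f' L := fun x => by
    have h1 : HasDerivAt (fun y => f (y + L)) (f' (x + L)) x := (hf (x + L)).comp_add_const x L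
    rw [funext hper] at h1
    exact h1.unique (hf x)
  have hper2 : Function.Periodic f'' L := fun x => by
    have h1 : HasDerivAt (fun y => f' (y + L)) (f'' (x + L)) x := (hf' (x + L)).comp_add_const x L
    rw [funext hper1] at h1
    exact h1.unique (hf' x)
  have hbd : ∀ g : ℝ → ℝ, Continuous g → Function.Periodic g L → ∃ K, ∀ x, |g x| ≤ K := by
    intro g hg hgp
    obtain ⟨K, hK⟩ := isCompact_Icc.exists_bound_of_continuousOn (hg.continuousOn (s := Icc 0 L))
    refine ⟨K, fun x => ?_⟩
    obtain ⟨y, hy, hxy⟩ := hgp.exists_mem_Ico₀ hL x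
    rw [hxy]
    exact hK y (Ico_subset_Icc_self hy)
  obtain ⟨P, hP⟩ := hbd f' (continuous_iff_continuousAt.2 fun x => (hf' x).continuousAt) hper1
  obtain ⟨D, hD⟩ := hbd f'' hf'' hper2
  have hA : ∀ p, HasDerivAt (fun p => ∫ s in (0 : ℝ)..p, α s) (α p) p := fun p =>
    intervalIntegral.integral_hasDerivAt_right (hα.intervalIntegrable _ _)
      (hα.stronglyMeasurableAtFilter _ _) hα.continuousAt
  obtain ⟨Q, C, u, p, q, H⟩ := exists_limitFlow hα hα0 hA hL hf hf' hper hM hP hD hT.le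
  set v : ℝ → ℝ → ℝ := fun x t => u x (projIcc 0 T hT.le t) with hv
  have hvu : ∀ t ∈ Icc 0 T, ∀ x, v x t = u x t := fun t ht x => by
    simp only [hv]; rw [projIcc_of_mem hT.le ht]
  have hcont : ContinuousOn (fun z : ℝ × ℝ => v z.1 z.2) (univ ×ˢ Icc 0 T) :=
    H.continuousOn_u.congr fun z hz => hvu _ hz.2 _
  have hIcc : ∀ t ∈ Ioo 0 T, t ∈ Icc 0 T := fun t ht => Ioo_subset_Icc_self ht
  have hIoc : ∀ t ∈ Ioo 0 T, t ∈ Ioc 0 T := fun t ht => Ioo_subset_Ioc_self ht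
  have hreg := regularOn_of_hasDerivAt (u := v) (p := p) (r := fun x t => q x t / α (p x t))
    (q := q) (I := Ioo 0 T) (hcont.mono (prod_mono_right Ioo_subset_Icc_self))
    (fun t ht x => by
      rw [funext (hvu t (hIcc t ht))]; exact H.hasDerivAt_x (hIcc t ht) x)
    (fun t ht x => H.hasDerivAt_xx hA hα hα0 (hIoc t ht) x)
    (fun t ht x => (H.hasDerivAt_t ht x).congr_of_eventuallyEq <| by
      filter_upwards [Ioo_mem_nhds ht.1 ht.2] with s hs using hvu s (hIcc s hs) x)
    H.continuousOn_p
    (H.continuousOn_q.div (hα.comp_continuousOn H.continuousOn_p) fun z _ => (hα0 _).ne')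
    H.continuousOn_q
  refine ⟨v, hcont, fun x s => H.periodic _ (projIcc 0 T hT.le s).2 x, fun x => ?_,
    fun x s _ => H.bdd _ (projIcc 0 T hT.le s).2 x, hreg.1, fun x s hs => ?_⟩
  · rw [hvu 0 ⟨le_rfl, hT.le⟩, H.initial]
  · obtain ⟨h1, h2, h3⟩ := hreg.2 s hs x
    rw [h1, h2, h3, mul_div_cancel₀ _ (hα0 _).ne']

end Existence

section Profile

theorem hasDerivAt_primitive {f : ℝ → ℝ} (hf : Continuous f) (a p : ℝ) :
    HasDerivAt (fun p => ∫ s in a..p, f s) (f p) p :=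
  intervalIntegral.integral_hasDerivAt_right (hf.intervalIntegrable _ _)
    (hf.stronglyMeasurableAtFilter _ _) hf.continuousAt

/-- A function with continuous derivative bounded below by a positive constant has a global
differentiable inverse. -/
theorem exists_inverse_of_deriv_ge {F β : ℝ → ℝ} {lam : ℝ} (hlam : 0 < lam)
    (hF : ∀ p, HasDerivAt F (β p) p) (hβ : ∀ p, lam ≤ β p) :
    ∃ b : ℝ → ℝ, (∀ y, F (b y) = y) ∧ (∀ x, b (F x) = x) ∧ StrictMono b ∧
      ∀ y, HasDerivAt b (β (b y))⁻¹ y := by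
  have hmono : StrictMono F := strictMono_of_hasDerivAt_pos hF fun p => hlam.trans_le (hβ p)
  have hcont : Continuous F := continuous_iff_continuousAt.2 fun p => (hF p).continuousAt
  have hgrow : Monotone fun p => F p - lam * p := by
    refine monotone_of_hasDerivAt_nonneg (f' := fun p => β p - lam * 1)
      (fun p => (hF p).sub ((hasDerivAt_id p).const_mul lam)) fun p => ?_
    simp only [Pi.zero_apply]; linarith [hβ p]
  have htop : Tendsto F atTop atTop := by
    refine tendsto_atTop_mono' atTop (f₁ := fun p => lam * p + F 0) ?_
      (tendsto_atTop_add_const_right _ _ (tendsto_id.const_mul_atTop hlam))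
    filter_upwards [eventually_ge_atTop 0] with p hp
    have := hgrow hp
    simp only at this
    linarith
  have hbot : Tendsto F atBot atBot := by
    refine tendsto_atBot_mono' atBot (f₁ := fun p => lam * p + F 0) ?_
      (tendsto_atBot_add_const_right _ _ (tendsto_id.const_mul_atBot hlam))
    filter_upwards [eventually_le_atBot 0] with p hp
    have := hgrow hp
    simp only at this
    linarith
  have hsurj : Function.Surjective F := hcont.surjective htop hbot
  let e : ℝ ≃o ℝ := hmono.orderIsoOfSurjective F hsurj
  have he : ∀ x, e x = F x := fun x => rfl
  refine ⟨e.symm, fun y => by rw [← he, e.apply_symm_apply],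
    fun x => by rw [← he, e.symm_apply_apply], e.symm.strictMono, fun y => ?_⟩
  exact HasDerivAt.of_local_left_inverse e.symm.continuous.continuousAt (hF _)
    (hlam.trans_le (hβ _)).ne' (Eventually.of_forall fun z => by rw [← he, e.apply_symm_apply])

/-- The stationary profile: `s` decreases from `n` to `m` with `α(s) s' = -κ`, and `g` is a
primitive of `s`. -/
theorem exists_profile {α : ℝ → ℝ} (hα : Continuous α) (hα0 : ∀ p, 0 < α p) {m n κ : ℝ}
    (hmn : m ≤ n) (hκ : 0 < κ) :
    ∃ s g : ℝ → ℝ, ∃ z₁, z₁ = (∫ p in m..n, α p) / κ ∧ 0 ≤ z₁ ∧ s 0 = n ∧ s z₁ = m ∧ g 0 = 0 ∧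
      StrictAnti s ∧ (∀ z, HasDerivAt g (s z) z) ∧
      (∀ z ∈ Icc 0 z₁, s z ∈ Icc m n ∧ HasDerivAt s (-κ / α (s z)) z ∧
        g z = (∫ p in (s z)..n, p * α p) / κ) := by
  have hne : (Icc m n).Nonempty := nonempty_Icc.2 hmn
  obtain ⟨a, -, ha⟩ := isCompact_Icc.exists_isMinOn hne hα.continuousOn
  set β : ℝ → ℝ := fun p => α (projIcc m n hmn p) with hβ
  have hβα : ∀ p ∈ Icc m n, β p = α p := fun p hp => by
    simp only [hβ]; rw [projIcc_of_mem hmn hp]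
  have hβc : Continuous β := hα.comp (continuous_subtype_val.comp continuous_projIcc)
  have hβ0 : ∀ p, α a ≤ β p := fun p => ha (projIcc m n hmn p).2
  have hF := fun p => hasDerivAt_primitive hβc n p
  set F : ℝ → ℝ := fun p => ∫ s in n..p, β s with hFdef
  obtain ⟨b, hFb, hbF, hbmono, hb⟩ := exists_inverse_of_deriv_ge (hα0 a) hF hβ0
  have hFn : F n = 0 := by simp [hFdef]
  have hFm : F m = -∫ p in m..n, α p := by
    simp only [hFdef]
    rw [intervalIntegral.integral_symm]
    congr 1
    refine intervalIntegral.integral_congr fun p hp => ?_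
    rw [uIcc_of_le hmn] at hp
    exact hβα p hp
  have hI : 0 ≤ ∫ p in m..n, α p := intervalIntegral.integral_nonneg hmn fun p _ => (hα0 p).le
  set z₁ := (∫ p in m..n, α p) / κ with hz₁
  have hκz : κ * z₁ = ∫ p in m..n, α p := by rw [hz₁]; field_simp
  set s : ℝ → ℝ := fun z => b (-(κ * z)) with hs
  have hs0 : s 0 = n := by simp only [hs]; rw [mul_zero, neg_zero, ← hFn, hbF]
  have hs1 : s z₁ = m := by simp only [hs]; rw [hκz, ← hFm, hbF]
  have hsanti : StrictAnti s := fun x y hxy => hbmono (by nlinarith)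
  have hsd : ∀ z, HasDerivAt s (-κ / β (s z)) z := fun z => by
    have h1 : HasDerivAt (fun z => -(κ * z)) (-(κ * 1)) z :=
      ((hasDerivAt_id z).const_mul κ).neg
    exact ((hb _).comp z h1).congr_deriv (by rw [mul_one]; field_simp; rfl)
  have hG := fun p => hasDerivAt_primitive (continuous_id.mul hβc) n p
  have hgd : ∀ z, HasDerivAt (fun z => -(∫ p in n..(s z), (id p * β p)) / κ) (s z) z := by
    intro z
    have hne : β (s z) ≠ 0 := ((hα0 a).trans_le (hβ0 _)).ne'
    exact ((((hG (s z)).comp z (hsd z)).neg).div_const κ).congr_deriv (by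
      simp only [Pi.mul_apply, id]; field_simp)
  refine ⟨s, _, z₁, rfl, div_nonneg hI hκ.le, hs0, hs1, by simp [hs0], hsanti, hgd, ?_⟩
  intro z hz
  have hmem : s z ∈ Icc m n :=
    ⟨hs1 ▸ hsanti.antitone hz.2, hs0 ▸ hsanti.antitone hz.1⟩
  refine ⟨hmem, hβα _ hmem ▸ hsd z, ?_⟩
  rw [← intervalIntegral.integral_symm]
  congr 1
  refine intervalIntegral.integral_congr fun p hp => ?_
  rw [uIcc_of_le hmem.2] at hp
  simp only [id]
  rw [hβα p ⟨hmem.1.trans hp.1, hp.2⟩]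

end Profile

section UpperBound

variable {α : ℝ → ℝ} {u : ℝ → ℝ → ℝ} {S : Set (ℝ × ℝ)}

theorem RegularOn.hasDerivAt_x (hu : RegularOn u S) {x t : ℝ} (h : (x, t) ∈ S) :
    HasDerivAt (fun y => u y t) (pderivX u x t) x :=
  (hu.2.1 _ h).hasDerivAt

theorem RegularOn.hasDerivAt_xx (hu : RegularOn u S) {x t : ℝ} (h : (x, t) ∈ S) :
    HasDerivAt (fun y => pderivX u y t) (pderivXX u x t) x :=
  (hu.2.2.1 _ h).hasDerivAt

theorem RegularOn.hasDerivAt_t (hu : RegularOn u S) {x t : ℝ} (h : (x, t) ∈ S) :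
    HasDerivAt (fun s => u x s) (pderivT u x t) t :=
  (hu.2.2.2.1 _ h).hasDerivAt

theorem IsLocalMax.second_deriv_nonpos {f f' : ℝ → ℝ} {f'' x : ℝ} (h : IsLocalMax f x)
    (hf : ∀ᶠ y in 𝓝 x, HasDerivAt f (f' y) y) (hf' : HasDerivAt f' f'' x) : f'' ≤ 0 := by
  by_contra! hpos
  have hd : deriv f =ᶠ[𝓝 x] f' := hf.mono fun y hy => hy.deriv
  have hdd : deriv (deriv f) x = f'' := by rw [hd.deriv_eq]; exact hf'.deriv
  have hmin : IsLocalMin f x := isLocalMin_of_deriv_deriv_pos (by rw [hdd]; exact hpos)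
    h.deriv_eq_zero hf.self_of_nhds.continuousAt
  have hconst : f =ᶠ[𝓝 x] fun _ => f x := by
    filter_upwards [h, hmin] with y hy1 hy2 using le_antisymm hy1 hy2
  have h0 : deriv f =ᶠ[𝓝 x] fun _ => 0 := by
    have := hconst.deriv
    simpa using this
  rw [h0.deriv_eq] at hdd
  simp at hdd
  linarith

/-- Two-point maximum principle: the modulus of continuity of a bounded periodic solution is
controlled by a stationary profile. -/
theorem sub_le_profile {L M t κ z₁ : ℝ} {g s : ℝ → ℝ} (hL : 0 < L) (ht : 0 < t)
    (hz₁ : 0 ≤ z₁) (hM : 2 * M ≤ 4 * κ * t)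
    (hg0 : g 0 = 0) (hgz : 2 * M ≤ g z₁) (hg : ∀ z, HasDerivAt g (s z) z)
    (hgnn : ∀ z ∈ Icc 0 z₁, 0 ≤ g z)
    (hs : ∀ z ∈ Icc 0 z₁, 0 < α (s z) ∧ HasDerivAt s (-κ / α (s z)) z)
    (hu : RegularOn u (univ ×ˢ Icc 0 t))
    (heq : ∀ x, ∀ s ∈ Icc 0 t, pderivT u x s = α (pderivX u x s) * pderivXX u x s)
    (hper : ∀ x s, u (x + L) s = u x s) (hb : ∀ x, ∀ s ∈ Icc 0 t, |u x s| ≤ M) (x : ℝ) {z : ℝ}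
    (hz : z ∈ Icc 0 z₁) : u (x + z) t - u x t ≤ g z := by
  by_contra! hcon
  set m := u (x + z) t - u x t - g z with hm
  have hm0 : 0 < m := by linarith
  set ε := m / (2 * t) with hε
  have hε0 : 0 < ε := by positivity
  have hεt : ε * t = m / 2 := by rw [hε]; field_simp
  set Z : ℝ → ℝ → ℝ → ℝ := fun x z τ =>
    u (x + z) τ - u x τ - g z - 4 * κ * (t - τ) - ε * τ with hZ
  have hgc : Continuous g := continuous_iff_continuousAt.2 fun z => (hg z).continuousAt
  have hZc : ContinuousOn (fun w : ℝ × ℝ × ℝ => Z w.1 w.2.1 w.2.2)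
      (Icc 0 L ×ˢ Icc 0 z₁ ×ˢ Icc 0 t) := by
    have h1 : ContinuousOn (fun w : ℝ × ℝ × ℝ => u (w.1 + w.2.1) w.2.2)
        (Icc 0 L ×ˢ Icc 0 z₁ ×ˢ Icc 0 t) :=
      hu.1.comp (f := fun w : ℝ × ℝ × ℝ => (w.1 + w.2.1, w.2.2)) (by fun_prop)
        fun w hw => ⟨mem_univ _, hw.2.2⟩
    have h2 : ContinuousOn (fun w : ℝ × ℝ × ℝ => u w.1 w.2.2)
        (Icc 0 L ×ˢ Icc 0 z₁ ×ˢ Icc 0 t) :=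
      hu.1.comp (f := fun w : ℝ × ℝ × ℝ => (w.1, w.2.2)) (by fun_prop)
        fun w hw => ⟨mem_univ _, hw.2.2⟩
    simp only [hZ]
    exact (((h1.sub h2).sub (by fun_prop)).sub (by fun_prop)).sub (by fun_prop)
  obtain ⟨⟨x', z', τ⟩, ⟨-, hz', hτ⟩, hmax⟩ := (isCompact_Icc.prod (isCompact_Icc.prod
    isCompact_Icc)).exists_isMaxOn ⟨(0, 0, 0), ⟨le_rfl, hL.le⟩, ⟨le_rfl, hz₁⟩, le_rfl, ht.le⟩ hZc
  simp only at hz' hτ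
  have hmaxall : ∀ y, ∀ z ∈ Icc 0 z₁, ∀ σ ∈ Icc 0 t, Z y z σ ≤ Z x' z' τ := by
    intro y z hz σ hσ
    have hp : Function.Periodic (fun y => Z y z σ) L := fun y => by
      simp only [hZ]
      rw [hper y, show y + L + z = y + z + L by ring, hper (y + z)]
    obtain ⟨y', hy', hyy⟩ := hp.exists_mem_Ico₀ hL y
    rw [show Z y z σ = Z y' z σ from hyy]
    exact hmax (show (y', z, σ) ∈ _ from ⟨Ico_subset_Icc_self hy', hz, hσ⟩)
  have hpos : 0 < Z x' z' τ := by
    refine lt_of_lt_of_le ?_ (hmaxall x z hz t ⟨ht.le, le_rfl⟩)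
    simp only [hZ]
    linarith
  have hκt : 0 ≤ 4 * κ * t := by
    have := (abs_nonneg _).trans (hb 0 0 ⟨le_rfl, ht.le⟩)
    linarith
  have hκ : 0 ≤ κ := by
    by_contra! hneg
    nlinarith
  have hετ : 0 ≤ ε * τ := mul_nonneg hε0.le hτ.1
  have hκτ : 0 ≤ 4 * κ * (t - τ) := mul_nonneg (by linarith) (by linarith [hτ.2])
  have hsubM : u (x' + z') τ - u x' τ ≤ 2 * M := by
    linarith [(abs_le.1 (hb (x' + z') τ hτ)).2, (abs_le.1 (hb x' τ hτ)).1]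
  simp only [hZ] at hpos
  have hτ0 : 0 < τ := by
    refine lt_of_le_of_ne hτ.1 fun h => ?_
    rw [← h] at hpos hsubM
    linarith [hgnn z' hz']
  have hz'0 : 0 < z' := by
    refine lt_of_le_of_ne hz'.1 fun h => ?_
    rw [← h, hg0, add_zero] at hpos
    linarith
  have hz'1 : z' < z₁ := by
    refine lt_of_le_of_ne hz'.2 fun h => ?_
    rw [h] at hpos hsubM
    linarith
  have hmemS : ∀ y, (y, τ) ∈ (univ ×ˢ Icc 0 t : Set (ℝ × ℝ)) := fun y => ⟨mem_univ _, hτ⟩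
  have hzn : ∀ᶠ r in 𝓝 (0 : ℝ), z' + 2 * r ∈ Icc 0 z₁ := by
    have hc : ContinuousAt (fun r : ℝ => z' + 2 * r) 0 := by fun_prop
    exact hc.eventually_mem (by simpa using Icc_mem_nhds hz'0 hz'1)
  have hzn1 : ∀ᶠ r in 𝓝 (0 : ℝ), z' + r ∈ Icc 0 z₁ := by
    have hc : ContinuousAt (fun r : ℝ => z' + r) 0 := by fun_prop
    exact hc.eventually_mem (by simpa using Icc_mem_nhds hz'0 hz'1)
  have hdx : HasDerivAt (fun y => u (y + z') τ - u y τ - g z' - 4 * κ * (t - τ) - ε * τ)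
      (pderivX u (x' + z') τ - pderivX u x' τ) x' :=
    ((((hu.hasDerivAt_x (hmemS (x' + z'))).comp_add_const x' z').sub
      (hu.hasDerivAt_x (hmemS x'))).sub_const _ |>.sub_const _).sub_const _
  have e1 : pderivX u (x' + z') τ - pderivX u x' τ = 0 :=
    IsLocalMax.hasDerivAt_eq_zero (Eventually.of_forall fun y => hmaxall y z' hz' τ hτ) hdx
  have hdz : HasDerivAt (fun r => u (x' + (z' + r)) τ - u x' τ - g (z' + r) - 4 * κ * (t - τ)
      - ε * τ) (pderivX u (x' + z') τ - s z') 0 := by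
    have h1 : HasDerivAt (fun r => u (x' + (z' + r)) τ) (pderivX u (x' + z') τ) 0 := by
      have := (hu.hasDerivAt_x (hmemS (x' + z' + 0))).comp_const_add (x' + z') 0
      simpa [add_assoc] using this
    have h2 : HasDerivAt (fun r => g (z' + r)) (s z') 0 := by
      have := (hg (z' + 0)).comp_const_add z' 0
      simpa using this
    exact (((h1.sub_const _).sub h2).sub_const _).sub_const _
  have e2 : pderivX u (x' + z') τ - s z' = 0 :=
    IsLocalMax.hasDerivAt_eq_zero (by
      filter_upwards [hzn1] with r hr
      simp only [add_zero]
      exact hmaxall x' (z' + r) hr τ hτ) hdz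
  have hd1 : ∀ r, HasDerivAt (fun r => u (x' - r + (z' + 2 * r)) τ - u (x' - r) τ - g (z' + 2 * r)
      - 4 * κ * (t - τ) - ε * τ)
      (pderivX u (x' + z' + r) τ + pderivX u (x' - r) τ - 2 * s (z' + 2 * r)) r := by
    intro r
    have h1 : HasDerivAt (fun r => u (x' - r + (z' + 2 * r)) τ) (pderivX u (x' + z' + r) τ) r := by
      have := (hu.hasDerivAt_x (hmemS (x' + z' + r))).comp_const_add (x' + z') r
      exact this.congr_of_eventuallyEq (Eventually.of_forall fun r => by ring_nf)
    have h2 : HasDerivAt (fun r => u (x' - r) τ) (-pderivX u (x' - r) τ) r :=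
      (hu.hasDerivAt_x (hmemS (x' - r))).comp_const_sub x' r
    have h3 : HasDerivAt (fun r => g (z' + 2 * r)) (s (z' + 2 * r) * (2 * 1)) r :=
      (hg (z' + 2 * r)).comp r (((hasDerivAt_id r).const_mul 2).const_add z')
    exact ((((h1.sub h2).sub h3).sub_const _).sub_const _).congr_deriv (by ring)
  have hd2 : HasDerivAt (fun r => pderivX u (x' + z' + r) τ + pderivX u (x' - r) τ
      - 2 * s (z' + 2 * r)) (pderivXX u (x' + z') τ - pderivXX u x' τ - 4 * (-κ / α (s z'))) 0 := by
    have h1 : HasDerivAt (fun r => pderivX u (x' + z' + r) τ) (pderivXX u (x' + z') τ) 0 := by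
      have := (hu.hasDerivAt_xx (hmemS (x' + z' + 0))).comp_const_add (x' + z') 0
      simpa using this
    have h2 : HasDerivAt (fun r => pderivX u (x' - r) τ) (-pderivXX u x' τ) 0 := by
      have := (hu.hasDerivAt_xx (hmemS (x' - 0))).comp_const_sub x' 0
      simpa using this
    have h3 : HasDerivAt (fun r => s (z' + 2 * r)) (-κ / α (s z') * (2 * 1)) 0 := by
      have h4 : HasDerivAt s (-κ / α (s z')) (z' + 2 * 0) := by
        simpa using (hs z' hz').2
      exact h4.comp 0 (((hasDerivAt_id 0).const_mul 2).const_add z')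
    exact ((h1.add h2).sub (h3.const_mul 2)).congr_deriv (by ring)
  have e3 := IsLocalMax.second_deriv_nonpos (f := fun r => u (x' - r + (z' + 2 * r)) τ
      - u (x' - r) τ - g (z' + 2 * r) - 4 * κ * (t - τ) - ε * τ) (by
      filter_upwards [hzn] with r hr
      simp only [sub_zero, mul_zero, add_zero]
      exact hmaxall (x' - r) (z' + 2 * r) hr τ hτ) (Eventually.of_forall hd1) hd2
  have hdt : HasDerivAt (fun σ => u (x' + z') σ - u x' σ - g z' - 4 * κ * (t - σ) - ε * σ)
      (pderivT u (x' + z') τ - pderivT u x' τ - 4 * κ * (-1) - ε * 1) τ :=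
    ((((hu.hasDerivAt_t (hmemS (x' + z'))).sub (hu.hasDerivAt_t (hmemS x'))).sub_const _).sub
      (((hasDerivAt_id τ).const_sub t).const_mul (4 * κ))).sub ((hasDerivAt_id τ).const_mul ε)
  have e4 := hdt.nonneg_of_left_max hτ0 fun σ hσ => hmaxall x' z' hz' σ ⟨hσ.1, hσ.2.trans hτ.2⟩
  have e5 : pderivX u (x' + z') τ = s z' := by linarith
  have e6 : pderivX u x' τ = s z' := by linarith
  rw [heq _ τ hτ, heq _ τ hτ, e5, e6] at e4
  have hα0 := (hs z' hz').1
  have h5 : α (s z') * (-κ / α (s z')) = -κ := by field_simp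
  nlinarith

theorem exists_pderivX_le (hα : Continuous α) (hα0 : ∀ p, 0 < α p) {L M t : ℝ} (hL : 0 < L)
    (hM : 0 < M) (ht : 0 < t)
    (hB : Tendsto (fun ξ => ∫ s in (0 : ℝ)..ξ, s * α s) atTop atTop) :
    ∃ C, ∀ u : ℝ → ℝ → ℝ, RegularOn u (univ ×ˢ Icc 0 t) →
      (∀ x, ∀ s ∈ Icc 0 t, pderivT u x s = α (pderivX u x s) * pderivXX u x s) →
      (∀ x s, u (x + L) s = u x s) → (∀ x, ∀ s ∈ Icc 0 t, |u x s| ≤ M) →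
      ∀ z, pderivX u z t ≤ C := by
  set κ := M / (2 * t) with hκ
  have hκ0 : 0 < κ := by positivity
  obtain ⟨C, hC0, hC⟩ := ((eventually_gt_atTop 0).and
    (hB.eventually_ge_atTop (2 * M * κ))).exists
  obtain ⟨s, g, z₁, hz₁, hz₁0, hs0, hs1, hg0, hsanti, hg, hprof⟩ :=
    exists_profile hα hα0 hC0.le hκ0
  have hz₁pos : 0 < z₁ := by
    refine lt_of_le_of_ne hz₁0 fun h => ?_
    rw [← h, hs0] at hs1
    linarith
  have hgz : 2 * M ≤ g z₁ := by
    rw [(hprof z₁ ⟨hz₁0, le_rfl⟩).2.2, hs1, le_div_iff₀ hκ0]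
    exact hC
  have hgnn : ∀ z ∈ Icc 0 z₁, 0 ≤ g z := fun z hz => by
    rw [(hprof z hz).2.2]
    refine div_nonneg (intervalIntegral.integral_nonneg (hprof z hz).1.2 fun p hp => ?_) hκ0.le
    exact mul_nonneg ((hprof z hz).1.1.trans hp.1) (hα0 p).le
  refine ⟨C, fun u hu heq hper hb z => ?_⟩
  have key := fun r hr => sub_le_profile hL ht hz₁0
    (by rw [hκ]; exact le_of_eq (by field_simp; norm_num)) hg0 hgz hg hgnn
    (fun z hz => ⟨hα0 _, (hprof z hz).2.1⟩) hu heq hper hb z (z := r) hr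
  have hd : HasDerivAt (fun r => u (z - r) t - u z t - g (0 - r)) (-pderivX u z t + s 0) 0 := by
    have h1 := (hu.hasDerivAt_x (x := z - 0) (t := t) ⟨mem_univ _, ht.le, le_rfl⟩).comp_const_sub z 0
    have h2 := (hg (0 - 0)).comp_const_sub 0 0
    rw [sub_zero] at h1 h2
    exact ((h1.sub_const _).sub h2).congr_deriv (by ring)
  have := hd.nonneg_of_left_max (a := -z₁) (by linarith) fun r hr => by
    have := key (-r) ⟨by linarith [hr.2], by linarith [hr.1]⟩
    simp only [sub_zero, sub_self, hg0, zero_sub]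
    rw [sub_eq_add_neg z r]
    linarith
  linarith

end UpperBound

section Rescale

theorem pderivX_rescale (u : ℝ → ℝ → ℝ) (a b r x s : ℝ) :
    pderivX (fun x s => a * u (b * x) (s + r)) x s = a * b * pderivX u (b * x) (s + r) := by
  simp only [pderivX]
  rw [deriv_const_mul_field, deriv_comp_mul_left b (fun y => u y (s + r)), smul_eq_mul, mul_assoc]

theorem pderivXX_rescale (u : ℝ → ℝ → ℝ) (a b r x s : ℝ) :
    pderivXX (fun x s => a * u (b * x) (s + r)) x s =
      a * b ^ 2 * pderivXX u (b * x) (s + r) := by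
  simp only [pderivXX, pderivX_rescale]
  rw [deriv_const_mul_field, deriv_comp_mul_left b (fun y => pderivX u y (s + r)), smul_eq_mul]
  ring

theorem pderivT_rescale (u : ℝ → ℝ → ℝ) (a b r x s : ℝ) :
    pderivT (fun x s => a * u (b * x) (s + r)) x s = a * pderivT u (b * x) (s + r) := by
  simp only [pderivT]
  rw [deriv_const_mul_field, deriv_comp_add_const (fun s => u (b * x) s)]

theorem RegularOn.rescale {u : ℝ → ℝ → ℝ} {I J : Set ℝ} {r : ℝ} (hu : RegularOn u (univ ×ˢ I))
    (a b : ℝ) (hJ : ∀ s ∈ J, s + r ∈ I) :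
    RegularOn (fun x s => a * u (b * x) (s + r)) (univ ×ˢ J) := by
  have hm : MapsTo (fun p : ℝ × ℝ => (b * p.1, p.2 + r)) (univ ×ˢ J) (univ ×ˢ I) :=
    fun p hp => ⟨mem_univ _, hJ _ hp.2⟩
  have hc : Continuous fun p : ℝ × ℝ => (b * p.1, p.2 + r) := by fun_prop
  have comp : ∀ F : ℝ → ℝ → ℝ, ContinuousOn (fun p : ℝ × ℝ => F p.1 p.2) (univ ×ˢ I) → ∀ k : ℝ,
      ContinuousOn (fun p : ℝ × ℝ => k * F (b * p.1) (p.2 + r)) (univ ×ˢ J) := fun F hF k =>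
    continuousOn_const.mul (hF.comp hc.continuousOn hm)
  have diffX : ∀ F : ℝ → ℝ → ℝ, (∀ p ∈ univ ×ˢ I, DifferentiableAt ℝ (fun y => F y p.2) p.1) →
      ∀ k : ℝ, ∀ p ∈ univ ×ˢ J, DifferentiableAt ℝ (fun y => k * F (b * y) (p.2 + r)) p.1 := by
    intro F hF k p hp
    exact ((hF _ (hm hp)).comp p.1 (f := fun y => b * y) (by fun_prop)).const_mul k
  obtain ⟨h1, h2, h3, h4, h5, h6, h7⟩ := hu
  refine ⟨comp u h1 a, diffX u h2 a, ?_, ?_, ?_, ?_, ?_⟩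
  · simp only [pderivX_rescale]
    exact diffX _ h3 _
  · intro p hp
    exact ((h4 _ (hm hp)).comp p.2 (f := fun s => s + r) (by fun_prop)).const_mul a
  · simp only [pderivX_rescale]
    exact comp _ h5 _
  · simp only [pderivXX_rescale]
    exact comp _ h6 _
  · simp only [pderivT_rescale]
    exact comp _ h7 _

end Rescale

section Barrier

variable {α : ℝ → ℝ} {u : ℝ → ℝ → ℝ} {φ ψ : ℝ → ℝ}

/-- Comparison of a solution with a subsolution `φ x - c s` on a spatial interval. -/
theorem barrier_le (hα : Continuous α) (hα0 : ∀ p, 0 < α p) {M T T' ℓ c : ℝ} (hℓ : 0 < ℓ)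
    (hT' : 0 ≤ T') (hTT : T' < T) (hc : 0 ≤ c) (hφ : ∀ x, HasDerivAt φ (ψ x) x)
    (hψ : ∀ x ∈ Ioo 0 ℓ, ∃ d, -c ≤ d ∧
      HasDerivWithinAt (fun y => ∫ p in (0 : ℝ)..ψ y, α p) d (Ioi x) x)
    (hu : ContinuousOn (fun z : ℝ × ℝ => u z.1 z.2) (univ ×ˢ Icc 0 T))
    (hreg : RegularOn u (univ ×ˢ Ioo 0 T))
    (heq : ∀ x, ∀ s ∈ Ioo 0 T, pderivT u x s = α (pderivX u x s) * pderivXX u x s)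
    (hb : ∀ x, ∀ s ∈ Icc 0 T, |u x s| ≤ M) (h0 : φ 0 ≤ -M) (h1 : φ ℓ ≤ -M)
    (hinit : ∀ x ∈ Icc 0 ℓ, φ x ≤ u x 0) :
    ∀ x ∈ Icc 0 ℓ, φ x - c * T' ≤ u x T' := by
  intro x hx
  refine le_of_forall_pos_le_add fun ε' hε' => ?_
  obtain ⟨ε, hε, hεT⟩ : ∃ ε, 0 < ε ∧ ε * T' ≤ ε' := by
    refine ⟨ε' / (T' + 1), by positivity, ?_⟩
    rw [div_mul_eq_mul_div, div_le_iff₀ (by linarith)]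
    nlinarith
  suffices h : 0 ≤ u x T' - φ x + (c + ε) * T' by nlinarith
  by_contra! hneg
  have hφc : Continuous φ := continuous_iff_continuousAt.2 fun z => (hφ z).continuousAt
  have hWc : ContinuousOn (fun w : ℝ × ℝ => u w.1 w.2 - φ w.1 + (c + ε) * w.2)
      (Icc 0 ℓ ×ˢ Icc 0 T') :=
    ((hu.mono (prod_mono (subset_univ _) (Icc_subset_Icc_right hTT.le))).sub
      (by fun_prop)).add (by fun_prop)
  obtain ⟨⟨y, τ⟩, ⟨hy, hτ⟩, hmin⟩ := (isCompact_Icc.prod isCompact_Icc).exists_isMinOn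
    ⟨(0, 0), ⟨le_rfl, hℓ.le⟩, le_rfl, hT'⟩ hWc
  simp only at hy hτ
  have hminall : ∀ z ∈ Icc 0 ℓ, ∀ σ ∈ Icc 0 T',
      u y τ - φ y + (c + ε) * τ ≤ u z σ - φ z + (c + ε) * σ := fun z hz σ hσ =>
    hmin (show (z, σ) ∈ _ from ⟨hz, hσ⟩)
  have hlt : u y τ - φ y + (c + ε) * τ < 0 := (hminall x hx T' ⟨hT', le_rfl⟩).trans_lt hneg
  have hcτ : 0 ≤ (c + ε) * τ := mul_nonneg (by linarith) hτ.1
  have hlow := (abs_le.1 (hb y τ ⟨hτ.1, hτ.2.trans hTT.le⟩)).1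
  have hy0 : 0 < y := lt_of_le_of_ne hy.1 fun h => by
    rw [← h] at hlt hlow; linarith
  have hy1 : y < ℓ := lt_of_le_of_ne hy.2 fun h => by
    rw [h] at hlt hlow; linarith
  have hτ0 : 0 < τ := lt_of_le_of_ne hτ.1 fun h => by
    rw [← h] at hlt hcτ; linarith [hinit y hy]
  have hτT : τ ∈ Ioo 0 T := ⟨hτ0, hτ.2.trans_lt hTT⟩
  have hS : ∀ z, (z, τ) ∈ (univ ×ˢ Ioo 0 T : Set (ℝ × ℝ)) := fun z => ⟨mem_univ _, hτT⟩
  have hux : pderivX u y τ = ψ y := by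
    have hd : HasDerivAt (fun z => u z τ - φ z + (c + ε) * τ) (pderivX u y τ - ψ y) y :=
      ((hreg.hasDerivAt_x (hS y)).sub (hφ y)).add_const _
    have : IsLocalMin (fun z => u z τ - φ z + (c + ε) * τ) y := by
      filter_upwards [Icc_mem_nhds hy0 hy1] with z hz using hminall z hz τ hτ
    linarith [this.hasDerivAt_eq_zero hd]
  have hut : pderivT u y τ ≤ -(c + ε) := by
    have hd : HasDerivAt (fun σ => -(u y σ - φ y + (c + ε) * σ))
        (-(pderivT u y τ + (c + ε) * 1)) τ :=
      (((hreg.hasDerivAt_t (hS y)).sub_const _).add ((hasDerivAt_id τ).const_mul _)).neg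
    have := hd.nonneg_of_left_max hτ0 fun σ hσ =>
      neg_le_neg (hminall y hy σ ⟨hσ.1, hσ.2.trans hτ.2⟩)
    linarith
  obtain ⟨d, hd, hdψ⟩ := hψ y ⟨hy0, hy1⟩
  set A : ℝ → ℝ := fun p => ∫ q in (0 : ℝ)..p, α q with hA
  have hAd : ∀ p, HasDerivAt A (α p) p := hasDerivAt_primitive hα 0
  have hAmono : StrictMono A := strictMono_of_hasDerivAt_pos hAd hα0
  have hdu : HasDerivAt (fun z => A (pderivX u z τ)) (pderivT u y τ) y := by
    rw [heq y τ hτT]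
    exact (hAd _).comp y (hreg.hasDerivAt_xx (hS y))
  have hh : HasDerivWithinAt (fun z => A (pderivX u z τ) - A (ψ z)) (pderivT u y τ - d) (Ioi y) y :=
    hdu.hasDerivWithinAt.sub hdψ
  have hslope := (hasDerivWithinAt_iff_tendsto_slope' self_notMem_Ioi).1 hh
  have hev := hslope.eventually_lt_const (u := 0) (by linarith)
  obtain ⟨r, hr, hrs⟩ := mem_nhdsGT_iff_exists_Ioo_subset.1 hev
  have hsign : ∀ z ∈ Ioo y r, pderivX u z τ - ψ z < 0 := fun z hz => by
    have h := hrs hz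
    simp only [mem_ofPred_eq, slope_def_field, hux, sub_self, sub_zero] at h
    have hzy : 0 < z - y := sub_pos.2 hz.1
    have : A (pderivX u z τ) < A (ψ z) := by
      by_contra! hcon
      exact absurd h (not_lt.2 (div_nonneg (sub_nonneg.2 hcon) hzy.le))
    linarith [hAmono.lt_iff_lt.1 this]
  have hr : y < r := hr
  set q := min r ℓ with hq
  have hyq : y < q := lt_min hr hy1
  have hdiff : ∀ z, HasDerivAt (fun z => u z τ - φ z) (pderivX u z τ - ψ z) z := fun z =>
    (hreg.hasDerivAt_x (hS z)).sub (hφ z)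
  obtain ⟨z, hz, hzeq⟩ := exists_hasDerivAt_eq_slope (fun z => u z τ - φ z) _ hyq
    (continuousOn_of_forall_continuousAt fun z _ => (hdiff z).continuousAt) fun z _ => hdiff z
  have hn := hsign z ⟨hz.1, hz.2.trans_le (min_le_left _ _)⟩
  rw [hzeq] at hn
  have := hminall q ⟨hy0.le.trans hyq.le, min_le_right _ _⟩ τ hτ
  exact absurd hn (not_lt.2 (div_nonneg (by linarith) (by linarith)))

/-- The concave profile of slope `n` to the left of `0` and slope `m` to the right of the
transition zone. -/
theorem exists_barrier_profile (hα : Continuous α) (hα0 : ∀ p, 0 < α p) {m n c : ℝ}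
    (hm : m ≤ 0) (hn : 0 ≤ n) (hc : 0 < c) :
    ∃ Φ ψ : ℝ → ℝ, (∀ x, HasDerivAt Φ (ψ x) x) ∧
      (∀ x, ∃ d, -c ≤ d ∧ HasDerivWithinAt (fun y => ∫ p in (0 : ℝ)..ψ y, α p) d (Ioi x) x) ∧
      (∀ x ≤ 0, Φ x = n * x) ∧ (∀ x, Φ x ≤ (∫ p in (0 : ℝ)..n, p * α p) / c) ∧
      ∀ x, (∫ p in m..n, α p) / c ≤ x →
        Φ x ≤ (∫ p in (0 : ℝ)..n, p * α p) / c + m * (x - (∫ p in m..n, α p) / c) := by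
  have hmn := hm.trans hn
  obtain ⟨s, g, z₁, hz₁, hz₁0, hs0, hs1, hg0, hsanti, hg, hprof⟩ := exists_profile hα hα0 hmn hc
  rw [← hz₁]
  have hmem : ∀ z, (projIcc 0 z₁ hz₁0 z : ℝ) ∈ Icc 0 z₁ := fun z => (projIcc 0 z₁ hz₁0 z).2
  set ψ : ℝ → ℝ := fun z => s (projIcc 0 z₁ hz₁0 z) with hψ
  have hleft : ∀ z ≤ 0, ψ z = n := fun z hz => by
    simp only [hψ]; rw [projIcc_of_le_left hz₁0 hz, hs0]
  have hright : ∀ z, z₁ ≤ z → ψ z = m := fun z hz => by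
    simp only [hψ]; rw [projIcc_of_right_le hz₁0 hz, hs1]
  have hmid : ∀ z ∈ Icc 0 z₁, ψ z = s z := fun z hz => by
    simp only [hψ]; rw [projIcc_of_mem hz₁0 hz]
  have hψc : Continuous ψ := by
    have : ContinuousOn s (Icc 0 z₁) := fun z hz =>
      (hprof z hz).2.1.continuousAt.continuousWithinAt
    exact this.comp_continuous (continuous_subtype_val.comp continuous_projIcc) hmem
  set A : ℝ → ℝ := fun p => ∫ q in (0 : ℝ)..p, α q with hA
  have hAd : ∀ p, HasDerivAt A (α p) p := hasDerivAt_primitive hα 0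
  have hintegrable : ∀ a b, IntervalIntegrable (fun p => p * α p) volume a b := fun a b =>
    (continuous_id.mul hα).intervalIntegrable _ _
  have hBnn : 0 ≤ ∫ p in (0 : ℝ)..n, p * α p :=
    intervalIntegral.integral_nonneg hn fun p hp => mul_nonneg hp.1 (hα0 p).le
  have hΦl : ∀ x ≤ 0, ∫ z in (0 : ℝ)..x, ψ z = n * x := fun x hx => by
    rw [intervalIntegral.integral_congr (g := fun _ => n) fun z hz => ?_]
    · simp [mul_comm]
    · rw [uIcc_of_ge hx] at hz
      exact hleft z hz.2
  have hΦm : ∀ x ∈ Icc 0 z₁, ∫ z in (0 : ℝ)..x, ψ z ≤ (∫ p in (0 : ℝ)..n, p * α p) / c := by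
    intro x hx
    have h1 : ∫ z in (0 : ℝ)..x, ψ z = g x := by
      rw [intervalIntegral.integral_eq_sub_of_hasDerivAt (f := g) (fun z hz => ?_)
        (hψc.intervalIntegrable _ _), hg0, sub_zero]
      rw [uIcc_of_le hx.1] at hz
      rw [hmid z ⟨hz.1, hz.2.trans hx.2⟩]
      exact hg z
    rw [h1, (hprof x hx).2.2]
    gcongr
    rw [← intervalIntegral.integral_add_adjacent_intervals (hintegrable (s x) 0) (hintegrable 0 n)]
    have : ∫ p in (s x)..0, p * α p ≤ 0 := by
      rcases le_total (s x) 0 with h | h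
      · rw [← neg_nonneg, ← intervalIntegral.integral_neg]
        exact intervalIntegral.integral_nonneg h fun p hp =>
          neg_nonneg.2 (mul_nonpos_of_nonpos_of_nonneg hp.2 (hα0 p).le)
      · rw [intervalIntegral.integral_symm]
        exact neg_nonpos.2 (intervalIntegral.integral_nonneg h fun p hp =>
          mul_nonneg hp.1 (hα0 p).le)
    linarith
  have hΦr : ∀ x, z₁ ≤ x →
      ∫ z in (0 : ℝ)..x, ψ z ≤ (∫ p in (0 : ℝ)..n, p * α p) / c + m * (x - z₁) := by
    intro x hx
    rw [← intervalIntegral.integral_add_adjacent_intervals (hψc.intervalIntegrable 0 z₁)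
      (hψc.intervalIntegrable z₁ x)]
    refine add_le_add (hΦm z₁ ⟨hz₁0, le_rfl⟩) ?_
    rw [intervalIntegral.integral_congr (g := fun _ => m) fun z hz => ?_]
    · simp [mul_comm]
    · rw [uIcc_of_le hx] at hz
      exact hright z hz.1
  refine ⟨fun x => ∫ z in (0 : ℝ)..x, ψ z, ψ, hasDerivAt_primitive hψc 0, ?_, hΦl, ?_, hΦr⟩
  · intro x
    rcases lt_or_ge x 0 with hx | hx
    · refine ⟨0, by linarith, ((hasDerivAt_const x (A n)).congr_of_eventuallyEq ?_).hasDerivWithinAt⟩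
      filter_upwards [gt_mem_nhds hx] with z hz
      simp only [hA]; rw [hleft z hz.le]
    rcases lt_or_ge x z₁ with hx1 | hx1
    · refine ⟨-c, le_rfl, ?_⟩
      have h1 := (hAd (s x)).comp x (hprof x ⟨hx, hx1.le⟩).2.1
      have h2 : α (s x) * (-c / α (s x)) = -c := by
        have := (hα0 (s x)).ne'
        field_simp
      rw [h2] at h1
      refine h1.hasDerivWithinAt.congr_of_eventuallyEq ?_ ?_
      · filter_upwards [Ioo_mem_nhdsGT hx1] with z hz
        simp only [hA, Function.comp]; rw [hmid z ⟨hx.trans hz.1.le, hz.2.le⟩]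
      · simp only [hA, Function.comp]; rw [hmid x ⟨hx, hx1.le⟩]
    · refine ⟨0, by linarith, (hasDerivWithinAt_const x _ (A m)).congr ?_ ?_⟩
      · intro z hz
        simp only [hA]; rw [hright z (hx1.trans (le_of_lt hz))]
      · simp only [hA]; rw [hright x hx1]
  · intro x
    rcases le_total x 0 with hx | hx
    · simp only
      rw [hΦl x hx]
      exact (mul_nonpos_of_nonneg_of_nonpos hn hx).trans (div_nonneg hBnn hc.le)
    rcases le_total x z₁ with hx1 | hx1
    · exact hΦm x ⟨hx, hx1⟩
    · have := hΦr x hx1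
      have h2 := mul_nonpos_of_nonpos_of_nonneg hm (sub_nonneg.2 hx1)
      simp only
      linarith

end Barrier

section Necessity

variable {α : ℝ → ℝ}

/-- Smooth odd periodic functions with values in `[-M, M]` that are nearly `M` on `[δ, L / 4]`. -/
theorem exists_odd_step {L δ M' M : ℝ} (hL : 0 < L) (hδ : 0 < δ) (hδL : δ < L / 4) (hM' : 0 < M')
    (hM : M' < M) :
    ∃ f f' f'' : ℝ → ℝ, (∀ x, HasDerivAt f (f' x) x) ∧ (∀ x, HasDerivAt f' (f'' x) x) ∧
      Continuous f'' ∧ (∀ x, f (x + L) = f x) ∧ (∀ x, |f x| ≤ M) ∧ (∀ x, f (-x) = -f x) ∧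
      (∀ x ∈ Icc 0 (L / 4), 0 ≤ f x) ∧ ∀ x ∈ Icc δ (L / 4), M' ≤ f x := by
  have hM0 : 0 < M := hM'.trans hM
  have hπ := Real.pi_pos
  have hlim : Tendsto (fun y => M * (2 / π) * arctan y) atTop (𝓝 (M * (2 / π) * (π / 2))) :=
    (tendsto_nhds_of_tendsto_nhdsWithin tendsto_arctan_atTop).const_mul _
  have hMe : M * (2 / π) * (π / 2) = M := by field_simp
  rw [hMe] at hlim
  have harg : ∀ x ∈ Icc 0 (L / 4), 2 * π / L * x ∈ Icc 0 (π / 2) := fun x hx => by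
    refine ⟨mul_nonneg (by positivity) hx.1, ?_⟩
    have : 2 * π / L * x ≤ 2 * π / L * (L / 4) := by gcongr; exact hx.2
    refine this.trans (le_of_eq ?_)
    field_simp
    norm_num
  have hσ : 0 < sin (2 * π / L * δ) := by
    refine sin_pos_of_pos_of_lt_pi (by positivity) ?_
    linarith [(harg δ ⟨hδ.le, hδL.le⟩).2]
  obtain ⟨y, hy0, hy⟩ := ((eventually_gt_atTop (0 : ℝ)).and (hlim.eventually_const_le hM)).exists
  set k := y / sin (2 * π / L * δ) with hk
  have hk0 : 0 < k := div_pos hy0 hσ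
  have hkσ : k * sin (2 * π / L * δ) = y := div_mul_cancel₀ _ hσ.ne'
  set f : ℝ → ℝ := fun x => M * (2 / π) * arctan (k * sin (2 * π / L * x)) with hf
  have hfs : ContDiff ℝ 2 f := by
    refine contDiff_const.mul (contDiff_arctan.comp (contDiff_const.mul (contDiff_sin.comp ?_)))
    fun_prop
  have hfs' : ContDiff ℝ 1 (deriv f) := ((contDiff_succ_iff_deriv (n := 1)).1 hfs).2.2
  have hfs'' : ContDiff ℝ 0 (deriv (deriv f)) := ((contDiff_succ_iff_deriv (n := 0)).1 hfs').2.2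
  refine ⟨f, deriv f, deriv (deriv f), fun x => (hfs.differentiable (by norm_num) x).hasDerivAt,
    fun x => (hfs'.differentiable (by norm_num) x).hasDerivAt, hfs''.continuous, ?_, ?_, ?_, ?_, ?_⟩
  · intro x
    simp only [hf]
    rw [show 2 * π / L * (x + L) = 2 * π / L * x + 2 * π by field_simp, sin_add_two_pi]
  · intro x
    simp only [hf]
    rw [abs_mul, abs_of_pos (by positivity : 0 < M * (2 / π))]
    calc M * (2 / π) * |arctan (k * sin (2 * π / L * x))| ≤ M * (2 / π) * (π / 2) := by
          gcongr
          exact abs_le.2 ⟨(neg_pi_div_two_lt_arctan _).le, (arctan_lt_pi_div_two _).le⟩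
      _ = M := hMe
  · intro x
    simp only [hf]
    rw [mul_neg, sin_neg, mul_neg, arctan_neg, mul_neg]
  · intro x hx
    refine mul_nonneg (by positivity) (arctan_nonneg.2 (mul_nonneg hk0.le ?_))
    exact sin_nonneg_of_nonneg_of_le_pi (harg x hx).1 (by linarith [(harg x hx).2])
  · intro x hx
    have hx' : x ∈ Icc 0 (L / 4) := ⟨hδ.le.trans hx.1, hx.2⟩
    refine hy.trans ?_
    simp only [hf]
    gcongr
    rw [← hkσ]
    gcongr
    refine sin_le_sin_of_le_of_le_pi_div_two ?_ (harg x hx').2 (by gcongr; exact hx.1)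
    linarith [(harg δ ⟨hδ.le, hδL.le⟩).1]

/-- If `∫ p α(p) dp` stays bounded on `[0, ∞)`, there are uniformly bounded solutions with
arbitrarily large slope at a fixed positive time. -/
theorem exists_steep_solution (hα : Continuous α) (hα0 : ∀ p, 0 < α p) {L K : ℝ} (hL : 0 < L)
    (hK : ∀ ξ, 0 ≤ ξ → ∫ p in (0 : ℝ)..ξ, p * α p ≤ K) :
    ∃ M, 0 < M ∧ ∃ t, 0 < t ∧ ∀ C, ∃ u : ℝ → ℝ → ℝ, RegularOn u (univ ×ˢ Icc 0 t) ∧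
      (∀ x, ∀ s ∈ Icc 0 t, pderivT u x s = α (pderivX u x s) * pderivXX u x s) ∧
      (∀ x s, u (x + L) s = u x s) ∧ (∀ x, ∀ s ∈ Icc 0 t, |u x s| ≤ M) ∧
      ∃ z, C < pderivX u z t := by
  have hK0 : 0 ≤ K := by simpa using hK 0 le_rfl
  set ℓ := L / 4 with hℓ
  have hℓ0 : 0 < ℓ := by positivity
  set M := K + 4 with hMdef
  have hM0 : 0 < M := by linarith
  set m := -(2 * (3 + K + M) / ℓ) with hm
  have hm0 : m ≤ 0 := neg_nonpos.2 (by positivity)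
  set a := (∫ p in m..1, α p) + K with ha
  set c := max 1 (4 * a / ℓ) with hc
  have hc1 : 1 ≤ c := le_max_left _ _
  have hc0 : 0 < c := by linarith
  have hac : a / c ≤ ℓ / 4 := by
    rw [div_le_iff₀ hc0]
    have := le_max_right 1 (4 * a / ℓ)
    rw [← hc, div_le_iff₀ hℓ0] at this
    linarith
  set t := 1 / c with ht
  have ht0 : 0 < t := by positivity
  have hct : c * t = 1 := by rw [ht]; field_simp
  have hαi : ∀ x y, IntervalIntegrable α volume x y := fun x y => hα.intervalIntegrable x y
  have hpαi : ∀ x y, IntervalIntegrable (fun p => p * α p) volume x y := fun x y =>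
    (continuous_id.mul hα).intervalIntegrable x y
  have hA : ∀ n, 1 ≤ n → ∫ p in m..n, α p ≤ a := by
    intro n hn
    rw [← intervalIntegral.integral_add_adjacent_intervals (hαi m 1) (hαi 1 n), ha]
    gcongr
    have h1 : ∫ p in (1 : ℝ)..n, α p ≤ ∫ p in (1 : ℝ)..n, p * α p :=
      intervalIntegral.integral_mono_on hn (hαi _ _) (hpαi _ _) fun p hp =>
        le_mul_of_one_le_left (hα0 p).le hp.1
    have h2 : 0 ≤ ∫ p in (0 : ℝ)..1, p * α p :=
      intervalIntegral.integral_nonneg zero_le_one fun p hp => mul_nonneg hp.1 (hα0 p).le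
    have h3 := hK n (by linarith)
    rw [← intervalIntegral.integral_add_adjacent_intervals (hpαi 0 1) (hpαi 1 n)] at h3
    linarith
  refine ⟨M, hM0, t, ht0, fun C => ?_⟩
  obtain ⟨n, hn1, hnC, hnℓ⟩ : ∃ n, 1 ≤ n ∧ C * (M + 3) < n ∧ (M + 3) / n ≤ ℓ / 4 := by
    refine ⟨max 1 (max (C * (M + 3) + 1) (4 * (M + 3) / ℓ)), le_max_left _ _, ?_, ?_⟩
    · exact (lt_add_one _).trans_le ((le_max_left _ _).trans (le_max_right _ _))
    · rw [div_le_iff₀ (lt_of_lt_of_le one_pos (le_max_left _ _))]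
      have h : 4 * (M + 3) / ℓ ≤ max 1 (max (C * (M + 3) + 1) (4 * (M + 3) / ℓ)) :=
        (le_max_right _ _).trans (le_max_right _ _)
      rw [div_le_iff₀ hℓ0] at h
      linarith
  have hn0 : 0 < n := by linarith
  set x₀ := (M + 3) / n with hx₀
  have hx₀0 : 0 < x₀ := by positivity
  have hnx₀ : n * x₀ = M + 3 := by rw [hx₀]; field_simp
  set δ := M / n with hδ
  have hδ0 : 0 < δ := by positivity
  have hnδ : n * δ = M := by rw [hδ]; field_simp
  have hδx : δ < x₀ := by rw [hδ, hx₀]; gcongr; linarith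
  obtain ⟨Φ, ψ, hΦ, hψ, hΦl, hΦb, hΦr⟩ := exists_barrier_profile hα hα0 hm0 hn0.le hc0
  have hBc : (∫ p in (0 : ℝ)..n, p * α p) / c ≤ K :=
    (div_le_self (intervalIntegral.integral_nonneg hn0.le fun p hp =>
      mul_nonneg hp.1 (hα0 p).le) hc1).trans (hK n hn0.le)
  have hz₁ : (∫ p in m..n, α p) / c ≤ ℓ / 4 :=
    (div_le_div_of_nonneg_right (hA n hn1) hc0.le).trans hac
  set φ : ℝ → ℝ := fun x => 3 + Φ (x - x₀) with hφdef
  have hφ : ∀ x, HasDerivAt φ (ψ (x - x₀)) x := fun x =>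
    ((hΦ (x - x₀)).comp_sub_const x x₀).const_add 3
  have hφψ : ∀ x ∈ Ioo 0 ℓ, ∃ d, -c ≤ d ∧
      HasDerivWithinAt (fun y => ∫ p in (0 : ℝ)..ψ (y - x₀), α p) d (Ioi x) x := fun x _ => by
    obtain ⟨d, hd, hdψ⟩ := hψ (x - x₀)
    refine ⟨d, hd, ?_⟩
    have h := hdψ.comp x (h := fun y => y - x₀) (s := Ioi x)
      ((hasDerivWithinAt_id x _).sub_const x₀) fun y hy => sub_lt_sub_right (mem_Ioi.1 hy) x₀
    simpa [Function.comp_def] using h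
  have hφx₀ : φ x₀ = 3 := by
    simp only [hφdef]
    rw [sub_self, hΦl 0 le_rfl]
    ring
  have hφ0 : φ 0 ≤ -M := by
    simp only [hφdef]
    rw [hΦl _ (by linarith)]
    linarith
  have hφδ : ∀ x ≤ δ, φ x ≤ 0 := fun x hx => by
    simp only [hφdef]
    rw [hΦl _ (by linarith)]
    nlinarith
  have hφb : ∀ x, φ x ≤ 3 + K := fun x => by
    simp only [hφdef]
    linarith [hΦb (x - x₀)]
  have hφ1 : φ ℓ ≤ -M := by
    have h1 := hΦr (ℓ - x₀) (by linarith)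
    have h2 : m * (ℓ - x₀ - (∫ p in m..n, α p) / c) ≤ m * (ℓ / 2) :=
      mul_le_mul_of_nonpos_left (by linarith) hm0
    have h3 : m * (ℓ / 2) = -(3 + K + M) := by rw [hm]; field_simp
    simp only [hφdef]
    linarith
  obtain ⟨f, f', f'', hf, hf', hf'', hfper, hfM, hfodd, hfnn, hfbig⟩ := exists_odd_step hL hδ0
    (by linarith : δ < L / 4) (by linarith : 0 < 3 + K) (by linarith : 3 + K < M)
  obtain ⟨u, huc, huper, hu0, hub, hureg, hueq⟩ := exists_solution hα hα0 hL hf hf' hf'' hfper hfM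
    (by positivity : 0 < 3 * t)
  have hφf : ∀ x ∈ Icc 0 ℓ, φ x ≤ f x := fun x hx => by
    rcases le_total x δ with h | h
    · exact (hφδ x h).trans (hfnn x hx)
    · exact (hφb x).trans (hfbig x ⟨h, hx.2⟩)
  have hx₀ℓ : x₀ ∈ Icc 0 ℓ := ⟨hx₀0.le, by linarith⟩
  have hright : 1 ≤ u x₀ (2 * t) := by
    have := barrier_le hα hα0 hℓ0 (by positivity : 0 ≤ 2 * t) (by linarith : 2 * t < 3 * t) hc0.le
      hφ hφψ huc hureg hueq hub hφ0 hφ1 (fun x hx => by rw [hu0]; exact hφf x hx) x₀ hx₀ℓ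
    rw [hφx₀] at this
    linarith
  have hleft : 1 ≤ -u (-x₀) (2 * t) := by
    have := barrier_le (u := fun x s => -1 * u (-1 * x) (s + 0)) hα hα0 hℓ0
      (by positivity : 0 ≤ 2 * t) (by linarith : 2 * t < 3 * t) hc0.le hφ hφψ ?_
      (hureg.rescale (-1) (-1) fun s hs => by simpa using hs) ?_ (M := M) ?_ hφ0 hφ1 ?_ x₀ hx₀ℓ
    · rw [hφx₀] at this
      simp only [add_zero, neg_mul, one_mul] at this
      linarith
    · simp only [add_zero]
      exact continuousOn_const.mul (huc.comp (f := fun z : ℝ × ℝ => (-1 * z.1, z.2)) (by fun_prop)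
        fun z hz => ⟨mem_univ _, hz.2⟩)
    · intro x s hs
      rw [pderivX_rescale, pderivXX_rescale, pderivT_rescale, add_zero, hueq _ s hs]
      norm_num
    · intro x s hs
      simpa using hub (-x) s hs
    · intro x hx
      simp only [add_zero, neg_mul, one_mul, hu0, hfodd, neg_neg]
      exact hφf x hx
  have hmem : ∀ s ∈ Icc 0 t, s + t ∈ Ioo 0 (3 * t) := fun s hs =>
    ⟨by linarith [hs.1], by linarith [hs.2]⟩
  refine ⟨fun x s => 1 * u (1 * x) (s + t), hureg.rescale 1 1 hmem, ?_, ?_, ?_, ?_⟩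
  · intro x s hs
    rw [pderivX_rescale, pderivXX_rescale, pderivT_rescale, hueq _ _ (hmem s hs)]
    norm_num
  · intro x s
    simp only [one_mul, huper]
  · intro x s hs
    simpa using hub x (s + t) (Ioo_subset_Icc_self (hmem s hs))
  · have hd : ∀ z, HasDerivAt (fun z => u z (2 * t)) (pderivX u z (2 * t)) z := fun z =>
      hureg.hasDerivAt_x ⟨mem_univ _, by linarith, by linarith⟩
    obtain ⟨z, -, hz⟩ := exists_hasDerivAt_eq_slope (fun z => u z (2 * t)) _
      (by linarith : -x₀ < x₀)
      (continuousOn_of_forall_continuousAt fun z _ => (hd z).continuousAt) fun z _ => hd z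
    refine ⟨z, ?_⟩
    rw [pderivX_rescale, one_mul, one_mul, one_mul, show t + t = 2 * t by ring, hz,
      lt_div_iff₀ (by linarith)]
    have : C * x₀ < 1 := by
      rw [hx₀, ← mul_div_assoc, div_lt_one hn0]
      exact hnC
    linarith

theorem tendsto_integral_atTop_of_pderivX_le (hα : Continuous α) (hα0 : ∀ p, 0 < α p) {L : ℝ}
    (hL : 0 < L)
    (h : ∀ M : ℝ, 0 < M → ∀ t : ℝ, 0 < t → ∃ C : ℝ, ∀ u : ℝ → ℝ → ℝ,
      RegularOn u (univ ×ˢ Icc 0 t) →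
      (∀ x, ∀ s ∈ Icc 0 t, pderivT u x s = α (pderivX u x s) * pderivXX u x s) →
      (∀ x s, u (x + L) s = u x s) → (∀ x, ∀ s ∈ Icc 0 t, |u x s| ≤ M) →
      ∀ z, pderivX u z t ≤ C) :
    Tendsto (fun ξ => ∫ s in (0 : ℝ)..ξ, s * α s) atTop atTop := by
  by_contra hB
  obtain ⟨K, hK⟩ : ∃ K, ∀ ξ, 0 ≤ ξ → ∫ p in (0 : ℝ)..ξ, p * α p ≤ K := by
    by_contra! hcon
    refine hB (tendsto_atTop_atTop.2 fun b => ?_)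
    obtain ⟨ξ, hξ, hb⟩ := hcon b
    refine ⟨ξ, fun y hy => hb.le.trans ?_⟩
    have hintegrable : ∀ x y, IntervalIntegrable (fun p => p * α p) volume x y := fun x y =>
      (continuous_id.mul hα).intervalIntegrable x y
    rw [← intervalIntegral.integral_add_adjacent_intervals (hintegrable 0 ξ) (hintegrable ξ y)]
    exact le_add_of_nonneg_right (intervalIntegral.integral_nonneg hy fun p hp =>
      mul_nonneg (hξ.trans hp.1) (hα0 p).le)
  obtain ⟨M, hM, t, ht, hsteep⟩ := exists_steep_solution hα hα0 hL hK
  obtain ⟨C, hC⟩ := h M hM t ht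
  obtain ⟨u, hu, heq, hper, hb, z, hz⟩ := hsteep C
  exact absurd (hC u hu heq hper hb z) (not_le.2 hz)

theorem tendsto_integral_comp_neg_iff :
    Tendsto (fun ξ => ∫ s in (0 : ℝ)..ξ, s * α (-s)) atTop atTop ↔
      Tendsto (fun ξ => ∫ s in (0 : ℝ)..ξ, s * α s) atBot atTop := by
  have h : ∀ ξ, ∫ s in (0 : ℝ)..ξ, s * α (-s) = ∫ s in (0 : ℝ)..(-ξ), s * α s := fun ξ => by
    have h1 := intervalIntegral.integral_comp_neg (a := 0) (b := ξ) fun s => s * α s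
    rw [neg_zero, intervalIntegral.integral_symm 0 (-ξ)] at h1
    rw [← neg_inj, ← h1, ← intervalIntegral.integral_neg]
    simp
  simp only [h]
  rw [← map_neg_atTop, tendsto_map'_iff]
  rfl

theorem reflect_solution {u : ℝ → ℝ → ℝ} {I : Set ℝ} {L M : ℝ}
    (hu : RegularOn u (univ ×ˢ I))
    (heq : ∀ x, ∀ s ∈ I, pderivT u x s = α (pderivX u x s) * pderivXX u x s)
    (hper : ∀ x s, u (x + L) s = u x s) (hb : ∀ x, ∀ s ∈ I, |u x s| ≤ M) :
    ∃ v : ℝ → ℝ → ℝ, RegularOn v (univ ×ˢ I) ∧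
      (∀ x, ∀ s ∈ I, pderivT v x s = α (-pderivX v x s) * pderivXX v x s) ∧
      (∀ x s, v (x + L) s = v x s) ∧ (∀ x, ∀ s ∈ I, |v x s| ≤ M) ∧
      ∀ x s, pderivX v x s = -pderivX u (-x) s := by
  refine ⟨fun x s => 1 * u (-1 * x) (s + 0), hu.rescale 1 (-1) (by simp), ?_, ?_, ?_, ?_⟩
  · intro x s hs
    rw [pderivX_rescale, pderivXX_rescale, pderivT_rescale, add_zero, heq _ s hs]
    norm_num
  · intro x s
    have := hper (-(x + L)) (s + 0)
    rw [neg_add, neg_add_cancel_right] at this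
    simp only [one_mul, neg_mul, neg_add]
    exact this.symm
  · intro x s hs
    simpa using hb (-x) s hs
  · intro x s
    rw [pderivX_rescale]
    simp

end Necessity

theorem lipschitz_bound_characterization
    (α : ℝ → ℝ) (hα : Continuous α) (hαpos : ∀ p, 0 < α p)
    (L : ℝ) (hL : 0 < L) :
    (∀ M : ℝ, 0 < M → ∀ t : ℝ, 0 < t → ∃ C : ℝ,
      ∀ u : ℝ → ℝ → ℝ,
        RegularOn u (univ ×ˢ Icc 0 t) →
        (∀ x : ℝ, ∀ s ∈ Icc (0:ℝ) t,
          pderivT u x s = α (pderivX u x s) * pderivXX u x s) →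
        (∀ x s : ℝ, u (x + L) s = u x s) →
        (∀ x : ℝ, ∀ s ∈ Icc (0:ℝ) t, |u x s| ≤ M) →
        ∀ z : ℝ, |pderivX u z t| ≤ C) ↔
    (Tendsto (fun ξ => ∫ s in (0:ℝ)..ξ, s * α s) atTop atTop ∧
     Tendsto (fun ξ => ∫ s in (0:ℝ)..ξ, s * α s) atBot atTop) := by
  have hα' : Continuous fun p => α (-p) := hα.comp continuous_neg
  constructor
  · intro h
    refine ⟨tendsto_integral_atTop_of_pderivX_le hα hαpos hL fun M hM t ht => ?_,
      tendsto_integral_comp_neg_iff.1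
        (tendsto_integral_atTop_of_pderivX_le hα' (fun p => hαpos _) hL fun M hM t ht => ?_)⟩
    · obtain ⟨C, hC⟩ := h M hM t ht
      exact ⟨C, fun u hu heq hper hb z => (le_abs_self _).trans (hC u hu heq hper hb z)⟩
    · obtain ⟨C, hC⟩ := h M hM t ht
      refine ⟨C, fun u hu heq hper hb z => ?_⟩
      obtain ⟨v, hv, hveq, hvper, hvb, hvx⟩ := reflect_solution (α := fun p => α (-p)) hu heq hper hb
      simp only [neg_neg] at hveq
      have := hC v hv hveq hvper hvb (-z)
      rw [hvx, neg_neg, abs_neg] at this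
      exact (le_abs_self _).trans this
  · rintro ⟨htop, hbot⟩ M hM t ht
    obtain ⟨C₁, hC₁⟩ := exists_pderivX_le hα hαpos hL hM ht htop
    obtain ⟨C₂, hC₂⟩ := exists_pderivX_le hα' (fun p => hαpos _) hL hM ht
      (tendsto_integral_comp_neg_iff.2 hbot)
    refine ⟨max C₁ C₂, fun u hu heq hper hb z => abs_le'.2 ⟨?_, ?_⟩⟩
    · exact (hC₁ u hu heq hper hb z).trans (le_max_left _ _)
    · obtain ⟨v, hv, hveq, hvper, hvb, hvx⟩ := reflect_solution hu heq hper hb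
      have := hC₂ v hv hveq hvper hvb (-z)
      rw [hvx, neg_neg] at this
      exact this.trans (le_max_right _ _)
end

section
/- There exists a universal constant C with the following property. Let 0 < λ ≤ Λ, let α : ℝ → ℝ be continuous with λ ≤ α(p) ≤ Λ for all p, let R, M > 0, and let u be a regular solution of ∂_t u = α(∂_x u) ∂²_x u on Q_R = (−R,R) × (−R²,0] with osc u ≤ M. Then |∂_x u(x,t)| ≤ C ((1+Λ)/λ)^{1/2} M/R for all (x,t) ∈ Q_{R/2} = (−R/2, R/2) × (−R²/4, 0]. -/
open Set Real Filter

/-- A function bounded above by its value at `a` to the left of `a` has nonnegative derivative. -/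
theorem HasDerivAt.nonneg_of_eventually_le_left {f : ℝ → ℝ} {f' a : ℝ} (hf : HasDerivAt f f' a)
    (h : ∀ᶠ x in nhdsWithin a (Iio a), f x ≤ f a) : 0 ≤ f' := by
  have hs := (hasDerivAt_iff_tendsto_slope.1 hf).mono_left
    (nhdsWithin_mono (s := Iio a) (t := {a}ᶜ) a (fun x (hx : x < a) => hx.ne))
  refine ge_of_tendsto hs ?_
  filter_upwards [h, self_mem_nhdsWithin] with x hx hxa
  rw [slope_def_field]
  exact div_nonneg_of_nonpos (by linarith) (by linarith [show x < a from hxa])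

/-- A function bounded above by its value at `a` to the right of `a` has nonpositive derivative. -/
theorem HasDerivAt.nonpos_of_eventually_le_right {f : ℝ → ℝ} {f' a : ℝ} (hf : HasDerivAt f f' a)
    (h : ∀ᶠ x in nhdsWithin a (Ioi a), f x ≤ f a) : f' ≤ 0 := by
  have hs := (hasDerivAt_iff_tendsto_slope.1 hf).mono_left
    (nhdsWithin_mono (s := Ioi a) (t := {a}ᶜ) a (fun x (hx : a < x) => hx.ne'))
  refine le_of_tendsto hs ?_
  filter_upwards [h, self_mem_nhdsWithin] with x hx hxa
  rw [slope_def_field]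
  exact div_nonpos_of_nonpos_of_nonneg (by linarith) (by linarith [show a < x from hxa])

/-- Second order necessary condition at a local maximum. -/
theorem IsLocalMax.second_deriv_nonpos_s18 {f g : ℝ → ℝ} {a c : ℝ} (h : IsLocalMax f a)
    (hf : ∀ᶠ x in nhds a, HasDerivAt f (g x) x) (hg : HasDerivAt g c a) : c ≤ 0 := by
  by_contra! hc
  have hd : deriv f =ᶠ[nhds a] g := hf.mono fun x hx => hx.deriv
  have hmin : IsLocalMin f a := by
    apply isLocalMin_of_deriv_deriv_pos
    · rwa [hd.deriv_eq, hg.deriv]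
    · exact h.deriv_eq_zero
    · exact hf.self_of_nhds.continuousAt
  have hconst : f =ᶠ[nhds a] fun _ => f a := by
    filter_upwards [h, hmin] with x h1 h2 using le_antisymm h1 h2
  have hg0 : g =ᶠ[nhds a] fun _ => 0 := by
    filter_upwards [hconst.eventuallyEq_nhds, hf] with x h1 h2
    exact h2.unique ((hasDerivAt_const x (f a)).congr_of_eventuallyEq h1)
  have := hg.unique ((hasDerivAt_const a (0 : ℝ)).congr_of_eventuallyEq hg0)
  linarith

/-- A product bound for a factor `a ≥ lam` and a factor below a nonpositive number. -/
theorem mul_le_neg_mul {lam a k l z : ℝ} (hlam : 0 ≤ lam) (hkl : k ≤ l) (ha : lam ≤ a)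
    (hz : z ≤ -(l - k)) : a * z ≤ -(lam * (l - k)) := by
  have h1 := mul_le_mul_of_nonneg_left hz (hlam.trans ha)
  have h2 := mul_le_mul_of_nonneg_right ha (sub_nonneg.2 hkl)
  linarith

set_option maxHeartbeats 1000000 in
/-- Doubling of variables: the difference `u x t - u y t` stays below a quadratic barrier which is
concave in `x - y`. -/
theorem sub_le_barrier {u ux uxx ut : ℝ → ℝ → ℝ} {lam K B m n r T s M x₀ t₀ : ℝ}
    (hlam : 0 < lam) (hB : 0 < B) (hm : 0 < m) (hn : 0 < n) (hs : 0 < s)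
    (hmr : m * r ^ 2 = M) (hnT : n * T = M) (hK : K = B * s) (hBs : B * s ^ 2 / 2 = M)
    (hAm : 2 * m < B) (hA : n < 2 * (lam * (B - 2 * m)))
    (hu : ContinuousOn (fun p : ℝ × ℝ => u p.1 p.2)
      (Icc (x₀ - r) (x₀ + r) ×ˢ Icc (t₀ - T) t₀))
    (hux : ∀ x ∈ Icc (x₀ - r) (x₀ + r), ∀ t ∈ Icc (t₀ - T) t₀,
      HasDerivAt (fun y => u y t) (ux x t) x)
    (huxx : ∀ x ∈ Icc (x₀ - r) (x₀ + r), ∀ t ∈ Icc (t₀ - T) t₀,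
      HasDerivAt (fun y => ux y t) (uxx x t) x)
    (hut : ∀ x ∈ Icc (x₀ - r) (x₀ + r), ∀ t ∈ Icc (t₀ - T) t₀,
      HasDerivAt (fun τ => u x τ) (ut x t) t)
    (heq : ∀ x ∈ Icc (x₀ - r) (x₀ + r), ∀ t ∈ Icc (t₀ - T) t₀,
      ∃ a, lam ≤ a ∧ ut x t = a * uxx x t)
    (hosc : ∀ x ∈ Icc (x₀ - r) (x₀ + r), ∀ y ∈ Icc (x₀ - r) (x₀ + r), ∀ t ∈ Icc (t₀ - T) t₀,
      u x t - u y t ≤ M) :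
    ∀ x ∈ Icc (x₀ - r) (x₀ + r), ∀ y ∈ Icc (x₀ - r) (x₀ + r), ∀ t ∈ Icc (t₀ - T) t₀,
      0 ≤ x - y → x - y ≤ s →
      u x t - u y t ≤ K * (x - y) - B / 2 * (x - y) ^ 2 + m * ((x - x₀) ^ 2 + (y - x₀) ^ 2)
        + n * (t₀ - t) := by
  set I := Icc (x₀ - r) (x₀ + r) with hI
  set J := Icc (t₀ - T) t₀ with hJ
  set F : ℝ × ℝ × ℝ → ℝ := fun p => u p.1 p.2.2 - u p.2.1 p.2.2 -
    (K * (p.1 - p.2.1) - B / 2 * (p.1 - p.2.1) ^ 2 + m * ((p.1 - x₀) ^ 2 + (p.2.1 - x₀) ^ 2)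
        + n * (t₀ - p.2.2)) with hF
  set D : Set (ℝ × ℝ × ℝ) := (I ×ˢ I ×ˢ J) ∩ {p | 0 ≤ p.1 - p.2.1 ∧ p.1 - p.2.1 ≤ s} with hD
  have hDc : IsCompact D := by
    refine (isCompact_Icc.prod (isCompact_Icc.prod isCompact_Icc)).inter_right ?_
    have hsub : Continuous fun p : ℝ × ℝ × ℝ => p.1 - p.2.1 := by fun_prop
    exact (isClosed_le continuous_const hsub).inter (isClosed_le hsub continuous_const)
  have hFc : ContinuousOn F D := by
    have h1 : ContinuousOn (fun p : ℝ × ℝ × ℝ => u p.1 p.2.2) D :=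
      hu.comp (f := fun p : ℝ × ℝ × ℝ => (p.1, p.2.2)) (by fun_prop)
        fun p hp => ⟨hp.1.1, hp.1.2.2⟩
    have h2 : ContinuousOn (fun p : ℝ × ℝ × ℝ => u p.2.1 p.2.2) D :=
      hu.comp (f := fun p : ℝ × ℝ × ℝ => (p.2.1, p.2.2)) (by fun_prop)
        fun p hp => ⟨hp.1.2.1, hp.1.2.2⟩
    exact (h1.sub h2).sub (by fun_prop)
  intro x' hx' y' hy' t' ht' h0' hs'
  by_contra! hlt
  have hmem' : ((x', y', t') : ℝ × ℝ × ℝ) ∈ D := ⟨⟨hx', hy', ht'⟩, h0', hs'⟩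
  obtain ⟨⟨x, y, t⟩, hmem, hmax⟩ := hDc.exists_isMaxOn ⟨_, hmem'⟩ hFc
  have hFpos : 0 < F (x, y, t) := by
    refine lt_of_lt_of_le ?_ (hmax hmem')
    simp only [hF]; linarith
  obtain ⟨⟨hx, hy, ht⟩, h0, hxs⟩ := hmem
  simp only at hx hy ht h0 hxs
  have hFpos' : 0 < u x t - u y t - (K * (x - y) - B / 2 * (x - y) ^ 2 +
    (m * (x - x₀) ^ 2 + m * (y - x₀) ^ 2) + n * (t₀ - t)) := by
    rw [← mul_add]; exact hFpos
  have hoxy := hosc x hx y hy t ht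
  have hψ : 0 ≤ K * (x - y) - B / 2 * (x - y) ^ 2 := by
    have : K * (x - y) - B / 2 * (x - y) ^ 2 = B * ((x - y) * (s - (x - y) / 2)) := by
      rw [hK]; ring
    rw [this]
    exact mul_nonneg hB.le (mul_nonneg h0 (by linarith))
  have hmx : 0 ≤ m * (x - x₀) ^ 2 := by positivity
  have hmy : 0 ≤ m * (y - x₀) ^ 2 := by positivity
  have hnt : 0 ≤ n * (t₀ - t) := mul_nonneg hn.le (by linarith [ht.2])
  have hxy : 0 < x - y := by
    refine lt_of_le_of_ne h0 fun h => ?_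
    obtain rfl : x = y := by linarith
    linarith
  have hxy' : x - y < s := by
    refine lt_of_le_of_ne hxs fun h => ?_
    have hM : K * s - B / 2 * s ^ 2 = M := by rw [hK, ← hBs]; ring
    rw [h] at hFpos'
    linarith
  have hend : ∀ z ∈ I, m * (z - x₀) ^ 2 < M → z ∈ Ioo (x₀ - r) (x₀ + r) := by
    intro z hz hzM
    refine ⟨lt_of_le_of_ne hz.1 fun h => ?_, lt_of_le_of_ne hz.2 fun h => ?_⟩
    · rw [← h, sub_sub_cancel_left, neg_sq] at hzM; linarith
    · rw [h, add_sub_cancel_left] at hzM; linarith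
  have hxo := hend x hx (by linarith)
  have hyo := hend y hy (by linarith)
  have hto : t₀ - T < t := by
    refine lt_of_le_of_ne ht.1 fun h => ?_
    rw [← h, sub_sub_cancel, hnT] at hFpos'
    rw [← h] at hoxy
    linarith
  have hIx : ∀ᶠ z in nhds x, z ∈ I := Icc_mem_nhds hxo.1 hxo.2
  have hIy : ∀ᶠ z in nhds y, z ∈ I := Icc_mem_nhds hyo.1 hyo.2
  have hxx : uxx x t - (2 * m - B) ≤ 0 := by
    refine IsLocalMax.second_deriv_nonpos_s18 (f := fun z => F (z, y, t))
      (g := fun z => ux z t - (K - B * (z - y) + 2 * m * (z - x₀))) (a := x) ?_ ?_ ?_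
    · filter_upwards [hIx, Ioo_mem_nhds (show y < x by linarith) (show x < y + s by linarith)]
        with z hz hzy
      exact hmax ⟨⟨hz, hy, ht⟩, by linarith [hzy.1], by linarith [hzy.2]⟩
    · filter_upwards [hIx] with z hz
      have hp : HasDerivAt (fun z : ℝ => z) 1 z := hasDerivAt_id z
      have := ((hux z hz t ht).sub_const (u y t)).sub
        ((((((hp.sub_const y).const_mul K).sub (((hp.sub_const y).pow 2).const_mul (B / 2))).add
        ((((hp.sub_const x₀).pow 2).add_const ((y - x₀) ^ 2)).const_mul m)).add_const
        (n * (t₀ - t))))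
      refine this.congr_deriv ?_
      push_cast
      ring
    · have hp : HasDerivAt (fun z : ℝ => z) 1 x := hasDerivAt_id x
      have := (huxx x hx t ht).sub
        ((((hp.sub_const y).const_mul B).const_sub K).add ((hp.sub_const x₀).const_mul (2 * m)))
      exact this.congr_deriv (by ring)
  have hyy : -uxx y t - (2 * m - B) ≤ 0 := by
    refine IsLocalMax.second_deriv_nonpos_s18 (f := fun z => F (x, z, t))
      (g := fun z => -ux z t - (-K + B * (x - z) + 2 * m * (z - x₀))) (a := y) ?_ ?_ ?_
    · filter_upwards [hIy, Ioo_mem_nhds (show x - s < y by linarith) (show y < x by linarith)]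
        with z hz hzy
      exact hmax ⟨⟨hx, hz, ht⟩, by linarith [hzy.2], by linarith [hzy.1]⟩
    · filter_upwards [hIy] with z hz
      have hp : HasDerivAt (fun z : ℝ => z) 1 z := hasDerivAt_id z
      have := ((hux z hz t ht).const_sub (u x t)).sub
        ((((((hp.const_sub x).const_mul K).sub (((hp.const_sub x).pow 2).const_mul (B / 2))).add
        ((((hp.sub_const x₀).pow 2).const_add ((x - x₀) ^ 2)).const_mul m)).add_const
        (n * (t₀ - t))))
      refine this.congr_deriv ?_
      push_cast
      ring
    · have hp : HasDerivAt (fun z : ℝ => z) 1 y := hasDerivAt_id y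
      have := (huxx y hy t ht).neg.sub
        ((((hp.const_sub x).const_mul B).const_add (-K)).add
          ((hp.sub_const x₀).const_mul (2 * m)))
      exact this.congr_deriv (by ring)
  have htt : 0 ≤ ut x t - ut y t + n := by
    refine HasDerivAt.nonneg_of_eventually_le_left (f := fun τ => F (x, y, τ)) (a := t) ?_ ?_
    · have hp : HasDerivAt (fun z : ℝ => z) 1 t := hasDerivAt_id t
      have := ((hut x hx t ht).sub (hut y hy t ht)).sub
        (((hp.const_sub t₀).const_mul n).const_add
          (K * (x - y) - B / 2 * (x - y) ^ 2 + m * ((x - x₀) ^ 2 + (y - x₀) ^ 2)))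
      exact this.congr_deriv (by ring)
    · filter_upwards [Ioo_mem_nhdsLT hto] with τ hτ
      exact hmax ⟨⟨hx, hy, hτ.1.le, hτ.2.le.trans ht.2⟩, h0, hxs⟩
  obtain ⟨a, ha, hax⟩ := heq x hx t ht
  obtain ⟨b, hb, hby⟩ := heq y hy t ht
  rw [hax, hby] at htt
  have h1 := mul_le_neg_mul hlam.le hAm.le ha (show uxx x t ≤ -(B - 2 * m) by linarith only [hxx])
  have h2 := mul_le_neg_mul hlam.le hAm.le hb (show -uxx y t ≤ -(B - 2 * m) by linarith only [hyy])
  linarith only [h1, h2, htt, hA]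

/-- One-sided interior gradient bound. -/
theorem spatial_deriv_le {u ux uxx ut : ℝ → ℝ → ℝ} {lam R M x₀ t₀ : ℝ}
    (hlam : 0 < lam) (hR : 0 < R) (hM : 0 < M)
    (hx₀ : x₀ ∈ Ioo (-(R / 2)) (R / 2)) (ht₀ : t₀ ∈ Ioc (-(R ^ 2 / 4)) 0)
    (hu : ContinuousOn (fun p : ℝ × ℝ => u p.1 p.2) (Ioo (-R) R ×ˢ Ioc (-(R ^ 2)) 0))
    (hux : ∀ x ∈ Ioo (-R) R, ∀ t ∈ Ioc (-(R ^ 2)) 0, HasDerivAt (fun y => u y t) (ux x t) x)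
    (huxx : ∀ x ∈ Ioo (-R) R, ∀ t ∈ Ioc (-(R ^ 2)) 0, HasDerivAt (fun y => ux y t) (uxx x t) x)
    (hut : ∀ x ∈ Ioo (-R) R, ∀ t ∈ Ioc (-(R ^ 2)) 0, HasDerivAt (fun τ => u x τ) (ut x t) t)
    (heq : ∀ x ∈ Ioo (-R) R, ∀ t ∈ Ioc (-(R ^ 2)) 0, ∃ a, lam ≤ a ∧ ut x t = a * uxx x t)
    (hosc : ∀ x ∈ Ioo (-R) R, ∀ y ∈ Ioo (-R) R, ∀ t ∈ Ioc (-(R ^ 2)) 0, u x t - u y t ≤ M) :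
    ux x₀ t₀ ≤ √(16 + 4 / lam) * M / R := by
  set q := √(16 + 4 / lam) with hq
  have hq0 : 0 < q := by positivity
  have hq2 : q ^ 2 = 16 + 4 / lam := Real.sq_sqrt (by positivity)
  have hR2 : 0 < R ^ 2 := by positivity
  have hI : Icc (x₀ - R / 2) (x₀ + R / 2) ⊆ Ioo (-R) R := fun x hx =>
    ⟨by linarith [hx.1, hx₀.1], by linarith [hx.2, hx₀.2]⟩
  have hJ : Icc (t₀ - R ^ 2 / 2) t₀ ⊆ Ioc (-(R ^ 2)) 0 := fun t ht =>
    ⟨by linarith [ht.1, ht₀.1], by linarith [ht.2, ht₀.2]⟩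
  have hBA : M * q ^ 2 / (2 * R ^ 2) - 2 * (4 * M / R ^ 2) = 2 * M / (lam * R ^ 2) := by
    rw [hq2]; field_simp; ring
  have hs : 0 < 2 * R / q := by positivity
  have key := sub_le_barrier (u := u) (ux := ux) (uxx := uxx) (ut := ut) (lam := lam)
    (K := q * M / R) (B := M * q ^ 2 / (2 * R ^ 2)) (m := 4 * M / R ^ 2) (n := 2 * M / R ^ 2)
    (r := R / 2) (T := R ^ 2 / 2) (s := 2 * R / q) (M := M) (x₀ := x₀) (t₀ := t₀)
    hlam (by positivity) (by positivity) (by positivity) hs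
    (by field_simp; norm_num) (by field_simp) (by field_simp) (by field_simp)
    (by have : 0 < 2 * M / (lam * R ^ 2) := by positivity
        linarith)
    (by have h4 : 2 * (lam * (2 * M / (lam * R ^ 2))) = 2 * (2 * M / R ^ 2) := by field_simp
        have : 0 < 2 * M / R ^ 2 := by positivity
        rw [hBA, h4]; linarith)
    (hu.mono (prod_mono hI hJ))
    (fun x hx t ht => hux x (hI hx) t (hJ ht)) (fun x hx t ht => huxx x (hI hx) t (hJ ht))
    (fun x hx t ht => hut x (hI hx) t (hJ ht)) (fun x hx t ht => heq x (hI hx) t (hJ ht))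
    (fun x hx y hy t ht => hosc x (hI hx) y (hI hy) t (hJ ht))
  have hx₀I : x₀ ∈ Icc (x₀ - R / 2) (x₀ + R / 2) := ⟨by linarith, by linarith⟩
  have ht₀J : t₀ ∈ Icc (t₀ - R ^ 2 / 2) t₀ := ⟨by linarith, le_rfl⟩
  have hB : 0 < M * q ^ 2 / (2 * R ^ 2) := by positivity
  have hd : HasDerivAt (fun x => u x t₀ - (q * M / R * (x - x₀) + 4 * M / R ^ 2 * (x - x₀) ^ 2))
      (ux x₀ t₀ - q * M / R) x₀ := by
    have hp : HasDerivAt (fun z : ℝ => z) 1 x₀ := hasDerivAt_id x₀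
    have := (hux x₀ (hI hx₀I) t₀ (hJ ht₀J)).sub (((hp.sub_const x₀).const_mul (q * M / R)).add
      (((hp.sub_const x₀).pow 2).const_mul (4 * M / R ^ 2)))
    refine this.congr_deriv ?_
    simp
  have := hd.nonpos_of_eventually_le_right (by
    filter_upwards [Ioo_mem_nhdsGT (show x₀ < x₀ + R / 2 by linarith),
      Ioo_mem_nhdsGT (show x₀ < x₀ + 2 * R / q by linarith)] with x h1 h2
    have h3 := key x ⟨by linarith [h1.1], h1.2.le⟩ x₀ hx₀I t₀ ht₀J (by linarith [h1.1])
      (by linarith [h2.2])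
    have h5 : 0 ≤ M * q ^ 2 / (2 * R ^ 2) / 2 * (x - x₀) ^ 2 := by positivity
    simp only [sub_self] at h3 ⊢
    nlinarith)
  linarith

theorem interior_gradient_estimate :
    ∃ C : ℝ, 0 < C ∧
      ∀ (lam Lam : ℝ), 0 < lam → lam ≤ Lam →
      ∀ α : ℝ → ℝ, Continuous α → (∀ p, lam ≤ α p ∧ α p ≤ Lam) →
      ∀ (R M : ℝ), 0 < R → 0 < M →
      ∀ u : ℝ → ℝ → ℝ,
        RegularOn u (Ioo (-R) R ×ˢ Ioc (-(R^2)) 0) →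
        (∀ x t : ℝ, x ∈ Ioo (-R) R → t ∈ Ioc (-(R^2)) 0 →
          pderivT u x t = α (pderivX u x t) * pderivXX u x t) →
        (∀ x y t s : ℝ, x ∈ Ioo (-R) R → t ∈ Ioc (-(R^2)) 0 →
          y ∈ Ioo (-R) R → s ∈ Ioc (-(R^2)) 0 → u y s - u x t ≤ M) →
        ∀ x t : ℝ, x ∈ Ioo (-(R/2)) (R/2) → t ∈ Ioc (-(R^2/4)) 0 →
          |pderivX u x t| ≤ C * Real.sqrt ((1 + Lam) / lam) * M / R := by
  refine ⟨4, by norm_num, ?_⟩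
  intro lam Lam hlam hLam α _ hα R M hR hM u hu hpde hosc x t hx ht
  obtain ⟨hc, h1, h2, h3, -⟩ := hu
  have hux : ∀ x ∈ Ioo (-R) R, ∀ t ∈ Ioc (-(R ^ 2)) 0,
      HasDerivAt (fun y => u y t) (pderivX u x t) x :=
    fun x hx t ht => (h1 (x, t) ⟨hx, ht⟩).hasDerivAt
  have huxx : ∀ x ∈ Ioo (-R) R, ∀ t ∈ Ioc (-(R ^ 2)) 0,
      HasDerivAt (fun y => pderivX u y t) (pderivXX u x t) x :=
    fun x hx t ht => (h2 (x, t) ⟨hx, ht⟩).hasDerivAt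
  have hut : ∀ x ∈ Ioo (-R) R, ∀ t ∈ Ioc (-(R ^ 2)) 0,
      HasDerivAt (fun τ => u x τ) (pderivT u x t) t :=
    fun x hx t ht => (h3 (x, t) ⟨hx, ht⟩).hasDerivAt
  have hupper := spatial_deriv_le hlam hR hM hx ht hc hux huxx hut
    (fun x hx t ht => ⟨_, (hα (pderivX u x t)).1, hpde x t hx ht⟩)
    (fun x hx y hy t ht => hosc y x t t hy ht hx ht)
  have hlower := spatial_deriv_le (u := fun x t => -u x t) (ux := fun x t => -pderivX u x t)
    (uxx := fun x t => -pderivXX u x t) (ut := fun x t => -pderivT u x t) hlam hR hM hx ht hc.neg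
    (fun x hx t ht => (hux x hx t ht).neg) (fun x hx t ht => (huxx x hx t ht).neg)
    (fun x hx t ht => (hut x hx t ht).neg)
    (fun x hx t ht => ⟨_, (hα (pderivX u x t)).1, by rw [hpde x t hx ht]; ring⟩)
    (fun x hx y hy t ht => by linarith [hosc x y t t hx ht hy ht])
  have hsqrt : √(16 + 4 / lam) ≤ 4 * √((1 + Lam) / lam) := by
    rw [Real.sqrt_le_left (by positivity), mul_pow, Real.sq_sqrt (by
      have : 0 < Lam := hlam.trans_le hLam
      positivity)]
    have h4 : 16 + 4 / lam = (16 * lam + 4) / lam := by field_simp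
    rw [h4, ← mul_div_assoc]
    gcongr
    linarith
  have hbound : √(16 + 4 / lam) * M / R ≤ 4 * √((1 + Lam) / lam) * M / R := by gcongr
  exact abs_le.2 ⟨by linarith, by linarith⟩
end
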